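/- Let X be a finite undirected loopless graph, s ≥ 1 an integer, and suppose there is an injective map c from the integers {−r,…,r} (with r = 2s+1) to the vertices of X with c(0) = i such that for every k with |k| < r the edges of X incident to c(k) are exactly one edge joining c(k) to c(k−1) and one edge joining c(k) to c(k+1). Let X′ be the graph with vertex set (V(X) ∖ {i}) ⊔ {i′, i″} and edge set consisting of all edges of X not incident to i together with an edge c(−1)—i′, an edge i′—i″, and an edge i″—c(1). Let v, w : V(X) → ℕ be dimension vectors with w(c(k)) = 0 and v(c(k)) ≤ s for all |k| ≤ r, and define v′, w′ : V(X′) → ℕ by v′(j) = v(j), w′(j) = w(j) for j ∉ {i′, i″} (under the natural identification of vertices) and v′(i′) = v′(i″) = v(i), w′(i′) = w′(i″) = 0. Then there is a bijection between: (a) the set of isomorphism classes of stable nilpotent framed representations of X satisfying the moment map condition with dim V_j = v(j) and dim W_j = w(j) for all vertices j and with ε_{c(k)} = 0 for all |k| ≤ r, and (b) the set of isomorphism classes of stable nilpotent framed representations of X′ satisfying the moment map condition with dim V_j = v′(j) and dim W_j = w′(j) for all vertices j and with ε_j = 0 for all j on the path c(−r),…,c(−1), i′, i″, c(1),…,c(r);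 moreover the bijection preserves ε_j for every vertex j not on the path. -/

import Mathlib

noncomputable section

/-!
Finite undirected loopless (multi)graphs with a fixed orientation: each edge `e`
has a source `src e` and a target `tgt e`, and carries maps in both directions.
-/

structure Multigraph where
  V : Type
  E : Type
  [fintypeV : Fintype V]
  [fintypeE : Fintype E]
  [decEqV : DecidableEq V]
  src : E → V
  tgt : E → V
  loopless : ∀ e, src e ≠ tgt e

attribute [instance] Multigraph.fintypeV Multigraph.fintypeE Multigraph.decEqV

/-- The edge `e` joins the vertices `u` and `v` (in either direction). -/
def Multigraph.Joins (G : Multigraph) (e : G.E) (u v : G.V) : Prop :=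
  (G.src e = u ∧ G.tgt e = v) ∨ (G.src e = v ∧ G.tgt e = u)

/-- Directed edges: each edge in both directions. -/
def Multigraph.dsrc (G : Multigraph) : G.E ⊕ G.E → G.V := Sum.elim G.src G.tgt

def Multigraph.dtgt (G : Multigraph) : G.E ⊕ G.E → G.V := Sum.elim G.tgt G.src

/-- Transport of a fibre along an equality of vertices. -/
def castL {G : Multigraph} {v : G.V → ℕ} {i j : G.V} (h : i = j) :
    (Fin (v i) → ℂ) →ₗ[ℂ] (Fin (v j) → ℂ) := by subst h; exact LinearMap.id

/-- A framed representation of `G` with dimension vectors `v, w`, on the fixed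
vector spaces `V_i = ℂ^{v i}`, `W_i = ℂ^{w i}`: a map `x e` across each edge in
each direction, and a map `t i : V_i → W_i` at each vertex. -/
structure FramedRep (G : Multigraph) (v w : G.V → ℕ) where
  x : ∀ e : G.E, (Fin (v (G.src e)) → ℂ) →ₗ[ℂ] (Fin (v (G.tgt e)) → ℂ)
  xbar : ∀ e : G.E, (Fin (v (G.tgt e)) → ℂ) →ₗ[ℂ] (Fin (v (G.src e)) → ℂ)
  t : ∀ i : G.V, (Fin (v i) → ℂ) →ₗ[ℂ] (Fin (w i) → ℂ)

namespace FramedRep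

variable {G : Multigraph} {v w : G.V → ℕ}

/-- The map assigned to a directed edge. -/
def dmap (ρ : FramedRep G v w) :
    ∀ d : G.E ⊕ G.E, (Fin (v (G.dsrc d)) → ℂ) →ₗ[ℂ] (Fin (v (G.dtgt d)) → ℂ)
  | Sum.inl e => ρ.x e
  | Sum.inr e => ρ.xbar e

/-- Stability: the only subrepresentation `U` contained in `V` (i.e. invariant
under all the directed edge maps and contained in `ker t`) is zero. -/
def Stable (ρ : FramedRep G v w) : Prop :=
  ∀ U : ∀ i : G.V, Submodule ℂ (Fin (v i) → ℂ),
    (∀ d : G.E ⊕ G.E, (U (G.dsrc d)).map (ρ.dmap d) ≤ U (G.dtgt d)) →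
    (∀ i, U i ≤ LinearMap.ker (ρ.t i)) →
    ∀ i, U i = ⊥

/-- The endomorphism of the total space `⊕_i V_i` induced by a directed edge. -/
def edgeEnd (ρ : FramedRep G v w) (d : G.E ⊕ G.E) :
    Module.End ℂ (∀ i : G.V, Fin (v i) → ℂ) :=
  LinearMap.pi fun j =>
    if h : G.dtgt d = j then
      (castL h).comp ((ρ.dmap d).comp (LinearMap.proj (G.dsrc d)))
    else 0

/-- Nilpotency: some length `N` such that every composite of `N` of the
directed edge maps (along any path) vanishes. -/
def IsNilpotentRep (ρ : FramedRep G v w) : Prop :=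
  ∃ N : ℕ, ∀ L : List (G.E ⊕ G.E), L.length = N → (L.map ρ.edgeEnd).prod = 0

/-- The moment map condition at every vertex:
`Σ_{e : tgt e = i} x_e ∘ x_ē = Σ_{e : src e = i} x_ē ∘ x_e` on `V_i`. -/
def MomentMap (ρ : FramedRep G v w) : Prop :=
  ∀ i : G.V,
    (∑ e : G.E, if h : G.tgt e = i then
        (castL h).comp ((ρ.x e).comp ((ρ.xbar e).comp (castL h.symm))) else 0)
      =
    ∑ e : G.E, if h : G.src e = i then
        (castL h).comp ((ρ.xbar e).comp ((ρ.x e).comp (castL h.symm))) else 0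

/-- The sum of the ranges of all edge maps into the vertex `j`. -/
def rangeSup (ρ : FramedRep G v w) (j : G.V) : Submodule ℂ (Fin (v j) → ℂ) :=
  ⨆ d : G.E ⊕ G.E, ⨆ h : G.dtgt d = j, LinearMap.range ((castL h).comp (ρ.dmap d))

/-- `ε_j`: the codimension in `V_j` of the sum of the ranges of all incoming
edge maps. -/
def epsVal (ρ : FramedRep G v w) (j : G.V) : ℕ :=
  v j - Module.finrank ℂ (ρ.rangeSup j)

/-- Isomorphism of framed representations (on the same fixed spaces). -/
def Iso (ρ ρ' : FramedRep G v w) : Prop :=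
  ∃ g : ∀ i : G.V, (Fin (v i) → ℂ) ≃ₗ[ℂ] (Fin (v i) → ℂ),
    (∀ e : G.E, (g (G.tgt e)).toLinearMap.comp (ρ.x e)
        = (ρ'.x e).comp (g (G.src e)).toLinearMap) ∧
    (∀ e : G.E, (g (G.src e)).toLinearMap.comp (ρ.xbar e)
        = (ρ'.xbar e).comp (g (G.tgt e)).toLinearMap) ∧
    (∀ i : G.V, (ρ'.t i).comp (g i).toLinearMap = ρ.t i)

end FramedRep

/-! ### Ladders of subspaces -/

section Ladder

variable {K M : Type*} [Field K] [AddCommGroup M] [Module K M]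

/-- A finite ladder of subspaces `S 0, …, S n` with a raising operator `A` and a lowering
operator `B` which commute on the interior steps. -/
structure Ladder (A B : Module.End K M) (S : ℕ → Submodule K M) (n : ℕ) : Prop where
  mapA : ∀ k < n, ∀ u ∈ S k, A u ∈ S (k + 1)
  mapB : ∀ k < n, ∀ u ∈ S (k + 1), B u ∈ S k
  comm : ∀ k, 0 < k → k < n → ∀ u ∈ S k, A (B u) = B (A u)

namespace Ladder

variable {A B : Module.End K M} {S : ℕ → Submodule K M} {n : ℕ}

theorem reverse (h : Ladder A B S n) : Ladder B A (fun k => S (n - k)) n where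
  mapA k hk u hu := by
    refine h.mapB (n - (k + 1)) (by omega) u ?_
    rwa [show n - (k + 1) + 1 = n - k by omega]
  mapB k hk u hu := by
    have := h.mapA (n - (k + 1)) (by omega) u hu
    rwa [show n - (k + 1) + 1 = n - k by omega] at this
  comm k h0 hk u hu := (h.comm (n - k) (by omega) (by omega) u hu).symm

theorem pow_mem (h : Ladder A B S n) {k j : ℕ} (hkj : k + j ≤ n) {u : M} (hu : u ∈ S k) :
    (A ^ j) u ∈ S (k + j) := by
  induction j with
  | zero => simpa using hu
  | succ j ih =>
    rw [pow_succ', Module.End.mul_apply]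
    exact h.mapA (k + j) (by omega) _ (ih (by omega))

theorem mul_pow_apply (h : Ladder A B S n) {j : ℕ} (hj : j < n) {u : M} (hu : u ∈ S 0) :
    B (A ((A ^ j) u)) = (A ^ j) (B (A u)) := by
  induction j with
  | zero => simp
  | succ j ih =>
    rw [pow_succ', Module.End.mul_apply, Module.End.mul_apply, ← ih (by omega)]
    refine (h.comm (j + 1) (by omega) hj _ ?_).symm
    have := h.pow_mem (k := 0) (j := j + 1) (by omega) hu
    rwa [pow_succ', Module.End.mul_apply, zero_add] at this

theorem mul_mem_map_pow (h : Ladder A B S n) {j : ℕ} (hj : j < n) {u : M}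
    (hu : u ∈ (S 0).map (A ^ j)) : B (A u) ∈ (S 0).map (A ^ j) := by
  obtain ⟨z, hz, rfl⟩ := hu
  exact ⟨_, h.mapB 0 (by omega) _ (h.mapA 0 (by omega) _ hz), (h.mul_pow_apply hj hz).symm⟩

theorem pow_pow_apply (h : Ladder A B S n) {j : ℕ} (hj : j ≤ n) {u : M} (hu : u ∈ S 0) :
    (B ^ j) ((A ^ j) u) = ((B * A) ^ j) u := by
  induction j generalizing u with
  | zero => simp
  | succ j ih =>
    have h1 : B (A u) ∈ S 0 := h.mapB 0 (by omega) _ (h.mapA 0 (by omega) _ hu)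
    rw [pow_succ B, pow_succ' A, pow_succ (B * A), Module.End.mul_apply, Module.End.mul_apply,
      Module.End.mul_apply, h.mul_pow_apply (by omega) hu, ih (by omega) h1]
    rfl

theorem le_sup_map (h : Ladder A B S n)
    (gen : ∀ k, k + 1 < n → S (k + 1) ≤ (S k).map A ⊔ (S (k + 2)).map B) {k : ℕ} (hk : k < n) :
    S k ≤ (S 0).map (A ^ k) ⊔ (S (k + 1)).map B := by
  induction k with
  | zero => exact le_sup_of_le_left (by rw [pow_zero]; exact (Submodule.map_id _).ge)
  | succ k ih =>
    refine (gen k hk).trans (sup_le ?_ le_sup_right)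
    refine (Submodule.map_mono (ih (by omega))).trans ?_
    rw [Submodule.map_sup]
    refine sup_le_sup ?_ ?_
    · rw [← Submodule.map_comp, pow_succ']; rfl
    · rintro _ ⟨_, ⟨u, hu, rfl⟩, rfl⟩
      exact ⟨A u, h.mapA _ hk _ hu, (h.comm (k + 1) (by omega) hk u hu).symm⟩

theorem le_sup (h : Ladder A B S n)
    (gen : ∀ k, k + 1 < n → S (k + 1) ≤ (S k).map A ⊔ (S (k + 2)).map B) {s k : ℕ}
    (hk0 : 0 < k) (hk : k < n) (nil : ∀ u ∈ S k, ((B * A) ^ s) u = 0) :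
    S k ≤ (S 0).map (A ^ k) ⊔ (S n).map (B ^ (n - k)) := by
  have h2 := h.reverse.le_sup_map (k := n - (k + 1)) (by
    intro j hj
    have := gen (n - (j + 2)) (by omega)
    rw [show n - (j + 2) + 1 = n - (j + 1) by omega, show n - (j + 2) + 2 = n - j by omega] at this
    rwa [sup_comm]) (by omega)
  rw [show n - (n - (k + 1)) = k + 1 by omega, show n - (n - (k + 1) + 1) = k by omega] at h2
  have h1 := h.le_sup_map gen hk
  set W := (S 0).map (A ^ k) ⊔ (S n).map (B ^ (n - k)) with hW
  have h3 : S k ≤ W ⊔ (S k).map (B * A) := by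
    refine h1.trans (sup_le (le_sup_of_le_left le_sup_left) ?_)
    refine (Submodule.map_mono h2).trans ?_
    rw [Submodule.map_sup]
    refine sup_le_sup ?_ ?_
    · refine le_trans ?_ le_sup_right
      rw [← Submodule.map_comp, show n - k = n - (k + 1) + 1 by omega, pow_succ']; simp; rfl
    · rw [← Submodule.map_comp]; rfl
  have hWp : W.map (B * A) ≤ W := by
    rw [hW, Submodule.map_sup]
    refine sup_le_sup ?_ ?_
    · rintro _ ⟨_, ⟨u, hu, rfl⟩, rfl⟩
      exact ⟨B (A u), h.mapB 0 (by omega) _ (h.mapA 0 (by omega) _ hu),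
        (h.mul_pow_apply hk hu).symm⟩
    · rintro _ ⟨_, ⟨u, hu, rfl⟩, rfl⟩
      have hu' : u ∈ S (n - 0) := hu
      refine ⟨A (B u), h.reverse.mapB 0 (by omega) _ (h.reverse.mapA 0 (by omega) _ hu'), ?_⟩
      rw [← h.reverse.mul_pow_apply (by omega) hu', Module.End.mul_apply]
      refine h.comm k hk0 hk _ ?_
      have := h.reverse.pow_mem (k := 0) (j := n - k) (by omega) hu'
      simpa [show n - (n - k) = k by omega] using this
  have h4 : ∀ j, S k ≤ W ⊔ (S k).map ((B * A) ^ j) := by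
    intro j
    induction j with
    | zero => exact le_sup_of_le_right (by rw [pow_zero]; exact (Submodule.map_id _).ge)
    | succ j ih =>
      refine h3.trans (sup_le le_sup_left ((Submodule.map_mono ih).trans ?_))
      rw [Submodule.map_sup]
      refine sup_le_sup hWp ?_
      rw [← Submodule.map_comp, pow_succ']; rfl
  refine (h4 s).trans (sup_le le_rfl ?_)
  rintro _ ⟨u, hu, rfl⟩
  rw [nil u hu]; exact W.zero_mem

end Ladder

/-- A ladder without interior socle or interior top and with nilpotent round trips. -/
structure TightLadder (A B : Module.End K M) (S : ℕ → Submodule K M) (n s : ℕ) : Prop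
    extends Ladder A B S n where
  soc : ∀ k, 0 < k → k < n → ∀ u ∈ S k, A u = 0 → B u = 0 → u = 0
  gen : ∀ k, k + 1 < n → S (k + 1) ≤ (S k).map A ⊔ (S (k + 2)).map B
  nil : ∀ k < n, ∀ u ∈ S k, ((B * A) ^ s) u = 0
  nil' : ∀ k < n, ∀ u ∈ S (k + 1), ((A * B) ^ s) u = 0

namespace TightLadder

variable {A B : Module.End K M} {S : ℕ → Submodule K M} {n s : ℕ}

theorem reverse (h : TightLadder A B S n s) : TightLadder B A (fun k => S (n - k)) n s where
  toLadder := h.toLadder.reverse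
  soc k h0 hk u hu h1 h2 := h.soc (n - k) (by omega) (by omega) u hu h2 h1
  gen k hk := by
    have := h.gen (n - (k + 2)) (by omega)
    rw [show n - (k + 2) + 1 = n - (k + 1) by omega, show n - (k + 2) + 2 = n - k by omega] at this
    rwa [sup_comm]
  nil k hk u hu := by
    refine h.nil' (n - (k + 1)) (by omega) u ?_
    rwa [show n - (k + 1) + 1 = n - k by omega]
  nil' k hk u hu := h.nil (n - (k + 1)) (by omega) u hu

theorem pow_eq_zero (h : TightLadder A B S n s) {k : ℕ} (hsk : s ≤ k) (hk0 : 0 < k) (hk : k ≤ n)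
    {u : M} (hu : u ∈ (S 0).map (A ^ k)) : (B ^ k) u = 0 := by
  obtain ⟨u0, hu0, rfl⟩ := hu
  rw [h.pow_pow_apply hk hu0, ← Nat.sub_add_cancel hsk, pow_add, Module.End.mul_apply,
    h.nil 0 (by omega) u0 hu0, map_zero]

theorem eq_zero_of_apply (h : TightLadder A B S n s) {k : ℕ} (hsk : s ≤ k) (hk0 : 0 < k)
    (hk : k < n) {u : M} (hu : u ∈ (S 0).map (A ^ k)) (hA : A u = 0) : u = 0 := by
  have hB := h.pow_eq_zero hsk hk0 hk.le hu
  have hus : u ∈ S k := by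
    obtain ⟨u0, hu0, rfl⟩ := hu
    simpa using h.pow_mem (k := 0) (by omega) hu0
  have hmem : ∀ j ≤ k, (B ^ j) u ∈ S (k - j) := by
    intro j hj
    have := h.toLadder.reverse.pow_mem (k := n - k) (j := j) (u := u) (by omega)
      (by simpa [show n - (n - k) = k by omega] using hus)
    rwa [show n - (n - k + j) = k - j by omega] at this
  have hAB : ∀ j ≤ k, A ((B ^ j) u) = 0 ∨ j = k := by
    intro j
    induction j with
    | zero => intro _; left; simpa using hA
    | succ j ih =>
      intro hj
      rcases ih (by omega) with h1 | h1
      · left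
        rw [pow_succ', Module.End.mul_apply,
          h.comm (k - j) (by omega) (by omega) _ (hmem j (by omega)), h1, map_zero]
      · omega
  have hz : ∀ j ≤ k, (B ^ (k - j)) u = 0 := by
    intro j
    induction j with
    | zero => intro _; simpa using hB
    | succ j ih =>
      intro hj
      refine h.soc (k - (k - (j + 1))) (by omega) (by omega) _ (hmem _ (by omega)) ?_ ?_
      · rcases hAB (k - (j + 1)) (by omega) with h1 | h1
        · exact h1
        · omega
      · have := ih (by omega)
        rwa [show k - j = k - (j + 1) + 1 by omega, pow_succ', Module.End.mul_apply] at this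
  simpa using hz k le_rfl

theorem eq_zero_of_pow_apply (h : TightLadder A B S n s) {k j : ℕ} (hsk : s ≤ k) (hk0 : 0 < k)
    (hk : k + j ≤ n) {u : M} (hu : u ∈ (S 0).map (A ^ k)) (hA : (A ^ j) u = 0) : u = 0 := by
  induction j with
  | zero => simpa using hA
  | succ j ih =>
    refine ih (by omega) (h.eq_zero_of_apply (k := k + j) (by omega) (by omega) (by omega) ?_ ?_)
    · obtain ⟨u0, hu0, rfl⟩ := hu
      exact ⟨u0, hu0, by rw [add_comm, pow_add, Module.End.mul_apply]⟩
    · rwa [pow_succ', Module.End.mul_apply] at hA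

theorem disjoint (h : TightLadder A B S n s) {k : ℕ} (hsk : s ≤ k) (hsk' : s ≤ n - k) (hk0 : 0 < k)
    (hk : k < n) : Disjoint ((S 0).map (A ^ k)) ((S n).map (B ^ (n - k))) := by
  rw [Submodule.disjoint_def]
  intro u hu hu'
  exact h.eq_zero_of_pow_apply (j := n - k) hsk hk0 (by omega) hu
    (h.reverse.pow_eq_zero hsk' (by omega) (by omega) hu')

theorem le_sup (h : TightLadder A B S n s) {k : ℕ} (hk0 : 0 < k) (hk : k < n) :
    S k ≤ (S 0).map (A ^ k) ⊔ (S n).map (B ^ (n - k)) :=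
  h.toLadder.le_sup h.gen hk0 hk (h.nil k hk)

end TightLadder

end Ladder

/-- Linear maps prescribed on two disjoint subspaces extend to the whole space. -/
theorem exists_linearMap_eq_on_disjoint {K M N : Type*} [Field K] [AddCommGroup M] [Module K M]
    [AddCommGroup N] [Module K N] {R L : Submodule K M} (hd : Disjoint R L)
    (f : R →ₗ[K] N) (g : L →ₗ[K] N) :
    ∃ Φ : M →ₗ[K] N, (∀ u : R, Φ u = f u) ∧ ∀ u : L, Φ u = g u := by
  obtain ⟨p, hp⟩ := LinearMap.exists_leftInverse_of_injective (R.subtype.coprod L.subtype) (by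
    rw [LinearMap.ker_coprod_of_disjoint_range _ _ (by simpa using hd)]; simp)
  refine ⟨(f.coprod g) ∘ₗ p, fun u => ?_, fun u => ?_⟩
  · have := LinearMap.congr_fun hp (u, 0)
    simp only [LinearMap.comp_apply, LinearMap.coprod_apply, map_zero, add_zero] at this ⊢
    simp only [Submodule.subtype_apply, LinearMap.id_apply] at this
    simp [this]
  · have := LinearMap.congr_fun hp (0, u)
    simp only [LinearMap.comp_apply, LinearMap.coprod_apply, map_zero, zero_add] at this ⊢
    simp only [Submodule.subtype_apply, LinearMap.id_apply] at this
    simp [this]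

/-- An endomorphism without nonzero subspaces contained in their own image kills a subspace of
dimension at most `s` in `s` steps. -/
theorem pow_apply_eq_zero_of_finrank_le {K M : Type*} [Field K] [AddCommGroup M] [Module K M]
    [FiniteDimensional K M] {p : Module.End K M} {S : Submodule K M} {s : ℕ}
    (hS : ∀ u ∈ S, p u ∈ S) (hs : Module.finrank K S ≤ s)
    (hp : ∀ W ≤ S, W ≤ W.map p → W = ⊥) {u : M} (hu : u ∈ S) : (p ^ s) u = 0 := by
  set f : Module.End K S := p.restrict hS with hf
  have hfp : ∀ (j : ℕ) (z : S), ((f ^ j) z : M) = (p ^ j) z := by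
    intro j z
    induction j with
    | zero => simp
    | succ j ih => rw [pow_succ', pow_succ', Module.End.mul_apply, Module.End.mul_apply, ← ih]; rfl
  have hnil : IsNilpotent f := by
    obtain ⟨N, hN⟩ := IsArtinian.monotone_stabilizes
      (⟨fun j => OrderDual.toDual (LinearMap.range (f ^ j)), fun a b hab => by
        change LinearMap.range (f ^ b) ≤ LinearMap.range (f ^ a)
        rw [← Nat.add_sub_cancel' hab, pow_add]
        exact LinearMap.range_comp_le_range _ _⟩ : ℕ →o (Submodule K S)ᵒᵈ)
    refine ⟨N, ?_⟩
    have h1 : LinearMap.range (f ^ N) = LinearMap.range (f ^ (N + 1)) := hN (N + 1) (by omega)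
    have h2 := hp ((LinearMap.range (f ^ N)).map S.subtype) (Submodule.map_subtype_le _ _) (by
      rintro _ ⟨z, hz, rfl⟩
      rw [h1] at hz
      obtain ⟨y, rfl⟩ := hz
      refine ⟨_, ⟨_, ⟨y, rfl⟩, rfl⟩, ?_⟩
      rw [pow_succ', Module.End.mul_apply]; rfl)
    exact LinearMap.range_eq_bot.1
      (Submodule.map_injective_of_injective S.subtype_injective (h2.trans (Submodule.map_bot _).symm))
  have h3 : f ^ Module.finrank K S = 0 := by
    have := LinearMap.aeval_self_charpoly f
    rwa [LinearMap.charpoly_eq_X_pow_iff _ |>.2 ?_, map_pow, Polynomial.aeval_X] at this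
    intro m
    obtain ⟨N, hN⟩ := hnil
    exact ⟨N, by simp [hN]⟩
  have h4 : f ^ s = 0 := by rw [← Nat.sub_add_cancel hs, pow_add, h3, mul_zero]
  have := hfp s ⟨u, hu⟩
  rw [h4] at this
  simpa using this.symm

/-! ### Representations on a total space -/

/-- A representation of a double quiver on a total space `M` graded by the vertices, with the
framing recorded as a single map to a total framing space `N`. -/
@[ext]
structure TotalRep {V E : Type} (src tgt : E → V) (M N : Type) [Fintype V]
    [AddCommGroup M] [Module ℂ M] [AddCommGroup N] [Module ℂ N] where
  P : V → Module.End ℂ M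
  x : E → Module.End ℂ M
  y : E → Module.End ℂ M
  T : M →ₗ[ℂ] N
  P_self : ∀ a m, P a (P a m) = P a m
  P_ne : ∀ a b m, a ≠ b → P a (P b m) = 0
  P_sum : ∀ m, ∑ a, P a m = m
  P_x : ∀ e m, P (tgt e) (x e m) = x e m
  x_P : ∀ e m, x e (P (src e) m) = x e m
  P_y : ∀ e m, P (src e) (y e m) = y e m
  y_P : ∀ e m, y e (P (tgt e) m) = y e m

namespace TotalRep

variable {V E M N : Type} [Fintype V] [AddCommGroup M] [Module ℂ M] [AddCommGroup N] [Module ℂ N]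
  {src tgt : E → V}

section Basic

variable (ρ : TotalRep src tgt M N)

/-- The sum of the images of a subspace under all edge maps. -/
def out (U : Submodule ℂ M) : Submodule ℂ M := ⨆ e, U.map (ρ.x e) ⊔ U.map (ρ.y e)

/-- No nonzero vector at a vertex is killed by all edge maps and the framing. -/
def Socle : Prop := ∀ j m, ρ.P j m = m → (∀ e, ρ.x e m = 0 ∧ ρ.y e m = 0) → ρ.T m = 0 → m = 0

def Nil : Prop := ∀ U : Submodule ℂ M, U ≤ ρ.out U → U = ⊥

def Moment [Fintype E] : Prop := ∑ e, (ρ.x e * ρ.y e - ρ.y e * ρ.x e) = 0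

/-- The fibre at `j` is spanned by the images of the edge maps. -/
def Top (j : V) : Prop := LinearMap.range (ρ.P j) ≤ (ρ.out ⊤).map (ρ.P j)

variable {ρ}

theorem x_eq_zero {e : E} {a : V} {m : M} (hm : ρ.P a m = m) (h : src e ≠ a) : ρ.x e m = 0 := by
  rw [← ρ.x_P, ← hm, ρ.P_ne _ _ _ h, map_zero]

theorem y_eq_zero {e : E} {a : V} {m : M} (hm : ρ.P a m = m) (h : tgt e ≠ a) : ρ.y e m = 0 := by
  rw [← ρ.y_P, ← hm, ρ.P_ne _ _ _ h, map_zero]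

theorem P_x_ne {e : E} {a : V} {m : M} (h : tgt e ≠ a) : ρ.P a (ρ.x e m) = 0 := by
  rw [← ρ.P_x, ρ.P_ne _ _ _ h.symm]

theorem P_y_ne {e : E} {a : V} {m : M} (h : src e ≠ a) : ρ.P a (ρ.y e m) = 0 := by
  rw [← ρ.P_y, ρ.P_ne _ _ _ h.symm]

theorem mem_range_P {a : V} {m : M} : m ∈ LinearMap.range (ρ.P a) ↔ ρ.P a m = m :=
  ⟨by rintro ⟨z, rfl⟩; exact ρ.P_self a z, fun h => ⟨m, h⟩⟩

theorem map_x_le_out (U : Submodule ℂ M) (e : E) : U.map (ρ.x e) ≤ ρ.out U :=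
  le_sup_left.trans (le_iSup (fun e => U.map (ρ.x e) ⊔ U.map (ρ.y e)) e)

theorem map_y_le_out (U : Submodule ℂ M) (e : E) : U.map (ρ.y e) ≤ ρ.out U :=
  le_sup_right.trans (le_iSup (fun e => U.map (ρ.x e) ⊔ U.map (ρ.y e)) e)

theorem x_mem_out {U : Submodule ℂ M} (e : E) {m : M} (hm : m ∈ U) : ρ.x e m ∈ ρ.out U :=
  map_x_le_out U e ⟨m, hm, rfl⟩

theorem y_mem_out {U : Submodule ℂ M} (e : E) {m : M} (hm : m ∈ U) : ρ.y e m ∈ ρ.out U :=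
  map_y_le_out U e ⟨m, hm, rfl⟩

theorem out_le {U W : Submodule ℂ M} (h : ∀ e, ∀ m ∈ U, ρ.x e m ∈ W ∧ ρ.y e m ∈ W) :
    ρ.out U ≤ W := by
  refine iSup_le fun e => sup_le ?_ ?_
  · rintro _ ⟨m, hm, rfl⟩; exact (h e m hm).1
  · rintro _ ⟨m, hm, rfl⟩; exact (h e m hm).2

theorem out_mono {U W : Submodule ℂ M} (h : U ≤ W) : ρ.out U ≤ ρ.out W :=
  out_le fun e _ hm => ⟨x_mem_out e (h hm), y_mem_out e (h hm)⟩

theorem P_x_y {a : V} {m : M} (hm : ρ.P a m = m) (e : E) :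
    ρ.P a (ρ.x e (ρ.y e m)) = ρ.x e (ρ.y e m) := by
  by_cases h : tgt e = a
  · rw [← h, ρ.P_x]
  · rw [y_eq_zero hm h, map_zero, map_zero]

theorem P_y_x {a : V} {m : M} (hm : ρ.P a m = m) (e : E) :
    ρ.P a (ρ.y e (ρ.x e m)) = ρ.y e (ρ.x e m) := by
  by_cases h : src e = a
  · rw [← h, ρ.P_y]
  · rw [x_eq_zero hm h, map_zero, map_zero]

theorem moment_iff [Fintype E] :
    ρ.Moment ↔ ∀ a m, ρ.P a m = m → ∑ e, ρ.x e (ρ.y e m) = ∑ e, ρ.y e (ρ.x e m) := by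
  have key : ∀ m, (∑ e, (ρ.x e * ρ.y e - ρ.y e * ρ.x e)) m =
      ∑ e, ρ.x e (ρ.y e m) - ∑ e, ρ.y e (ρ.x e m) := fun m => by
    simp [LinearMap.sum_apply, Finset.sum_sub_distrib]
  constructor
  · intro h a m _
    rw [← sub_eq_zero, ← key, h, LinearMap.zero_apply]
  · intro h
    refine LinearMap.ext fun m => ?_
    rw [← ρ.P_sum m, map_sum, map_sum]
    refine Finset.sum_congr rfl fun a _ => ?_
    rw [key, h a _ (ρ.P_self a m), sub_self, LinearMap.zero_apply]

theorem map_P_out_le (U : Submodule ℂ M) (j : V) : (ρ.out U).map (ρ.P j) ≤ ρ.out U := by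
  rw [Submodule.map_le_iff_le_comap]
  refine out_le fun e m hm => ⟨?_, ?_⟩
  · by_cases h : tgt e = j
    · subst h; rw [Submodule.mem_comap, ρ.P_x]; exact x_mem_out e hm
    · rw [Submodule.mem_comap, P_x_ne h]; exact zero_mem _
  · by_cases h : src e = j
    · subst h; rw [Submodule.mem_comap, ρ.P_y]; exact y_mem_out e hm
    · rw [Submodule.mem_comap, P_y_ne h]; exact zero_mem _

end Basic

/-! ### Paths -/

/-- An oriented path `q 0 → … → q n` with edges `pe k` from `q k` to `q (k+1)`, such that no
other edges meet the interior vertices. -/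
structure IsPath (s t : E → V) (q : ℕ → V) (pe : ℕ → E) (n : ℕ) : Prop where
  src : ∀ k < n, s (pe k) = q k
  tgt : ∀ k < n, t (pe k) = q (k + 1)
  inj : ∀ j k, j ≤ n → k ≤ n → q j = q k → j = k
  src_unique : ∀ k, 0 < k → k < n → ∀ e, s e = q k → e = pe k
  tgt_unique : ∀ k, k + 1 < n → ∀ e, t e = q (k + 1) → e = pe k

section Path

variable (ρ : TotalRep src tgt M N) (q : ℕ → V) (pe : ℕ → E) (n : ℕ)

def up : Module.End ℂ M := ∑ k ∈ Finset.range n, ρ.x (pe k)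

def down : Module.End ℂ M := ∑ k ∈ Finset.range n, ρ.y (pe k)

/-- The fibre at the `k`-th vertex of the path. -/
def fib (k : ℕ) : Submodule ℂ M := LinearMap.range (ρ.P (q k))

variable {ρ q pe n}

theorem mem_fib {k : ℕ} {m : M} : m ∈ ρ.fib q k ↔ ρ.P (q k) m = m := mem_range_P

theorem P_mem_fib (k : ℕ) (m : M) : ρ.P (q k) m ∈ ρ.fib q k := ⟨m, rfl⟩

theorem up_apply (h : IsPath src tgt q pe n) {k : ℕ} (hk : k < n) {m : M} (hm : m ∈ ρ.fib q k) :
    ρ.up pe n m = ρ.x (pe k) m := by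
  rw [up, LinearMap.sum_apply, Finset.sum_eq_single k]
  · intro j hj hjk
    rw [Finset.mem_range] at hj
    refine x_eq_zero (mem_fib.1 hm) fun h1 => hjk ?_
    rw [h.src j hj] at h1
    exact h.inj j k hj.le hk.le h1
  · intro h1; exact absurd (Finset.mem_range.2 hk) h1

theorem down_apply (h : IsPath src tgt q pe n) {k : ℕ} (hk : k < n) {m : M}
    (hm : m ∈ ρ.fib q (k + 1)) : ρ.down pe n m = ρ.y (pe k) m := by
  rw [down, LinearMap.sum_apply, Finset.sum_eq_single k]
  · intro j hj hjk
    rw [Finset.mem_range] at hj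
    refine y_eq_zero (mem_fib.1 hm) fun h1 => hjk ?_
    rw [h.tgt j hj] at h1
    have := h.inj (j + 1) (k + 1) hj hk h1
    omega
  · intro h1; exact absurd (Finset.mem_range.2 hk) h1

theorem x_mem_fib (h : IsPath src tgt q pe n) {k : ℕ} (hk : k < n) (m : M) :
    ρ.x (pe k) m ∈ ρ.fib q (k + 1) := by
  rw [mem_fib, ← h.tgt k hk, ρ.P_x]

theorem y_mem_fib (h : IsPath src tgt q pe n) {k : ℕ} (hk : k < n) (m : M) :
    ρ.y (pe k) m ∈ ρ.fib q k := by
  rw [mem_fib, ← h.src k hk, ρ.P_y]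

theorem up_pow_mem (h : IsPath src tgt q pe n) {k : ℕ} (hk : k ≤ n) {m : M} (hm : m ∈ ρ.fib q 0) :
    (ρ.up pe n ^ k) m ∈ ρ.fib q k := by
  induction k with
  | zero => exact hm
  | succ k ih =>
    rw [pow_succ', Module.End.mul_apply, up_apply h (by omega) (ih (by omega))]
    exact x_mem_fib h (by omega) _

theorem down_pow_mem (h : IsPath src tgt q pe n) {k : ℕ} (hk : k ≤ n) {m : M}
    (hm : m ∈ ρ.fib q n) : (ρ.down pe n ^ k) m ∈ ρ.fib q (n - k) := by
  induction k with
  | zero => exact hm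
  | succ k ih =>
    have h1 := ih (by omega)
    rw [show n - k = n - (k + 1) + 1 by omega] at h1
    rw [pow_succ', Module.End.mul_apply, down_apply h (by omega) h1]
    exact y_mem_fib h (by omega) _

theorem up_pow_succ_apply (h : IsPath src tgt q pe n) {k : ℕ} (hk : k < n) {m : M}
    (hm : m ∈ ρ.fib q 0) : (ρ.up pe n ^ (k + 1)) m = ρ.x (pe k) ((ρ.up pe n ^ k) m) := by
  rw [pow_succ', Module.End.mul_apply, up_apply h hk (up_pow_mem h hk.le hm)]

theorem down_pow_succ_apply (h : IsPath src tgt q pe n) {k : ℕ} (hk : k < n) {m : M}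
    (hm : m ∈ ρ.fib q n) :
    (ρ.down pe n ^ (k + 1)) m = ρ.y (pe (n - (k + 1))) ((ρ.down pe n ^ k) m) := by
  have h1 := down_pow_mem h hk.le hm
  rw [show n - k = n - (k + 1) + 1 by omega] at h1
  rw [pow_succ', Module.End.mul_apply, down_apply h (by omega) h1]

theorem up_pow_mem_of_out_le {U : Submodule ℂ M} (hU : ρ.out U ≤ U) (k : ℕ) {m : M} (hm : m ∈ U) :
    (ρ.up pe n ^ k) m ∈ U := by
  induction k with
  | zero => exact hm
  | succ k ih =>
    rw [pow_succ', Module.End.mul_apply, up, LinearMap.sum_apply]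
    exact sum_mem fun j _ => hU (x_mem_out _ ih)

theorem down_pow_mem_of_out_le {U : Submodule ℂ M} (hU : ρ.out U ≤ U) (k : ℕ) {m : M}
    (hm : m ∈ U) : (ρ.down pe n ^ k) m ∈ U := by
  induction k with
  | zero => exact hm
  | succ k ih =>
    rw [pow_succ', Module.End.mul_apply, down, LinearMap.sum_apply]
    exact sum_mem fun j _ => hU (y_mem_out _ ih)

theorem sum_x_y_apply [Fintype E] (h : IsPath src tgt q pe n) {k : ℕ} (hk : k + 1 < n) {m : M}
    (hm : m ∈ ρ.fib q (k + 1)) : ∑ e, ρ.x e (ρ.y e m) = ρ.up pe n (ρ.down pe n m) := by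
  rw [down_apply h (by omega) hm, up_apply h (by omega) (y_mem_fib h (by omega) m)]
  refine Finset.sum_eq_single (pe k) (fun e _ he => ?_) fun h2 => absurd (Finset.mem_univ _) h2
  rw [y_eq_zero (mem_fib.1 hm) fun h2 => he (h.tgt_unique k hk e h2), map_zero]

theorem sum_y_x_apply [Fintype E] (h : IsPath src tgt q pe n) {k : ℕ} (hk : k + 1 < n) {m : M}
    (hm : m ∈ ρ.fib q (k + 1)) : ∑ e, ρ.y e (ρ.x e m) = ρ.down pe n (ρ.up pe n m) := by
  rw [up_apply h hk hm, down_apply h hk (x_mem_fib h hk m)]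
  refine Finset.sum_eq_single (pe (k + 1)) (fun e _ he => ?_) fun h2 => absurd (Finset.mem_univ _) h2
  rw [x_eq_zero (mem_fib.1 hm) fun h2 => he (h.src_unique (k + 1) (by omega) hk e h2), map_zero]

theorem ladder [Fintype E] (h : IsPath src tgt q pe n) (hM : ρ.Moment) :
    Ladder (ρ.up pe n) (ρ.down pe n) (ρ.fib q) n where
  mapA k hk u hu := by rw [up_apply h hk hu]; exact x_mem_fib h hk u
  mapB k hk u hu := by rw [down_apply h hk hu]; exact y_mem_fib h hk u
  comm k h0 hk u hu := by
    obtain ⟨k, rfl⟩ := Nat.exists_eq_succ_of_ne_zero h0.ne'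
    rw [Nat.succ_eq_add_one] at *
    rw [← sum_x_y_apply h hk hu, ← sum_y_x_apply h hk hu, moment_iff.1 hM _ u (mem_fib.1 hu)]

theorem map_P_out_le_of_isPath (h : IsPath src tgt q pe n) (U : Submodule ℂ M) {k : ℕ}
    (hk : k + 1 < n) :
    (ρ.out U).map (ρ.P (q (k + 1))) ≤ (U.map (ρ.P (q k))).map (ρ.up pe n) ⊔
      (U.map (ρ.P (q (k + 2)))).map (ρ.down pe n) := by
  rw [Submodule.map_le_iff_le_comap]
  refine out_le fun e m hm => ⟨?_, ?_⟩
  · rw [Submodule.mem_comap]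
    by_cases h1 : tgt e = q (k + 1)
    · obtain rfl := h.tgt_unique k hk e h1
      rw [← h1, ρ.P_x]
      refine Submodule.mem_sup_left ⟨_, ⟨m, hm, rfl⟩, ?_⟩
      rw [up_apply h (by omega) (P_mem_fib k m), ← h.src k (by omega), ρ.x_P]
    · rw [P_x_ne h1]; exact zero_mem _
  · rw [Submodule.mem_comap]
    by_cases h1 : src e = q (k + 1)
    · obtain rfl := h.src_unique (k + 1) (by omega) hk e h1
      rw [← h1, ρ.P_y]
      refine Submodule.mem_sup_right ⟨_, ⟨m, hm, rfl⟩, ?_⟩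
      rw [down_apply h hk (P_mem_fib (k + 2) m), ← h.tgt (k + 1) (by omega), ρ.y_P]
    · rw [P_y_ne h1]; exact zero_mem _

theorem tightLadder [Fintype E] [FiniteDimensional ℂ M] (h : IsPath src tgt q pe n)
    (hM : ρ.Moment) (hS : ρ.Socle) (hN : ρ.Nil) {s : ℕ}
    (hT : ∀ k, 0 < k → k < n → ∀ m ∈ ρ.fib q k, ρ.T m = 0)
    (htop : ∀ k, 0 < k → k < n → ρ.Top (q k))
    (hdim : ∀ k ≤ n, Module.finrank ℂ (ρ.fib q k) ≤ s) :
    TightLadder (ρ.up pe n) (ρ.down pe n) (ρ.fib q) n s where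
  toLadder := ladder h hM
  soc k h0 hk u hu hA hB := by
    refine hS (q k) u (mem_fib.1 hu) (fun e => ⟨?_, ?_⟩) (hT k h0 hk u hu)
    · by_cases h1 : src e = q k
      · obtain rfl := h.src_unique k h0 hk e h1
        rwa [up_apply h hk hu] at hA
      · exact x_eq_zero (mem_fib.1 hu) h1
    · obtain ⟨k, rfl⟩ := Nat.exists_eq_succ_of_ne_zero h0.ne'
      by_cases h1 : tgt e = q (k + 1)
      · obtain rfl := h.tgt_unique k hk e h1
        rwa [down_apply h (by omega) hu] at hB
      · exact y_eq_zero (mem_fib.1 hu) h1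
  gen k hk := by
    refine (htop (k + 1) (by omega) hk).trans ((map_P_out_le_of_isPath h ⊤ hk).trans ?_)
    rw [Submodule.map_top, Submodule.map_top]; rfl
  nil k hk u hu := by
    refine pow_apply_eq_zero_of_finrank_le (S := ρ.fib q k) ?_ (hdim k hk.le) ?_ hu
    · intro z hz
      exact (ladder h hM).mapB k hk _ ((ladder h hM).mapA k hk z hz)
    · intro W hW hWp
      refine le_bot_iff.1 (le_sup_left.trans (hN (W ⊔ W.map (ρ.up pe n)) (sup_le ?_ ?_)).le)
      · intro z hz
        obtain ⟨w, hw, rfl⟩ := hWp hz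
        rw [Module.End.mul_apply, down_apply h hk ((ladder h hM).mapA k hk w (hW hw))]
        exact y_mem_out _ (Submodule.mem_sup_right ⟨w, hw, rfl⟩)
      · rintro _ ⟨w, hw, rfl⟩
        rw [up_apply h hk (hW hw)]
        exact x_mem_out _ (Submodule.mem_sup_left hw)
  nil' k hk u hu := by
    refine pow_apply_eq_zero_of_finrank_le (S := ρ.fib q (k + 1)) ?_ (hdim (k + 1) hk) ?_ hu
    · intro z hz
      exact (ladder h hM).mapA k hk _ ((ladder h hM).mapB k hk z hz)
    · intro W hW hWp
      refine le_bot_iff.1 (le_sup_left.trans (hN (W ⊔ W.map (ρ.down pe n)) (sup_le ?_ ?_)).le)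
      · intro z hz
        obtain ⟨w, hw, rfl⟩ := hWp hz
        rw [Module.End.mul_apply, up_apply h hk ((ladder h hM).mapB k hk w (hW hw))]
        exact x_mem_out _ (Submodule.mem_sup_right ⟨w, hw, rfl⟩)
      · rintro _ ⟨w, hw, rfl⟩
        rw [down_apply h hk (hW hw)]
        exact y_mem_out _ (Submodule.mem_sup_left hw)

/-- A subspace equal to the sum of its images under the edge maps is, on the path, generated from
the two ends. -/
theorem inf_fib_le [Fintype E] (h : IsPath src tgt q pe n) (hM : ρ.Moment)
    {U : Submodule ℂ M} (hU : ρ.out U = U) {s k : ℕ} (hk0 : 0 < k) (hk : k < n)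
    (nil : ∀ u ∈ ρ.fib q k, ((ρ.down pe n * ρ.up pe n) ^ s) u = 0) :
    U ⊓ ρ.fib q k ≤ (U ⊓ ρ.fib q 0).map (ρ.up pe n ^ k) ⊔
      (U ⊓ ρ.fib q n).map (ρ.down pe n ^ (n - k)) := by
  have hL := ladder h hM
  have hP : ∀ k, U.map (ρ.P (q k)) = U ⊓ ρ.fib q k := by
    intro k
    refine le_antisymm (le_inf ?_ ?_) ?_
    · conv_lhs => rw [← hU]
      exact (map_P_out_le U _).trans hU.le
    · exact LinearMap.map_le_range
    · rintro m ⟨h1, h2⟩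
      exact ⟨m, h1, mem_fib.1 h2⟩
  have hxU : ∀ e, ∀ m ∈ U, ρ.x e m ∈ U := fun e m hm => hU ▸ x_mem_out e hm
  have hyU : ∀ e, ∀ m ∈ U, ρ.y e m ∈ U := fun e m hm => hU ▸ y_mem_out e hm
  have hL' : Ladder (ρ.up pe n) (ρ.down pe n) (fun k => U ⊓ ρ.fib q k) n :=
    { mapA := fun k hk u hu => ⟨by rw [up_apply h hk hu.2]; exact hxU _ _ hu.1,
        hL.mapA k hk u hu.2⟩
      mapB := fun k hk u hu => ⟨by rw [down_apply h hk hu.2]; exact hyU _ _ hu.1,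
        hL.mapB k hk u hu.2⟩
      comm := fun k h0 hk u hu => hL.comm k h0 hk u hu.2 }
  refine hL'.le_sup (s := s) ?_ hk0 hk fun u hu => nil u hu.2
  intro k hk
  have := map_P_out_le_of_isPath (ρ := ρ) h U hk
  rwa [hU, hP, hP, hP] at this

end Path

end TotalRep

/-! ### Doubling a vertex on a path -/

/-- A quiver with a path of length `2r` centred at `i`, together with the quiver in which the
vertex `i` is doubled into `iL → iR`; the new edge is `none`. -/
structure Expansion (V V' E : Type) where
  src : E → V
  tgt : E → V
  src' : Option E → V'
  tgt' : Option E → V'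
  i : V
  iL : V'
  iR : V'
  π : V' → V
  κL : V → V'
  κR : V → V'
  q : ℕ → V
  pe : ℕ → E
  r : ℕ
  r_pos : 0 < r
  iL_ne_iR : iL ≠ iR
  κL_i : κL i = iL
  κR_i : κR i = iR
  κL_eq_κR : ∀ j, j ≠ i → κL j = κR j
  π_κL : ∀ j, π (κL j) = j
  π_κR : ∀ j, π (κR j) = j
  eq_κL_or : ∀ u, u = κL (π u) ∨ u = κR (π u)
  src'_some : ∀ e, src' (some e) = κR (src e)
  tgt'_some : ∀ e, tgt' (some e) = κL (tgt e)
  src'_none : src' none = iL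
  tgt'_none : tgt' none = iR
  path : TotalRep.IsPath src tgt q pe (2 * r)
  q_r : q r = i

namespace Expansion

variable {V V' E : Type} (X : Expansion V V' E)

def q' (k : ℕ) : V' := if k ≤ X.r then X.κL (X.q k) else X.κR (X.q (k - 1))

def pe' (k : ℕ) : Option E :=
  if k < X.r then some (X.pe k) else if k = X.r then none else some (X.pe (k - 1))

theorem π_iL : X.π X.iL = X.i := by rw [← X.κL_i, X.π_κL]

theorem π_iR : X.π X.iR = X.i := by rw [← X.κR_i, X.π_κR]

theorem κL_ne_iR (j : V) : X.κL j ≠ X.iR := by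
  intro h
  have h1 := congrArg X.π h
  rw [X.π_κL, X.π_iR] at h1
  rw [h1, X.κL_i] at h
  exact X.iL_ne_iR h

theorem κR_ne_iL (j : V) : X.κR j ≠ X.iL := by
  intro h
  have h1 := congrArg X.π h
  rw [X.π_κR, X.π_iL] at h1
  rw [h1, X.κR_i] at h
  exact X.iL_ne_iR h.symm

theorem κL_eq {u : V'} (h : X.π u ≠ X.i) : X.κL (X.π u) = u := by
  rcases X.eq_κL_or u with h1 | h1
  · exact h1.symm
  · rw [X.κL_eq_κR _ h]; exact h1.symm

theorem κR_eq {u : V'} (h : X.π u ≠ X.i) : X.κR (X.π u) = u := by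
  rw [← X.κL_eq_κR _ h, X.κL_eq h]

theorem eq_iL_or {u : V'} (h : X.π u = X.i) : u = X.iL ∨ u = X.iR := by
  rcases X.eq_κL_or u with h1 | h1
  · left; rw [h1, h, X.κL_i]
  · right; rw [h1, h, X.κR_i]

theorem π_src' (e : E) : X.π (X.src' (some e)) = X.src e := by rw [X.src'_some, X.π_κR]

theorem π_tgt' (e : E) : X.π (X.tgt' (some e)) = X.tgt e := by rw [X.tgt'_some, X.π_κL]

theorem q_ne {k : ℕ} (hk : k ≤ 2 * X.r) (h : k ≠ X.r) : X.q k ≠ X.i := by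
  rw [← X.q_r]
  exact fun h1 => h (X.path.inj k X.r hk (by omega) h1)

theorem q'_of_le {k : ℕ} (h : k ≤ X.r) : X.q' k = X.κL (X.q k) := if_pos h

theorem q'_of_lt {k : ℕ} (h : k < X.r) : X.q' k = X.κR (X.q k) := by
  rw [X.q'_of_le h.le, X.κL_eq_κR _ (X.q_ne (by omega) (by omega))]

theorem q'_succ {k : ℕ} (h : X.r ≤ k) : X.q' (k + 1) = X.κR (X.q k) := by
  rw [q', if_neg (by omega), Nat.add_sub_cancel]

theorem q'_succ_of_lt {k : ℕ} (h : X.r < k) (hk : k ≤ 2 * X.r) :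
    X.q' (k + 1) = X.κL (X.q k) := by
  rw [X.q'_succ h.le, X.κL_eq_κR _ (X.q_ne (by omega) (by omega))]

theorem q'_r : X.q' X.r = X.iL := by rw [X.q'_of_le le_rfl, X.q_r, X.κL_i]

theorem q'_r_succ : X.q' (X.r + 1) = X.iR := by rw [X.q'_succ le_rfl, X.q_r, X.κR_i]

theorem pe'_of_lt {k : ℕ} (h : k < X.r) : X.pe' k = some (X.pe k) := if_pos h

theorem pe'_r : X.pe' X.r = none := by simp [pe']

theorem pe'_succ {k : ℕ} (h : X.r ≤ k) : X.pe' (k + 1) = some (X.pe k) := by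
  rw [pe', if_neg (by omega), if_neg (by omega), Nat.add_sub_cancel]

theorem path' : TotalRep.IsPath X.src' X.tgt' X.q' X.pe' (2 * X.r + 1) where
  src k hk := by
    rcases lt_trichotomy k X.r with h | rfl | h
    · rw [X.pe'_of_lt h, X.src'_some, X.path.src k (by omega), X.q'_of_lt h]
    · rw [X.pe'_r, X.src'_none, X.q'_r]
    · obtain ⟨k, rfl⟩ := Nat.exists_eq_succ_of_ne_zero (show k ≠ 0 by omega)
      rw [Nat.succ_eq_add_one, X.pe'_succ (by omega), X.src'_some, X.path.src k (by omega),
        X.q'_succ (by omega)]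
  tgt k hk := by
    rcases lt_trichotomy k X.r with h | rfl | h
    · rw [X.pe'_of_lt h, X.tgt'_some, X.path.tgt k (by omega), X.q'_of_le h]
    · rw [X.pe'_r, X.tgt'_none, X.q'_r_succ]
    · obtain ⟨k, rfl⟩ := Nat.exists_eq_succ_of_ne_zero (show k ≠ 0 by omega)
      rw [Nat.succ_eq_add_one, X.pe'_succ (by omega), X.tgt'_some, X.path.tgt k (by omega),
        X.q'_succ_of_lt (by omega) (by omega)]
  inj := by
    have key : ∀ j k, j ≤ k → k ≤ 2 * X.r + 1 → X.q' j = X.q' k → j = k := by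
      intro j k hjk hk h
      by_cases h1 : k ≤ X.r
      · rw [X.q'_of_le h1, X.q'_of_le (hjk.trans h1)] at h
        have := congrArg X.π h
        rw [X.π_κL, X.π_κL] at this
        exact X.path.inj j k (by omega) (by omega) this
      · obtain ⟨k, rfl⟩ := Nat.exists_eq_succ_of_ne_zero (show k ≠ 0 by omega)
        rw [Nat.succ_eq_add_one] at *
        rw [X.q'_succ (by omega)] at h
        by_cases h2 : j ≤ X.r
        · rw [X.q'_of_le h2] at h
          have := congrArg X.π h
          rw [X.π_κL, X.π_κR] at this
          obtain rfl := X.path.inj j k (by omega) (by omega) this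
          obtain rfl : j = X.r := by omega
          rw [X.q_r, X.κL_i, X.κR_i] at h
          exact absurd h X.iL_ne_iR
        · obtain ⟨j, rfl⟩ := Nat.exists_eq_succ_of_ne_zero (show j ≠ 0 by omega)
          rw [Nat.succ_eq_add_one] at *
          rw [X.q'_succ (by omega)] at h
          have := congrArg X.π h
          rw [X.π_κR, X.π_κR] at this
          rw [X.path.inj j k (by omega) (by omega) this]
    intro j k hj hk h
    rcases le_total j k with h1 | h1
    · exact key j k h1 hk h
    · exact (key k j h1 hj h.symm).symm
  src_unique k h0 hk e he := by
    rcases lt_trichotomy k X.r with h | rfl | h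
    · rw [X.q'_of_le h.le] at he
      have hπ := congrArg X.π he
      cases e with
      | none =>
        rw [X.src'_none, X.π_iL, X.π_κL] at hπ
        exact absurd hπ.symm (X.q_ne (by omega) (by omega))
      | some e =>
        rw [X.π_src', X.π_κL] at hπ
        rw [X.pe'_of_lt h, X.path.src_unique k h0 (by omega) e hπ]
    · rw [X.pe'_r]
      cases e with
      | none => rfl
      | some e =>
        rw [X.q'_r, X.src'_some] at he
        exact absurd he (X.κR_ne_iL _)
    · obtain ⟨k, rfl⟩ := Nat.exists_eq_succ_of_ne_zero h0.ne'
      rw [Nat.succ_eq_add_one] at *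
      rw [X.q'_succ (by omega)] at he
      have hr := X.r_pos
      cases e with
      | none =>
        rw [X.src'_none] at he
        exact absurd he.symm (X.κR_ne_iL _)
      | some e =>
        have hπ := congrArg X.π he
        rw [X.π_src', X.π_κR] at hπ
        rw [X.pe'_succ (by omega), X.path.src_unique k (by omega) (by omega) e hπ]
  tgt_unique k hk e he := by
    have hr := X.r_pos
    rcases lt_trichotomy k X.r with h | rfl | h
    · rw [X.q'_of_le h] at he
      cases e with
      | none =>
        rw [X.tgt'_none] at he
        exact absurd he.symm (X.κL_ne_iR _)
      | some e =>
        have hπ := congrArg X.π he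
        rw [X.π_tgt', X.π_κL] at hπ
        rw [X.pe'_of_lt h, X.path.tgt_unique k (by omega) e hπ]
    · rw [X.pe'_r]
      cases e with
      | none => rfl
      | some e =>
        rw [X.q'_r_succ, X.tgt'_some] at he
        exact absurd he (X.κL_ne_iR _)
    · obtain ⟨k, rfl⟩ := Nat.exists_eq_succ_of_ne_zero (show k ≠ 0 by omega)
      rw [Nat.succ_eq_add_one] at *
      rw [X.q'_succ (by omega)] at he
      have hπ := congrArg X.π he
      cases e with
      | none =>
        rw [X.tgt'_none, X.π_iR, X.π_κR] at hπ
        exact absurd hπ.symm (X.q_ne (by omega) (by omega))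
      | some e =>
        rw [X.π_tgt', X.π_κR] at hπ
        rw [X.pe'_succ (by omega), X.path.tgt_unique k (by omega) e hπ]

end Expansion

/-- Identifications of the fibres of a representation `ρ'` of the doubled quiver with those of `ρ`,
compatible with all maps except the new ones. -/
structure Cover {V V' E M N M' N' : Type} [Fintype V] [Fintype V'] [AddCommGroup M] [Module ℂ M]
    [AddCommGroup N] [Module ℂ N] [AddCommGroup M'] [Module ℂ M'] [AddCommGroup N'] [Module ℂ N']
    (X : Expansion V V' E) (J : V' → N →ₗ[ℂ] N') (J' : V' → N' →ₗ[ℂ] N)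
    (ρ : TotalRep X.src X.tgt M N) (ρ' : TotalRep X.src' X.tgt' M' N') where
  I : V' → M →ₗ[ℂ] M'
  Q : V' → M' →ₗ[ℂ] M
  P_I : ∀ u m, ρ'.P u (I u m) = I u m
  I_P : ∀ u m, I u (ρ.P (X.π u) m) = I u m
  P_Q : ∀ u m, ρ.P (X.π u) (Q u m) = Q u m
  Q_P : ∀ u m, Q u (ρ'.P u m) = Q u m
  Q_I : ∀ u m, Q u (I u m) = ρ.P (X.π u) m
  I_Q : ∀ u m, I u (Q u m) = ρ'.P u m
  x_I : ∀ e m, ρ'.x (some e) (I (X.src' (some e)) m) = I (X.tgt' (some e)) (ρ.x e m)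
  y_I : ∀ e m, ρ'.y (some e) (I (X.tgt' (some e)) m) = I (X.src' (some e)) (ρ.y e m)
  T_I : ∀ u m, ρ'.T (I u m) = J u (ρ.T m)
  T_Q : ∀ u m, ρ.T (Q u m) = J' u (ρ'.T m)

structure Link {V V' E M N M' N' : Type} [Fintype V] [Fintype V'] [AddCommGroup M] [Module ℂ M]
    [AddCommGroup N] [Module ℂ N] [AddCommGroup M'] [Module ℂ M'] [AddCommGroup N'] [Module ℂ N']
    (X : Expansion V V' E) (J : V' → N →ₗ[ℂ] N') (J' : V' → N' →ₗ[ℂ] N)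
    (ρ : TotalRep X.src X.tgt M N) (ρ' : TotalRep X.src' X.tgt' M' N')
    extends Cover X J J' ρ ρ' where
  starL : ∀ z ∈ (ρ.fib X.q 0).map (ρ.up X.pe (2 * X.r) ^ X.r), ρ'.x none (I X.iL z) = I X.iR z
  starR : ∀ z ∈ (ρ.fib X.q (2 * X.r)).map (ρ.down X.pe (2 * X.r) ^ X.r),
    ρ'.y none (I X.iR z) = I X.iL z

namespace Expansion

open TotalRep

variable {V V' E M N : Type} [Fintype V] [AddCommGroup M] [Module ℂ M] [AddCommGroup N]
  [Module ℂ N] {X : Expansion V V' E} {ρ : TotalRep X.src X.tgt M N}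

theorem mem_fib_r {m : M} : m ∈ ρ.fib X.q X.r ↔ ρ.P X.i m = m := by rw [mem_fib, X.q_r]

theorem down_up_mem {z : M} (hz : z ∈ ρ.fib X.q X.r) :
    ρ.down X.pe (2 * X.r) (ρ.up X.pe (2 * X.r) z) ∈ ρ.fib X.q X.r := by
  have hr := X.r_pos
  rw [up_apply X.path (by omega) hz, down_apply X.path (by omega)
    (x_mem_fib X.path (by omega) z)]
  exact y_mem_fib X.path (by omega) _

theorem left_le : (ρ.fib X.q 0).map (ρ.up X.pe (2 * X.r) ^ X.r) ≤ ρ.fib X.q X.r := by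
  rintro _ ⟨m, hm, rfl⟩
  exact up_pow_mem X.path (by omega) hm

theorem right_le : (ρ.fib X.q (2 * X.r)).map (ρ.down X.pe (2 * X.r) ^ X.r) ≤ ρ.fib X.q X.r := by
  rintro _ ⟨m, hm, rfl⟩
  have := down_pow_mem X.path (k := X.r) (by omega) hm
  rwa [show 2 * X.r - X.r = X.r by omega] at this

end Expansion

namespace Cover

open TotalRep Expansion

variable {V V' E M N M' N' : Type} [Fintype V] [Fintype V'] [AddCommGroup M] [Module ℂ M]
  [AddCommGroup N] [Module ℂ N] [AddCommGroup M'] [Module ℂ M'] [AddCommGroup N'] [Module ℂ N']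
  {X : Expansion V V' E} {J : V' → N →ₗ[ℂ] N'} {J' : V' → N' →ₗ[ℂ] N}
  {ρ : TotalRep X.src X.tgt M N} {ρ' : TotalRep X.src' X.tgt' M' N'} (L : Cover X J J' ρ ρ')

local notation "𝐀" => TotalRep.up ρ X.pe (2 * X.r)
local notation "𝐁" => TotalRep.down ρ X.pe (2 * X.r)
local notation "𝐂" => TotalRep.up ρ' X.pe' (2 * X.r + 1)
local notation "𝐃" => TotalRep.down ρ' X.pe' (2 * X.r + 1)
local notation "𝐑" => Submodule.map (𝐀 ^ X.r) (TotalRep.fib ρ X.q 0)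
local notation "𝐋" => Submodule.map (𝐁 ^ X.r) (TotalRep.fib ρ X.q (2 * X.r))

include L

theorem x_apply (e : E) (m : M') :
    ρ'.x (some e) m = L.I (X.tgt' (some e)) (ρ.x e (L.Q (X.src' (some e)) m)) := by
  rw [← ρ'.x_P, ← L.I_Q, L.x_I]

theorem y_apply (e : E) (m : M') :
    ρ'.y (some e) m = L.I (X.src' (some e)) (ρ.y e (L.Q (X.tgt' (some e)) m)) := by
  rw [← ρ'.y_P, ← L.I_Q, L.y_I]

theorem Q_x (e : E) (m : M') :
    L.Q (X.tgt' (some e)) (ρ'.x (some e) m) = ρ.x e (L.Q (X.src' (some e)) m) := by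
  rw [L.x_apply, L.Q_I, X.π_tgt', ρ.P_x]

theorem Q_y (e : E) (m : M') :
    L.Q (X.src' (some e)) (ρ'.y (some e) m) = ρ.y e (L.Q (X.tgt' (some e)) m) := by
  rw [L.y_apply, L.Q_I, X.π_src', ρ.P_y]

theorem Q_eq_zero {u w : V'} (h : u ≠ w) {m : M'} (hm : ρ'.P w m = m) : L.Q u m = 0 := by
  rw [← L.Q_P, ← hm, ρ'.P_ne _ _ _ h, map_zero]

theorem I_eq_zero {u : V'} {j : V} (h : X.π u ≠ j) {m : M} (hm : ρ.P j m = m) : L.I u m = 0 := by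
  rw [← L.I_P, ← hm, ρ.P_ne _ _ _ h, map_zero]

theorem I_mem_fib {k : ℕ} (m : M) : L.I (X.q' k) m ∈ ρ'.fib X.q' k := by
  rw [mem_fib, L.P_I]

theorem I_injOn {u : V'} {m m₂ : M} (hm : ρ.P (X.π u) m = m) (hm₂ : ρ.P (X.π u) m₂ = m₂)
    (h : L.I u m = L.I u m₂) : m = m₂ := by
  rw [← hm, ← hm₂, ← L.Q_I, ← L.Q_I, h]

theorem Q_I_iL {m : M} (hm : m ∈ ρ.fib X.q X.r) : L.Q X.iL (L.I X.iL m) = m := by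
  rw [L.Q_I, X.π_iL, ← mem_fib_r]; exact hm

theorem Q_I_iR {m : M} (hm : m ∈ ρ.fib X.q X.r) : L.Q X.iR (L.I X.iR m) = m := by
  rw [L.Q_I, X.π_iR, ← mem_fib_r]; exact hm

theorem Q_mem_fib {u : V'} {k : ℕ} (hu : X.π u = X.q k) (m : M') : L.Q u m ∈ ρ.fib X.q k := by
  rw [mem_fib, ← hu, L.P_Q]

theorem up'_I {k : ℕ} (hk : k < X.r) {m : M} (hm : m ∈ ρ.fib X.q k) :
    𝐂 (L.I (X.κL (X.q k)) m) = L.I (X.κL (X.q (k + 1))) (𝐀 m) := by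
  have h0 : X.src' (some (X.pe k)) = X.q' k := by
    rw [X.src'_some, X.path.src k (by omega), X.q'_of_lt hk]
  rw [← X.q'_of_le hk.le, up_apply X.path' (by omega) (L.I_mem_fib m), X.pe'_of_lt hk, ← h0, L.x_I,
    X.tgt'_some, X.path.tgt k (by omega), up_apply X.path (by omega) hm]

theorem down'_I {k : ℕ} (hk : X.r ≤ k) (hk' : k < 2 * X.r) {m : M} (hm : m ∈ ρ.fib X.q (k + 1)) :
    𝐃 (L.I (X.κR (X.q (k + 1))) m) = L.I (X.κR (X.q k)) (𝐁 m) := by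
  have h0 : X.tgt' (some (X.pe k)) = X.q' (k + 1 + 1) := by
    rw [X.tgt'_some, X.path.tgt k (by omega), X.q'_succ_of_lt (by omega) (by omega)]
  rw [← X.q'_succ (by omega), down_apply X.path' (by omega) (L.I_mem_fib m), X.pe'_succ hk, ← h0,
    L.y_I, X.src'_some, X.path.src k (by omega), down_apply X.path (by omega) hm]

theorem up'_pow_I {k : ℕ} (hk : k ≤ X.r) {m : M} (hm : m ∈ ρ.fib X.q 0) :
    (𝐂 ^ k) (L.I (X.κL (X.q 0)) m) = L.I (X.κL (X.q k)) ((𝐀 ^ k) m) := by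
  induction k with
  | zero => simp
  | succ k ih =>
    rw [pow_succ', Module.End.mul_apply, ih (by omega),
      L.up'_I (by omega) (up_pow_mem X.path (by omega) hm), ← Module.End.mul_apply, ← pow_succ']

theorem down'_pow_I {k : ℕ} (hk : k ≤ X.r) {m : M} (hm : m ∈ ρ.fib X.q (2 * X.r)) :
    (𝐃 ^ k) (L.I (X.κR (X.q (2 * X.r))) m) = L.I (X.κR (X.q (2 * X.r - k))) ((𝐁 ^ k) m) := by
  induction k with
  | zero => simp
  | succ k ih =>
    have h1 := down_pow_mem X.path (k := k) (by omega) hm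
    have h2 : 2 * X.r - k = 2 * X.r - (k + 1) + 1 := by omega
    rw [h2] at h1
    rw [pow_succ', Module.End.mul_apply, ih (by omega), h2, L.down'_I (by omega) (by omega) h1,
      ← Module.End.mul_apply, ← pow_succ']

theorem up'_pow_eq {m : M'} (hm : m ∈ ρ'.fib X.q' 0) :
    ∃ z ∈ ρ.fib X.q 0, m = L.I (X.κL (X.q 0)) z ∧ (𝐂 ^ X.r) m = L.I X.iL ((𝐀 ^ X.r) z) := by
  have h0 := X.q'_of_le (Nat.zero_le X.r)
  have hz : L.Q (X.κL (X.q 0)) m ∈ ρ.fib X.q 0 := L.Q_mem_fib (X.π_κL _) m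
  have hm' : m = L.I (X.κL (X.q 0)) (L.Q (X.κL (X.q 0)) m) := by
    rw [L.I_Q, ← h0, mem_fib.1 hm]
  refine ⟨_, hz, hm', ?_⟩
  conv_lhs => rw [hm']
  rw [L.up'_pow_I le_rfl hz, X.q_r, X.κL_i]

theorem down'_pow_eq {m : M'} (hm : m ∈ ρ'.fib X.q' (2 * X.r + 1)) :
    ∃ z ∈ ρ.fib X.q (2 * X.r), m = L.I (X.κR (X.q (2 * X.r))) z ∧
      (𝐃 ^ X.r) m = L.I X.iR ((𝐁 ^ X.r) z) := by
  have h0 := X.q'_succ (show X.r ≤ 2 * X.r by omega)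
  have hz : L.Q (X.κR (X.q (2 * X.r))) m ∈ ρ.fib X.q (2 * X.r) := L.Q_mem_fib (X.π_κR _) m
  have hm' : m = L.I (X.κR (X.q (2 * X.r))) (L.Q (X.κR (X.q (2 * X.r))) m) := by
    rw [L.I_Q, ← h0, mem_fib.1 hm]
  refine ⟨_, hz, hm', ?_⟩
  conv_lhs => rw [hm']
  rw [L.down'_pow_I le_rfl hz, show 2 * X.r - X.r = X.r by omega, X.q_r, X.κR_i]

theorem map_up'_pow : (ρ'.fib X.q' 0).map (𝐂 ^ X.r) = (𝐑).map (L.I X.iL) := by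
  apply le_antisymm
  · rintro _ ⟨m, hm, rfl⟩
    obtain ⟨z, hz, -, h⟩ := L.up'_pow_eq hm
    exact ⟨_, ⟨z, hz, rfl⟩, h.symm⟩
  · rintro _ ⟨_, ⟨z, hz, rfl⟩, rfl⟩
    refine ⟨L.I (X.κL (X.q 0)) z, ?_, ?_⟩
    · rw [← X.q'_of_le (Nat.zero_le X.r)]; exact L.I_mem_fib z
    · rw [L.up'_pow_I le_rfl hz, X.q_r, X.κL_i]

theorem map_down'_pow :
    (ρ'.fib X.q' (2 * X.r + 1)).map (𝐃 ^ X.r) = (𝐋).map (L.I X.iR) := by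
  apply le_antisymm
  · rintro _ ⟨m, hm, rfl⟩
    obtain ⟨z, hz, -, h⟩ := L.down'_pow_eq hm
    exact ⟨_, ⟨z, hz, rfl⟩, h.symm⟩
  · rintro _ ⟨_, ⟨z, hz, rfl⟩, rfl⟩
    refine ⟨L.I (X.κR (X.q (2 * X.r))) z, ?_, ?_⟩
    · rw [← X.q'_succ (show X.r ≤ 2 * X.r by omega)]; exact L.I_mem_fib z
    · rw [L.down'_pow_I le_rfl hz, show 2 * X.r - X.r = X.r by omega, X.q_r, X.κR_i]

theorem up'_iL (m : M) : 𝐂 (L.I X.iL m) = ρ'.x none (L.I X.iL m) := by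
  have := L.I_mem_fib (k := X.r) m
  rw [X.q'_r] at this
  rw [up_apply X.path' (by omega) this, X.pe'_r]

theorem down'_iR (m : M) : 𝐃 (L.I X.iR m) = ρ'.y none (L.I X.iR m) := by
  have := L.I_mem_fib (k := X.r + 1) m
  rw [X.q'_r_succ] at this
  have hr := X.r_pos
  rw [down_apply X.path' (by omega) this, X.pe'_r]

end Cover

namespace Link

open TotalRep Expansion

variable {V V' E M N M' N' : Type} [Fintype V] [Fintype V'] [AddCommGroup M] [Module ℂ M]
  [AddCommGroup N] [Module ℂ N] [AddCommGroup M'] [Module ℂ M'] [AddCommGroup N'] [Module ℂ N']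
  {X : Expansion V V' E} {J : V' → N →ₗ[ℂ] N'} {J' : V' → N' →ₗ[ℂ] N}
  {ρ : TotalRep X.src X.tgt M N} {ρ' : TotalRep X.src' X.tgt' M' N'} (L : Link X J J' ρ ρ')

local notation "𝐀" => TotalRep.up ρ X.pe (2 * X.r)
local notation "𝐁" => TotalRep.down ρ X.pe (2 * X.r)
local notation "𝐂" => TotalRep.up ρ' X.pe' (2 * X.r + 1)
local notation "𝐃" => TotalRep.down ρ' X.pe' (2 * X.r + 1)
local notation "𝐑" => Submodule.map (𝐀 ^ X.r) (TotalRep.fib ρ X.q 0)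
local notation "𝐋" => Submodule.map (𝐁 ^ X.r) (TotalRep.fib ρ X.q (2 * X.r))

include L

theorem map_up'_pow_succ : (ρ'.fib X.q' 0).map (𝐂 ^ (X.r + 1)) = (𝐑).map (L.I X.iR) := by
  rw [pow_succ', Module.End.mul_eq_comp, Submodule.map_comp, L.map_up'_pow, ← Submodule.map_comp]
  ext m
  constructor <;> rintro ⟨z, hz, rfl⟩ <;> refine ⟨z, hz, ?_⟩ <;>
    rw [LinearMap.comp_apply, L.up'_iL, L.starL z hz]

theorem map_down'_pow_succ :
    (ρ'.fib X.q' (2 * X.r + 1)).map (𝐃 ^ (X.r + 1)) = (𝐋).map (L.I X.iL) := by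
  rw [pow_succ', Module.End.mul_eq_comp, Submodule.map_comp, L.map_down'_pow, ← Submodule.map_comp]
  ext m
  constructor <;> rintro ⟨z, hz, rfl⟩ <;> refine ⟨z, hz, ?_⟩ <;>
    rw [LinearMap.comp_apply, L.down'_iR, L.starR z hz]
/-- The two composites of the maps across the new edge are the composites `x y` and `y x` at the
doubled vertex. -/
def Mid (L : Link X J J' ρ ρ') : Prop :=
  (∀ z ∈ ρ.fib X.q X.r, ρ'.y none (ρ'.x none (L.I X.iL z)) = L.I X.iL (𝐀 (𝐁 z))) ∧
  ∀ z ∈ ρ.fib X.q X.r, ρ'.x none (ρ'.y none (L.I X.iR z)) = L.I X.iR (𝐁 (𝐀 z))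

theorem I_iL_mem (m : M) : L.I X.iL m ∈ ρ'.fib X.q' X.r := by
  rw [← X.q'_r]; exact L.I_mem_fib m

theorem I_iR_mem (m : M) : L.I X.iR m ∈ ρ'.fib X.q' (X.r + 1) := by
  rw [← X.q'_r_succ]; exact L.I_mem_fib m

theorem down'_I_left {k : ℕ} (hk : k < X.r) {m : M} (hm : m ∈ ρ.fib X.q (k + 1)) :
    𝐃 (L.I (X.κL (X.q (k + 1))) m) = L.I (X.κL (X.q k)) (𝐁 m) := by
  have h0 : X.tgt' (some (X.pe k)) = X.q' (k + 1) := by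
    rw [X.tgt'_some, X.path.tgt k (by omega), X.q'_of_le hk]
  rw [← X.q'_of_le hk, down_apply X.path' (by omega) (L.I_mem_fib m), X.pe'_of_lt hk, ← h0, L.y_I,
    X.src'_some, X.path.src k (by omega), ← X.q'_of_lt hk, X.q'_of_le hk.le,
    down_apply X.path (by omega) hm]

theorem up'_I_right {k : ℕ} (hk : X.r ≤ k) (hk' : k < 2 * X.r) {m : M} (hm : m ∈ ρ.fib X.q k) :
    𝐂 (L.I (X.κR (X.q k)) m) = L.I (X.κR (X.q (k + 1))) (𝐀 m) := by
  have h0 : X.src' (some (X.pe k)) = X.q' (k + 1) := by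
    rw [X.src'_some, X.path.src k (by omega), X.q'_succ hk]
  rw [← X.q'_succ hk, up_apply X.path' (by omega) (L.I_mem_fib m), X.pe'_succ hk, ← h0, L.x_I,
    X.tgt'_some, X.path.tgt k (by omega), ← X.q'_succ_of_lt (by omega) (by omega),
    X.q'_succ (by omega), up_apply X.path (by omega) hm]

theorem down'_iL {k : ℕ} (hk : X.r = k + 1) {z : M} (hz : z ∈ ρ.fib X.q X.r) :
    𝐃 (L.I X.iL z) = L.I (X.κL (X.q k)) (𝐁 z) := by
  rw [hk] at hz
  rw [← L.down'_I_left (by omega) hz, ← hk, X.q_r, X.κL_i]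

theorem up'_iR {z : M} (hz : z ∈ ρ.fib X.q X.r) :
    𝐂 (L.I X.iR z) = L.I (X.κR (X.q (X.r + 1))) (𝐀 z) := by
  have hr := X.r_pos
  rw [← L.up'_I_right le_rfl (by omega) hz, X.q_r, X.κR_i]

theorem up'_down'_iL {z : M} (hz : z ∈ ρ.fib X.q X.r) :
    𝐂 (𝐃 (L.I X.iL z)) = L.I X.iL (𝐀 (𝐁 z)) := by
  obtain ⟨k, hk⟩ := Nat.exists_eq_add_one_of_ne_zero X.r_pos.ne'
  have hz' : 𝐁 z ∈ ρ.fib X.q k := by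
    rw [hk] at hz
    rw [down_apply X.path (by omega) hz]
    exact y_mem_fib X.path (by omega) z
  rw [L.down'_iL hk hz, L.up'_I (by omega) hz', ← hk, X.q_r, X.κL_i]

theorem down'_up'_iR {z : M} (hz : z ∈ ρ.fib X.q X.r) :
    𝐃 (𝐂 (L.I X.iR z)) = L.I X.iR (𝐁 (𝐀 z)) := by
  have hr := X.r_pos
  have hz' : 𝐀 z ∈ ρ.fib X.q (X.r + 1) := by
    rw [up_apply X.path (by omega) hz]
    exact x_mem_fib X.path (by omega) z
  rw [L.up'_iR hz, L.down'_I le_rfl (by omega) hz', X.q_r, X.κR_i]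

theorem x'_iL_mem (m : M) : ρ'.x none (L.I X.iL m) ∈ ρ'.fib X.q' (X.r + 1) := by
  rw [mem_fib, X.q'_r_succ, ← X.tgt'_none, ρ'.P_x]

theorem y'_iR_mem (m : M) : ρ'.y none (L.I X.iR m) ∈ ρ'.fib X.q' X.r := by
  rw [mem_fib, X.q'_r, ← X.src'_none, ρ'.P_y]

theorem down'_up'_iL (m : M) : 𝐃 (𝐂 (L.I X.iL m)) = ρ'.y none (ρ'.x none (L.I X.iL m)) := by
  rw [L.up'_iL, down_apply X.path' (by omega) (L.x'_iL_mem m), X.pe'_r]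

theorem up'_down'_iR (m : M) : 𝐂 (𝐃 (L.I X.iR m)) = ρ'.x none (ρ'.y none (L.I X.iR m)) := by
  rw [L.down'_iR, up_apply X.path' (by omega) (L.y'_iR_mem m), X.pe'_r]

theorem x_y_I {u : V'} (h : X.κL (X.π u) = u) (e : E) (m : M) :
    ρ'.x (some e) (ρ'.y (some e) (L.I u m)) = L.I u (ρ.x e (ρ.y e m)) := by
  by_cases h1 : X.tgt' (some e) = u
  · rw [← h1, L.y_I, L.x_I]
  · rw [y_eq_zero (L.P_I u m) h1, map_zero, L.I_eq_zero _ (ρ.P_x e _)]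
    intro h2
    rw [h2, ← X.tgt'_some] at h
    exact h1 h

theorem y_x_I {u : V'} (h : X.κR (X.π u) = u) (e : E) (m : M) :
    ρ'.y (some e) (ρ'.x (some e) (L.I u m)) = L.I u (ρ.y e (ρ.x e m)) := by
  by_cases h1 : X.src' (some e) = u
  · rw [← h1, L.x_I, L.y_I]
  · rw [x_eq_zero (L.P_I u m) h1, map_zero, L.I_eq_zero _ (ρ.P_y e _)]
    intro h2
    rw [h2, ← X.src'_some] at h
    exact h1 h

theorem x_none_I {u : V'} (h : u ≠ X.iL) (m : M) : ρ'.x none (L.I u m) = 0 :=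
  x_eq_zero (L.P_I u m) (by rw [X.src'_none]; exact h.symm)

theorem y_none_I {u : V'} (h : u ≠ X.iR) (m : M) : ρ'.y none (L.I u m) = 0 :=
  y_eq_zero (L.P_I u m) (by rw [X.tgt'_none]; exact h.symm)

theorem mid [Fintype E] (hM : ρ'.Moment) : L.Mid := by
  have hr := X.r_pos
  have hL := ladder X.path' hM
  refine ⟨fun z hz => ?_, fun z hz => ?_⟩
  · rw [← L.down'_up'_iL, ← L.up'_down'_iL hz, hL.comm X.r hr (by omega) _ (L.I_iL_mem z)]
  · rw [← L.up'_down'_iR, ← L.down'_up'_iR hz, hL.comm (X.r + 1) (by omega) (by omega) _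
      (L.I_iR_mem z)]

theorem moment_fwd [Fintype E] (hM : ρ.Moment) (hmid : L.Mid) : ρ'.Moment := by
  have hr := X.r_pos
  obtain ⟨k, hk⟩ := Nat.exists_eq_succ_of_ne_zero X.r_pos.ne'
  rw [moment_iff] at hM ⊢
  intro u m' hm'
  obtain ⟨m, hm, rfl⟩ : ∃ m, ρ.P (X.π u) m = m ∧ m' = L.I u m :=
    ⟨L.Q u m', L.P_Q u m', by rw [L.I_Q, hm']⟩
  by_cases hu : X.π u = X.i
  · rw [hu, ← mem_fib_r] at hm
    rcases X.eq_iL_or hu with rfl | rfl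
    · have h1 := L.I_iL_mem m
      rw [hk] at h1
      rw [sum_x_y_apply X.path' (by omega) h1, sum_y_x_apply X.path' (by omega) h1,
        L.up'_down'_iL hm, L.down'_up'_iL, hmid.1 m hm]
    · have h1 := L.I_iR_mem m
      rw [sum_x_y_apply X.path' (by omega) h1, sum_y_x_apply X.path' (by omega) h1,
        L.down'_up'_iR hm, L.up'_down'_iR, hmid.2 m hm]
  · rw [Fintype.sum_option, Fintype.sum_option, L.x_none_I, L.y_none_I, map_zero, map_zero]
    · simp_rw [L.x_y_I (X.κL_eq hu), L.y_x_I (X.κR_eq hu)]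
      rw [← map_sum, ← map_sum, hM _ m hm]
    · rintro rfl; exact hu X.π_iR
    · rintro rfl; exact hu X.π_iL

theorem moment_bwd [Fintype E] (hM : ρ'.Moment) (hsup : ρ.fib X.q X.r ≤ 𝐑 ⊔ 𝐋) : ρ.Moment := by
  have hr := X.r_pos
  obtain ⟨k, hk⟩ := Nat.exists_eq_succ_of_ne_zero X.r_pos.ne'
  have hmid := L.mid hM
  have hL := ladder X.path' hM
  rw [moment_iff] at hM ⊢
  intro j m hm
  by_cases hj : j = X.i
  · subst hj
    rw [← mem_fib_r] at hm
    have hm' := hm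
    rw [hk] at hm'
    rw [sum_x_y_apply X.path (by omega) hm', sum_y_x_apply X.path (by omega) hm']
    have hp : ∀ z ∈ ρ.fib X.q X.r, 𝐀 (𝐁 z) ∈ ρ.fib X.q X.r := by
      intro z hz
      rw [hk] at hz
      rw [down_apply X.path (by omega) hz,
        up_apply X.path (by omega) (y_mem_fib X.path (by omega) z)]
      have h1 := x_mem_fib (ρ := ρ) X.path (k := k) (by omega) (ρ.y (X.pe k) z)
      rwa [← Nat.succ_eq_add_one, ← hk] at h1
    obtain ⟨z₁, hz₁, z₂, hz₂, rfl⟩ := Submodule.mem_sup.1 (hsup hm)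
    simp only [map_add]
    have h1 := left_le hz₁
    have h2 := right_le hz₂
    congr 1
    · have hmem : 𝐀 (𝐁 z₁) ∈ 𝐑 := by
        have h3 : L.I X.iL z₁ ∈ (ρ'.fib X.q' 0).map (𝐂 ^ X.r) := by
          rw [L.map_up'_pow]; exact ⟨z₁, hz₁, rfl⟩
        obtain ⟨z₀, hz₀, h4⟩ := h3
        have h5 : 𝐃 (𝐂 (L.I X.iL z₁)) ∈ (𝐑).map (L.I X.iL) := by
          rw [← h4, hL.mul_pow_apply (by omega) hz₀, ← L.map_up'_pow]
          exact ⟨_, hL.mapB 0 (by omega) _ (hL.mapA 0 (by omega) _ hz₀), rfl⟩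
        rw [L.down'_up'_iL, hmid.1 z₁ h1] at h5
        obtain ⟨z, hz, h6⟩ := h5
        have h7 := left_le hz
        rw [← L.Q_I_iL (hp z₁ h1), ← h6, L.Q_I_iL h7]
        exact hz
      have h3 := hmid.2 z₁ h1
      rw [← L.starL z₁ hz₁, hmid.1 z₁ h1, L.starL _ hmem] at h3
      rw [← L.Q_I_iR (hp z₁ h1), h3, L.Q_I_iR (down_up_mem h1)]
    · have hmem : 𝐁 (𝐀 z₂) ∈ 𝐋 := by
        have h3 : L.I X.iR z₂ ∈ (ρ'.fib X.q' (2 * X.r + 1)).map (𝐃 ^ X.r) := by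
          rw [L.map_down'_pow]; exact ⟨z₂, hz₂, rfl⟩
        obtain ⟨z₀, hz₀, h4⟩ := h3
        have h5 : 𝐂 (𝐃 (L.I X.iR z₂)) ∈ (𝐋).map (L.I X.iR) := by
          rw [← h4, hL.reverse.mul_pow_apply (by omega) hz₀, ← L.map_down'_pow]
          exact ⟨_, hL.mapA (2 * X.r) (by omega) _ (hL.mapB (2 * X.r) (by omega) _ hz₀), rfl⟩
        rw [L.up'_down'_iR, hmid.2 z₂ h2] at h5
        obtain ⟨z, hz, h6⟩ := h5
        have h7 := right_le hz
        rw [← L.Q_I_iR (down_up_mem h2), ← h6, L.Q_I_iR h7]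
        exact hz
      have h3 := hmid.1 z₂ h2
      rw [← L.starR z₂ hz₂, hmid.2 z₂ h2, L.starR _ hmem] at h3
      rw [← L.Q_I_iL (hp z₂ h2), ← h3, L.Q_I_iL (down_up_mem h2)]
  · have h := hM (X.κL j) (L.I (X.κL j) m) (L.P_I _ m)
    have hu : X.π (X.κL j) ≠ X.i := by rwa [X.π_κL]
    rw [Fintype.sum_option, Fintype.sum_option, L.x_none_I, L.y_none_I, map_zero, map_zero] at h
    · simp_rw [L.x_y_I (X.κL_eq hu), L.y_x_I (X.κR_eq hu)] at h
      rw [← map_sum, ← map_sum, zero_add, zero_add] at h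
      refine L.I_injOn ?_ ?_ h <;> rw [X.π_κL, map_sum]
      · exact Finset.sum_congr rfl fun e _ => P_x_y hm e
      · exact Finset.sum_congr rfl fun e _ => P_y_x hm e
    · intro h1; rw [h1] at hu; exact hu X.π_iR
    · intro h1; rw [h1] at hu; exact hu X.π_iL
theorem down'_up'_pow_iL {s : ℕ} (hmid : L.Mid)
    (hcomm : ∀ z ∈ ρ.fib X.q X.r, 𝐀 (𝐁 z) = 𝐁 (𝐀 z)) {z : M} (hz : z ∈ ρ.fib X.q X.r) :
    ((𝐃 * 𝐂) ^ s) (L.I X.iL z) = L.I X.iL (((𝐁 * 𝐀) ^ s) z) := by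
  induction s generalizing z with
  | zero => simp
  | succ s ih =>
    rw [pow_succ, pow_succ, Module.End.mul_apply, Module.End.mul_apply, Module.End.mul_apply,
      L.down'_up'_iL, hmid.1 z hz, hcomm z hz, ih (down_up_mem hz), Module.End.mul_apply]

theorem down'_up'_pow_iR {s : ℕ} {z : M} (hz : z ∈ ρ.fib X.q X.r) :
    ((𝐃 * 𝐂) ^ s) (L.I X.iR z) = L.I X.iR (((𝐁 * 𝐀) ^ s) z) := by
  induction s generalizing z with
  | zero => simp
  | succ s ih =>
    rw [pow_succ, pow_succ, Module.End.mul_apply, Module.End.mul_apply, Module.End.mul_apply,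
      L.down'_up'_iR hz, ih (down_up_mem hz), Module.End.mul_apply]

theorem I_Q_of_mem_r {m : M'} (hm : m ∈ ρ'.fib X.q' X.r) : L.I X.iL (L.Q X.iL m) = m := by
  rw [mem_fib, X.q'_r] at hm
  rw [L.I_Q, hm]

theorem I_Q_of_mem_r_succ {m : M'} (hm : m ∈ ρ'.fib X.q' (X.r + 1)) :
    L.I X.iR (L.Q X.iR m) = m := by
  rw [mem_fib, X.q'_r_succ] at hm
  rw [L.I_Q, hm]

theorem nil_fwd [Fintype E] {s : ℕ} (hM : ρ.Moment) (hM' : ρ'.Moment) (hN : ρ.Nil)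
    (hnil : ∀ z ∈ ρ.fib X.q X.r, ((𝐁 * 𝐀) ^ s) z = 0)
    {U' : Submodule ℂ M'} (hU' : ρ'.out U' = U') : U' = ⊥ := by
  have hr := X.r_pos
  have hmid := L.mid hM'
  have hL := ladder X.path hM
  have hcomm : ∀ z ∈ ρ.fib X.q X.r, 𝐀 (𝐁 z) = 𝐁 (𝐀 z) := hL.comm X.r hr (by omega)
  set U : Submodule ℂ M := ⨆ u, U'.map (L.Q u) with hU
  have hQU : ∀ u, ∀ m ∈ U', L.Q u m ∈ U := fun u m hm =>
    Submodule.mem_iSup_of_mem u ⟨m, hm, rfl⟩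
  have hx : ∀ u e, ∀ m ∈ U', L.Q u (ρ'.x (some e) m) ∈ ρ.out U := by
    intro u e m hm
    by_cases h : X.tgt' (some e) = u
    · rw [← h, L.Q_x]; exact x_mem_out e (hQU _ m hm)
    · rw [L.Q_eq_zero (Ne.symm h) (ρ'.P_x _ m)]; exact zero_mem _
  have hy : ∀ u e, ∀ m ∈ U', L.Q u (ρ'.y (some e) m) ∈ ρ.out U := by
    intro u e m hm
    by_cases h : X.src' (some e) = u
    · rw [← h, L.Q_y]; exact y_mem_out e (hQU _ m hm)
    · rw [L.Q_eq_zero (Ne.symm h) (ρ'.P_y _ m)]; exact zero_mem _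
  have hup : ∀ m ∈ U' ⊓ ρ'.fib X.q' 0, L.Q X.iL ((𝐂 ^ X.r) m) ∈ ρ.out U := by
    rintro m ⟨hm, hm0⟩
    obtain ⟨k, hk⟩ := Nat.exists_eq_add_one_of_ne_zero hr.ne'
    have h1 := up_pow_succ_apply X.path' (k := k) (by omega) hm0
    rw [X.pe'_of_lt (by omega), ← hk] at h1
    rw [h1]
    exact hx _ _ _ (up_pow_mem_of_out_le hU'.le k hm)
  have hdown : ∀ m ∈ U' ⊓ ρ'.fib X.q' (2 * X.r + 1), L.Q X.iR ((𝐃 ^ X.r) m) ∈ ρ.out U := by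
    rintro m ⟨hm, hm0⟩
    obtain ⟨k, hk⟩ := Nat.exists_eq_add_one_of_ne_zero hr.ne'
    have h1 := down_pow_succ_apply X.path' (k := k) (by omega) hm0
    rw [show 2 * X.r + 1 - (k + 1) = X.r + 1 by omega, X.pe'_succ le_rfl, ← hk] at h1
    rw [h1]
    exact hy _ _ _ (down_pow_mem_of_out_le hU'.le k hm)
  have hup' : ∀ m ∈ U' ⊓ ρ'.fib X.q' 0, L.Q X.iR ((𝐂 ^ (X.r + 1)) m) ∈ ρ.out U := by
    intro m hm
    obtain ⟨z, hz, -, h2⟩ := L.up'_pow_eq hm.2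
    have h3 := hup m hm
    have hz' : (𝐀 ^ X.r) z ∈ 𝐑 := ⟨z, hz, rfl⟩
    rw [h2, L.Q_I_iL (left_le hz')] at h3
    rwa [pow_succ', Module.End.mul_apply, h2, L.up'_iL, L.starL _ hz', L.Q_I_iR (left_le hz')]
  have hdown' : ∀ m ∈ U' ⊓ ρ'.fib X.q' (2 * X.r + 1),
      L.Q X.iL ((𝐃 ^ (X.r + 1)) m) ∈ ρ.out U := by
    intro m hm
    obtain ⟨z, hz, -, h2⟩ := L.down'_pow_eq hm.2
    have h3 := hdown m hm
    have hz' : (𝐁 ^ X.r) z ∈ 𝐋 := ⟨z, hz, rfl⟩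
    rw [h2, L.Q_I_iR (right_le hz')] at h3
    rwa [pow_succ', Module.End.mul_apply, h2, L.down'_iR, L.starR _ hz', L.Q_I_iL (right_le hz')]
  have hPU : ∀ u, ∀ m ∈ U', ρ'.P u m ∈ U' := by
    intro u m hm
    have h1 : ρ'.P u m ∈ (ρ'.out U').map (ρ'.P u) := ⟨m, hU'.ge hm, rfl⟩
    exact hU'.le (map_P_out_le U' u h1)
  have hUbot : U = ⊥ := by
    refine hN U (iSup_le fun u => ?_)
    rintro _ ⟨m, hm, rfl⟩
    by_cases hu : X.π u = X.i
    · rcases X.eq_iL_or hu with rfl | rfl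
      · have h1 : ρ'.P X.iL m ∈ U' ⊓ ρ'.fib X.q' X.r :=
          ⟨hPU _ m hm, mem_fib.2 (by rw [X.q'_r, ρ'.P_self])⟩
        obtain ⟨_, ⟨z₁, hz₁, rfl⟩, _, ⟨z₂, hz₂, rfl⟩, h2⟩ := Submodule.mem_sup.1
          (inf_fib_le X.path' hM' hU' (s := s) hr (by omega) (fun u hu => by
            have hz := L.Q_mem_fib (u := X.iL) (k := X.r) (by rw [X.π_iL, X.q_r]) u
            rw [← L.I_Q_of_mem_r hu, L.down'_up'_pow_iL hmid hcomm hz, hnil _ hz, map_zero]) h1)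
        rw [← L.Q_P, ← h2, map_add]
        rw [show 2 * X.r + 1 - X.r = X.r + 1 by omega]
        exact add_mem (hup z₁ hz₁) (hdown' z₂ hz₂)
      · have h1 : ρ'.P X.iR m ∈ U' ⊓ ρ'.fib X.q' (X.r + 1) :=
          ⟨hPU _ m hm, mem_fib.2 (by rw [X.q'_r_succ, ρ'.P_self])⟩
        obtain ⟨_, ⟨z₁, hz₁, rfl⟩, _, ⟨z₂, hz₂, rfl⟩, h2⟩ := Submodule.mem_sup.1
          (inf_fib_le X.path' hM' hU' (s := s) (by omega) (by omega) (fun u hu => by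
            have hz := L.Q_mem_fib (u := X.iR) (k := X.r) (by rw [X.π_iR, X.q_r]) u
            rw [← L.I_Q_of_mem_r_succ hu, L.down'_up'_pow_iR hz, hnil _ hz, map_zero]) h1)
        rw [← L.Q_P, ← h2, map_add]
        rw [show 2 * X.r + 1 - (X.r + 1) = X.r by omega]
        exact add_mem (hup' z₁ hz₁) (hdown z₂ hz₂)
    · have h1 : ρ'.out U' ≤ (ρ.out U).comap (L.Q u) := by
        refine out_le fun e m hm => ?_
        cases e with
        | none =>
          refine ⟨?_, ?_⟩ <;> rw [Submodule.mem_comap]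
          · rw [L.Q_eq_zero _ (ρ'.P_x _ m)]
            · exact zero_mem _
            · rintro rfl; rw [X.tgt'_none] at hu; exact hu X.π_iR
          · rw [L.Q_eq_zero _ (ρ'.P_y _ m)]
            · exact zero_mem _
            · rintro rfl; rw [X.src'_none] at hu; exact hu X.π_iL
        | some e => exact ⟨hx u e m hm, hy u e m hm⟩
      exact h1 (hU'.ge hm)
  rw [eq_bot_iff]
  intro m hm
  rw [Submodule.mem_bot, ← ρ'.P_sum m]
  refine Finset.sum_eq_zero fun u _ => ?_
  have h1 := hQU u m hm
  rw [hUbot, Submodule.mem_bot] at h1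
  rw [← L.I_Q, h1, map_zero]
theorem nil_bwd [Fintype E] {s : ℕ} (hM : ρ.Moment) (hN : ρ'.Nil)
    (hnil : ∀ z ∈ ρ'.fib X.q' (X.r + 1), ((𝐃 * 𝐂) ^ s) z = 0)
    {U : Submodule ℂ M} (hU : ρ.out U = U) : U = ⊥ := by
  have hr := X.r_pos
  set U' : Submodule ℂ M' := ⨆ u, U.map (L.I u) with hU'
  have hIU : ∀ u, ∀ m ∈ U, L.I u m ∈ U' := fun u m hm =>
    Submodule.mem_iSup_of_mem u ⟨m, hm, rfl⟩
  have hx : ∀ u, X.κL (X.π u) = u → ∀ e, ∀ m ∈ U, L.I u (ρ.x e m) ∈ ρ'.out U' := by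
    intro u hu e m hm
    by_cases h : X.π u = X.tgt e
    · rw [← hu, h, ← X.tgt'_some, ← L.x_I]; exact x_mem_out _ (hIU _ m hm)
    · rw [L.I_eq_zero h (ρ.P_x e m)]; exact zero_mem _
  have hy : ∀ u, X.κR (X.π u) = u → ∀ e, ∀ m ∈ U, L.I u (ρ.y e m) ∈ ρ'.out U' := by
    intro u hu e m hm
    by_cases h : X.π u = X.src e
    · rw [← hu, h, ← X.src'_some, ← L.y_I]; exact y_mem_out _ (hIU _ m hm)
    · rw [L.I_eq_zero h (ρ.P_y e m)]; exact zero_mem _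
  have hPU : ∀ j, ∀ m ∈ U, ρ.P j m ∈ U := by
    intro j m hm
    have h1 : ρ.P j m ∈ (ρ.out U).map (ρ.P j) := ⟨m, hU.ge hm, rfl⟩
    exact hU.le (map_P_out_le U j h1)
  have hdec : ∀ m ∈ U, ∃ z₁ ∈ U ⊓ ρ.fib X.q 0, ∃ z₂ ∈ U ⊓ ρ.fib X.q (2 * X.r),
      (𝐀 ^ X.r) z₁ + (𝐁 ^ X.r) z₂ = ρ.P X.i m := by
    intro m hm
    have h1 : ρ.P X.i m ∈ U ⊓ ρ.fib X.q X.r := ⟨hPU _ m hm, mem_fib_r.2 (ρ.P_self _ _)⟩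
    obtain ⟨_, ⟨z₁, hz₁, rfl⟩, _, ⟨z₂, hz₂, rfl⟩, h2⟩ := Submodule.mem_sup.1
      (inf_fib_le X.path hM hU (s := s) hr (by omega) (fun z hz => by
        have h := L.down'_up'_pow_iR (s := s) hz
        rw [hnil _ (L.I_iR_mem z)] at h
        have h3 : ∀ j, ((𝐁 * 𝐀) ^ j) z ∈ ρ.fib X.q X.r := by
          intro j
          induction j with
          | zero => exact hz
          | succ j ih =>
            rw [pow_succ', Module.End.mul_apply]
            exact down_up_mem ih
        rw [← L.Q_I_iR (h3 s), ← h, map_zero]) h1)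
    rw [show 2 * X.r - X.r = X.r by omega] at h2
    exact ⟨z₁, hz₁, z₂, hz₂, h2⟩
  have hUbot : U' = ⊥ := by
    refine hN U' (iSup_le fun u => ?_)
    rintro _ ⟨m, hm, rfl⟩
    by_cases hu : X.π u = X.i
    · obtain ⟨k, hk⟩ := Nat.exists_eq_add_one_of_ne_zero hr.ne'
      obtain ⟨z₁, hz₁, z₂, hz₂, h⟩ := hdec m hm
      rcases X.eq_iL_or hu with rfl | rfl
      · rw [← L.I_P, X.π_iL, ← h, map_add]
        refine add_mem ?_ ?_
        · have h1 := up_pow_succ_apply X.path (k := k) (by omega) hz₁.2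
          rw [← hk] at h1
          rw [h1]
          exact hx _ (by rw [X.π_iL, X.κL_i]) _ _ (up_pow_mem_of_out_le hU.le k hz₁.1)
        · rw [← L.starR _ ⟨z₂, hz₂.2, rfl⟩]
          exact y_mem_out _ (hIU _ _ (down_pow_mem_of_out_le hU.le _ hz₂.1))
      · rw [← L.I_P, X.π_iR, ← h, map_add]
        refine add_mem ?_ ?_
        · rw [← L.starL _ ⟨z₁, hz₁.2, rfl⟩]
          exact x_mem_out _ (hIU _ _ (up_pow_mem_of_out_le hU.le _ hz₁.1))
        · have h1 := down_pow_succ_apply X.path (k := k) (by omega) hz₂.2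
          rw [← hk] at h1
          rw [h1]
          exact hy _ (by rw [X.π_iR, X.κR_i]) _ _ (down_pow_mem_of_out_le hU.le k hz₂.1)
    · have h1 : ρ.out U ≤ (ρ'.out U').comap (L.I u) := out_le fun e m hm =>
        ⟨hx u (X.κL_eq hu) e m hm, hy u (X.κR_eq hu) e m hm⟩
      exact h1 (hU.ge hm)
  rw [eq_bot_iff]
  intro m hm
  rw [Submodule.mem_bot, ← ρ.P_sum m]
  refine Finset.sum_eq_zero fun j _ => ?_
  have h1 := hIU (X.κL j) m hm
  rw [hUbot, Submodule.mem_bot] at h1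
  rw [← X.π_κL j, ← L.Q_I, h1, map_zero]

theorem fib_le_sup {s : ℕ} (hT' : TightLadder 𝐂 𝐃 (ρ'.fib X.q') (2 * X.r + 1) s) :
    ρ.fib X.q X.r ≤ 𝐑 ⊔ 𝐋 := by
  intro z hz
  have h := hT'.le_sup (k := X.r) X.r_pos (by omega) (L.I_iL_mem z)
  rw [L.map_up'_pow, show 2 * X.r + 1 - X.r = X.r + 1 by omega, L.map_down'_pow_succ,
    ← Submodule.map_sup] at h
  obtain ⟨z', hz', h1⟩ := h
  have h2 : 𝐑 ⊔ 𝐋 ≤ ρ.fib X.q X.r := sup_le left_le right_le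
  rw [← L.Q_I_iL hz, ← h1, L.Q_I_iL (h2 hz')]
  exact hz'

theorem socle_fwd [Fintype E] {s : ℕ} (hs : s ≤ X.r) (hS : ρ.Socle) (hmid : L.Mid)
    (hT : TightLadder 𝐀 𝐁 (ρ.fib X.q) (2 * X.r) s) : ρ'.Socle := by
  have hr := X.r_pos
  have hr2 : 2 * X.r - X.r = X.r := by omega
  have hdisj := hT.disjoint (k := X.r) hs (by omega) hr (by omega)
  have hsup := hT.le_sup (k := X.r) hr (by omega)
  rw [hr2] at hdisj hsup
  intro u m' hm' hxy hTm
  obtain ⟨m, hm, rfl⟩ : ∃ m, ρ.P (X.π u) m = m ∧ m' = L.I u m :=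
    ⟨L.Q u m', L.P_Q u m', by rw [L.I_Q, hm']⟩
  by_cases hu : X.π u = X.i
  · rw [hu, ← mem_fib_r] at hm
    obtain ⟨z₁, hz₁, z₂, hz₂, rfl⟩ := Submodule.mem_sup.1 (hsup hm)
    have h1 := left_le hz₁
    have h2 := right_le hz₂
    obtain ⟨k, hk⟩ := Nat.exists_eq_add_one_of_ne_zero hr.ne'
    rcases X.eq_iL_or hu with rfl | rfl
    · have h3 := (hxy none).1
      rw [map_add, map_add, L.starL _ hz₁, ← L.starR _ hz₂, hmid.2 _ h2, ← map_add] at h3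
      have h4 : z₁ + 𝐁 (𝐀 z₂) = 0 := by
        rw [← L.Q_I_iR (add_mem h1 (down_up_mem h2)), h3, map_zero]
      have h5 : 𝐁 (𝐀 z₂) ∈ 𝐋 := by
        rw [← hT.comm X.r hr (by omega) _ h2]
        exact hT.toLadder.reverse.mul_mem_map_pow (by omega) hz₂
      have h7 : z₁ = 0 := Submodule.disjoint_def.1 hdisj _ hz₁
        (by rw [eq_neg_of_add_eq_zero_left h4]; exact neg_mem h5)
      rw [h7, zero_add] at hxy ⊢
      have h8 : 𝐃 (L.I X.iL z₂) = 0 := by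
        have h9 := L.I_iL_mem z₂
        rw [hk] at h9
        rw [down_apply X.path' (by omega) h9]
        exact (hxy _).2
      rw [L.down'_iL hk h2] at h8
      have h10 : 𝐁 z₂ ∈ ρ.fib X.q k := hT.mapB k (by omega) _ (by rw [← hk]; exact h2)
      have h11 : 𝐁 z₂ = 0 := by
        rw [← mem_fib.1 h10, ← X.π_κL (X.q k), ← L.Q_I, h8, map_zero]
      rw [hT.reverse.eq_zero_of_apply hs hr (by omega) hz₂ h11, map_zero]
    · have h3 := (hxy none).2
      rw [map_add, map_add, L.starR _ hz₂, ← L.starL _ hz₁, hmid.1 _ h1, ← map_add] at h3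
      have h1' : 𝐀 (𝐁 z₁) ∈ ρ.fib X.q X.r := by
        rw [hT.comm X.r hr (by omega) _ h1]; exact down_up_mem h1
      have h4 : 𝐀 (𝐁 z₁) + z₂ = 0 := by
        rw [← L.Q_I_iL (add_mem h1' h2), h3, map_zero]
      have h5 : 𝐀 (𝐁 z₁) ∈ 𝐑 := by
        rw [hT.comm X.r hr (by omega) _ h1]
        exact hT.toLadder.mul_mem_map_pow (by omega) hz₁
      have h7 : z₂ = 0 := Submodule.disjoint_def.1 hdisj _
        (by rw [eq_neg_of_add_eq_zero_right h4]; exact neg_mem h5) hz₂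
      rw [h7, add_zero] at hxy ⊢
      have h8 : 𝐂 (L.I X.iR z₁) = 0 := by
        rw [up_apply X.path' (by omega) (L.I_iR_mem z₁)]
        exact (hxy _).1
      rw [L.up'_iR h1] at h8
      have h10 : 𝐀 z₁ ∈ ρ.fib X.q (X.r + 1) := hT.mapA X.r (by omega) _ h1
      have h11 : 𝐀 z₁ = 0 := by
        rw [← mem_fib.1 h10, ← X.π_κR (X.q (X.r + 1)), ← L.Q_I, h8, map_zero]
      rw [hT.eq_zero_of_apply hs hr (by omega) hz₁ h11, map_zero]
  · have h0 : L.I u m = 0 ↔ m = 0 := ⟨fun h => by rw [← hm, ← L.Q_I, h, map_zero],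
      fun h => by rw [h, map_zero]⟩
    rw [h0]
    refine hS _ m hm (fun e => ⟨?_, ?_⟩) ?_
    · by_cases h : X.src e = X.π u
      · have h1 := (hxy (some e)).1
        rw [← X.κR_eq hu, ← h, ← X.src'_some, L.x_I] at h1
        rw [← ρ.P_x, ← X.π_tgt', ← L.Q_I, h1, map_zero]
      · exact x_eq_zero hm h
    · by_cases h : X.tgt e = X.π u
      · have h1 := (hxy (some e)).2
        rw [← X.κL_eq hu, ← h, ← X.tgt'_some, L.y_I] at h1
        rw [← ρ.P_y, ← X.π_src', ← L.Q_I, h1, map_zero]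
      · exact y_eq_zero hm h
    · rw [← hm, ← L.Q_I, L.T_Q, hTm, map_zero]

theorem socle_bwd {s : ℕ} (hs : s ≤ X.r) (hS : ρ'.Socle)
    (hT' : TightLadder 𝐂 𝐃 (ρ'.fib X.q') (2 * X.r + 1) s) : ρ.Socle := by
  have hr := X.r_pos
  intro j m hm hxy hTm
  by_cases hj : j = X.i
  · rw [hj, ← mem_fib_r] at hm
    have hxm : 𝐀 m = 0 := by rw [up_apply X.path (by omega) hm, (hxy _).1]
    obtain ⟨k, hk⟩ := Nat.exists_eq_add_one_of_ne_zero hr.ne'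
    have hym : 𝐁 m = 0 := by
      have h := hm
      rw [hk] at h
      rw [down_apply X.path (by omega) h, (hxy _).2]
    obtain ⟨z₁, hz₁, z₂, hz₂, rfl⟩ := Submodule.mem_sup.1 (L.fib_le_sup hT' hm)
    have h1 := left_le hz₁
    have h2 := right_le hz₂
    have h3 : (𝐃 ^ X.r) (L.I X.iL (z₁ + z₂)) = 0 := by
      rw [show 𝐃 ^ X.r = 𝐃 ^ k * 𝐃 by rw [← pow_succ, ← hk], Module.End.mul_apply, L.down'_iL hk hm,
      hym, map_zero, map_zero]
    rw [map_add, map_add, hT'.pow_eq_zero hs hr (by omega)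
      (by rw [L.map_up'_pow]; exact ⟨_, hz₁, rfl⟩), zero_add] at h3
    have h4 : L.I X.iL z₂ = 0 := hT'.reverse.eq_zero_of_pow_apply (k := X.r + 1) (by omega)
      (by omega) (by omega)
      (by simp only [Nat.sub_zero]; rw [L.map_down'_pow_succ]; exact ⟨_, hz₂, rfl⟩) h3
    have h5 : z₂ = 0 := by rw [← L.Q_I_iL h2, h4, map_zero]
    rw [h5, add_zero] at hxm ⊢
    have h6 : 𝐂 (L.I X.iR z₁) = 0 := by rw [L.up'_iR h1, hxm, map_zero]
    have h7 : L.I X.iR z₁ = 0 := hT'.eq_zero_of_apply (k := X.r + 1) (by omega)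
      (by omega) (by omega) (by rw [L.map_up'_pow_succ]; exact ⟨_, hz₁, rfl⟩) h6
    rw [← L.Q_I_iR h1, h7, map_zero]
  · have hu : X.π (X.κL j) ≠ X.i := by rwa [X.π_κL]
    have hR : X.κL j = X.κR j := X.κL_eq_κR j hj
    have h0 : L.I (X.κL j) m = 0 := by
      refine hS _ _ (L.P_I _ _) (fun e => ?_) (by rw [L.T_I, hTm, map_zero])
      cases e with
      | none => exact ⟨L.x_none_I (fun h => hu (by rw [h, X.π_iL])) m,
          L.y_none_I (X.κL_ne_iR j) m⟩
      | some e =>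
        constructor
        · by_cases h : X.src' (some e) = X.κL j
          · rw [← h, L.x_I, (hxy e).1, map_zero]
          · exact x_eq_zero (L.P_I _ _) h
        · by_cases h : X.tgt' (some e) = X.κL j
          · rw [← h, L.y_I, (hxy e).2, map_zero]
          · exact y_eq_zero (L.P_I _ _) h
    rw [← hm, ← X.π_κL j, ← L.Q_I, h0, map_zero]

theorem map_P_out {u : V'} (hu : X.π u ≠ X.i) :
    (ρ'.out ⊤).map (ρ'.P u) = ((ρ.out ⊤).map (ρ.P (X.π u))).map (L.I u) := by
  apply le_antisymm
  · rw [Submodule.map_le_iff_le_comap]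
    refine out_le fun e m _ => ?_
    have hz : (0 : M') ∈ ((ρ.out ⊤).map (ρ.P (X.π u))).map (L.I u) := zero_mem _
    rw [Submodule.mem_comap, Submodule.mem_comap]
    cases e with
    | none =>
      rw [P_x_ne, P_y_ne]
      · exact ⟨hz, hz⟩
      · rw [X.src'_none]; exact fun h => hu (by rw [← h, X.π_iL])
      · rw [X.tgt'_none]; exact fun h => hu (by rw [← h, X.π_iR])
    | some e =>
      constructor
      · by_cases h : X.tgt' (some e) = u
        · subst h
          rw [ρ'.P_x, L.x_apply, ← L.I_P]
          exact ⟨_, ⟨_, x_mem_out e Submodule.mem_top, rfl⟩, rfl⟩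
        · rw [P_x_ne h]; exact hz
      · by_cases h : X.src' (some e) = u
        · subst h
          rw [ρ'.P_y, L.y_apply, ← L.I_P]
          exact ⟨_, ⟨_, y_mem_out e Submodule.mem_top, rfl⟩, rfl⟩
        · rw [P_y_ne h]; exact hz
  · rw [Submodule.map_le_iff_le_comap, Submodule.map_le_iff_le_comap]
    refine out_le fun e m _ => ?_
    simp only [Submodule.mem_comap]
    rw [L.I_P, L.I_P]
    constructor
    · by_cases h : X.tgt e = X.π u
      · rw [← L.P_I, ← X.κL_eq hu, ← h, ← X.tgt'_some, ← L.x_I]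
        exact ⟨_, x_mem_out _ Submodule.mem_top, rfl⟩
      · rw [L.I_eq_zero (Ne.symm h) (ρ.P_x e m)]; exact zero_mem _
    · by_cases h : X.src e = X.π u
      · rw [← L.P_I, ← X.κR_eq hu, ← h, ← X.src'_some, ← L.y_I]
        exact ⟨_, y_mem_out _ Submodule.mem_top, rfl⟩
      · rw [L.I_eq_zero (Ne.symm h) (ρ.P_y e m)]; exact zero_mem _

theorem finrank_map_I {u : V'} {S : Submodule ℂ M} (hS : S ≤ LinearMap.range (ρ.P (X.π u))) :
    Module.finrank ℂ (S.map (L.I u)) = Module.finrank ℂ S := by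
  have hinj : Function.Injective ((L.I u).domRestrict S) := by
    intro a b hab
    exact Subtype.ext (L.I_injOn (mem_range_P.1 (hS a.2)) (mem_range_P.1 (hS b.2)) hab)
  rw [← LinearMap.range_domRestrict, LinearMap.finrank_range_of_inj hinj]

theorem range_P (u : V') : LinearMap.range (ρ'.P u) = (LinearMap.range (ρ.P (X.π u))).map (L.I u) := by
  apply le_antisymm
  · rintro _ ⟨m, rfl⟩
    rw [← L.I_Q]
    exact ⟨_, ⟨_, L.P_Q u m⟩, rfl⟩
  · rintro _ ⟨_, ⟨m, rfl⟩, rfl⟩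
    exact ⟨_, L.P_I u _⟩

theorem finrank_map_P_out {u : V'} (hu : X.π u ≠ X.i) :
    Module.finrank ℂ ((ρ'.out ⊤).map (ρ'.P u)) =
      Module.finrank ℂ ((ρ.out ⊤).map (ρ.P (X.π u))) := by
  rw [L.map_P_out hu, L.finrank_map_I]
  rw [Submodule.map_le_iff_le_comap]
  exact fun m _ => ⟨m, rfl⟩

theorem top_iff {u : V'} (hu : X.π u ≠ X.i) : ρ'.Top u ↔ ρ.Top (X.π u) := by
  rw [TotalRep.Top, TotalRep.Top, L.map_P_out hu, L.range_P]
  refine ⟨fun h => ?_, fun h => Submodule.map_mono h⟩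
  have h1 := Submodule.map_mono (f := L.Q u) h
  have key : ∀ S ≤ LinearMap.range (ρ.P (X.π u)), (S.map (L.I u)).map (L.Q u) = S := by
    intro S hS
    rw [← Submodule.map_comp]
    ext m
    constructor
    · rintro ⟨z, hz, rfl⟩
      rw [LinearMap.comp_apply, L.Q_I, mem_range_P.1 (hS hz)]; exact hz
    · intro hm
      exact ⟨m, hm, by rw [LinearMap.comp_apply, L.Q_I, mem_range_P.1 (hS hm)]⟩
  rwa [key _ le_rfl, key] at h1
  rw [Submodule.map_le_iff_le_comap]
  exact fun m _ => ⟨m, rfl⟩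

theorem top_iL (hsup : ρ.fib X.q X.r ≤ 𝐑 ⊔ 𝐋) : ρ'.Top X.iL := by
  obtain ⟨k, hk⟩ := Nat.exists_eq_add_one_of_ne_zero X.r_pos.ne'
  rintro m hm
  rw [mem_range_P] at hm
  have h1 : L.Q X.iL m ∈ ρ.fib X.q X.r := by rw [mem_fib_r, ← X.π_iL, L.P_Q]
  obtain ⟨z₁, hz₁, z₂, hz₂, h⟩ := Submodule.mem_sup.1 (hsup h1)
  have h2 : m = L.I X.iL z₁ + L.I X.iL z₂ := by rw [← map_add, h, L.I_Q, hm]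
  refine ⟨m, ?_, hm⟩
  rw [h2]
  refine add_mem ?_ ?_
  · obtain ⟨z₀, hz₀, rfl⟩ := hz₁
    have h3 := up_pow_succ_apply X.path (k := k) (by omega) hz₀
    rw [← hk] at h3
    have h4 : X.tgt' (some (X.pe k)) = X.iL := by
      rw [X.tgt'_some, X.path.tgt k (by omega), ← hk, X.q_r, X.κL_i]
    rw [h3, ← h4, ← L.x_I]
    exact x_mem_out _ Submodule.mem_top
  · rw [← L.starR _ hz₂]
    exact y_mem_out _ Submodule.mem_top

theorem top_iR (hsup : ρ.fib X.q X.r ≤ 𝐑 ⊔ 𝐋) : ρ'.Top X.iR := by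
  obtain ⟨k, hk⟩ := Nat.exists_eq_add_one_of_ne_zero X.r_pos.ne'
  rintro m hm
  rw [mem_range_P] at hm
  have h1 : L.Q X.iR m ∈ ρ.fib X.q X.r := by rw [mem_fib_r, ← X.π_iR, L.P_Q]
  obtain ⟨z₁, hz₁, z₂, hz₂, h⟩ := Submodule.mem_sup.1 (hsup h1)
  have h2 : m = L.I X.iR z₁ + L.I X.iR z₂ := by rw [← map_add, h, L.I_Q, hm]
  refine ⟨m, ?_, hm⟩
  rw [h2]
  refine add_mem ?_ ?_
  · rw [← L.starL _ hz₁]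
    exact x_mem_out _ Submodule.mem_top
  · obtain ⟨z₀, hz₀, rfl⟩ := hz₂
    have h3 := down_pow_succ_apply X.path (k := k) (by omega) hz₀
    rw [← hk, show 2 * X.r - X.r = X.r by omega] at h3
    have h4 : X.src' (some (X.pe X.r)) = X.iR := by
      rw [X.src'_some, X.path.src _ (by omega), X.q_r, X.κR_i]
    rw [h3, ← h4, ← L.y_I]
    exact y_mem_out _ Submodule.mem_top

omit L [Fintype V'] in
theorem top_i (hsup : ρ.fib X.q X.r ≤ 𝐑 ⊔ 𝐋) : ρ.Top X.i := by
  obtain ⟨k, hk⟩ := Nat.exists_eq_add_one_of_ne_zero X.r_pos.ne'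
  intro m hm
  rw [mem_range_P] at hm
  obtain ⟨z₁, hz₁, z₂, hz₂, rfl⟩ := Submodule.mem_sup.1 (hsup (mem_fib_r.2 hm))
  refine ⟨_, add_mem ?_ ?_, hm⟩
  · obtain ⟨z₀, hz₀, rfl⟩ := hz₁
    have h3 := up_pow_succ_apply X.path (k := k) (by omega) hz₀
    rw [← hk] at h3
    rw [h3]
    exact x_mem_out _ Submodule.mem_top
  · obtain ⟨z₀, hz₀, rfl⟩ := hz₂
    have h3 := down_pow_succ_apply X.path (k := k) (by omega) hz₀
    rw [← hk] at h3
    rw [h3]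
    exact y_mem_out _ Submodule.mem_top

end Link

/-! ### Morphisms -/

namespace TotalRep

variable {V E M N : Type} [Fintype V] [AddCommGroup M] [Module ℂ M] [AddCommGroup N] [Module ℂ N]
  {src tgt : E → V}

structure IsHom (ρ σ : TotalRep src tgt M N) (g : M →ₗ[ℂ] M) : Prop where
  P : ∀ a m, g (ρ.P a m) = σ.P a (g m)
  x : ∀ e m, g (ρ.x e m) = σ.x e (g m)
  y : ∀ e m, g (ρ.y e m) = σ.y e (g m)
  T : ∀ m, σ.T (g m) = ρ.T m

def Iso (ρ σ : TotalRep src tgt M N) : Prop := ∃ g : M ≃ₗ[ℂ] M, IsHom ρ σ g.toLinearMap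

theorem IsHom.symm {ρ σ : TotalRep src tgt M N} {g : M ≃ₗ[ℂ] M} (h : IsHom ρ σ g.toLinearMap) :
    IsHom σ ρ g.symm.toLinearMap where
  P a m := g.injective (by simpa using (h.P a (g.symm m)).symm)
  x e m := g.injective (by simpa using (h.x e (g.symm m)).symm)
  y e m := g.injective (by simpa using (h.y e (g.symm m)).symm)
  T m := by simpa using (h.T (g.symm m)).symm

namespace IsHom

variable {ρ σ : TotalRep src tgt M N} {g : M →ₗ[ℂ] M} {pe : ℕ → E} {q : ℕ → V} {n : ℕ}

theorem up (h : IsHom ρ σ g) (m : M) : g (ρ.up pe n m) = σ.up pe n (g m) := by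
  simp only [TotalRep.up, LinearMap.sum_apply, map_sum, h.x]

theorem down (h : IsHom ρ σ g) (m : M) : g (ρ.down pe n m) = σ.down pe n (g m) := by
  simp only [TotalRep.down, LinearMap.sum_apply, map_sum, h.y]

theorem up_pow (h : IsHom ρ σ g) (k : ℕ) (m : M) : g ((ρ.up pe n ^ k) m) = (σ.up pe n ^ k) (g m) := by
  induction k with
  | zero => rfl
  | succ k ih => rw [pow_succ', pow_succ', Module.End.mul_apply, Module.End.mul_apply, h.up, ih]

theorem down_pow (h : IsHom ρ σ g) (k : ℕ) (m : M) :
    g ((ρ.down pe n ^ k) m) = (σ.down pe n ^ k) (g m) := by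
  induction k with
  | zero => rfl
  | succ k ih => rw [pow_succ', pow_succ', Module.End.mul_apply, Module.End.mul_apply, h.down, ih]

theorem mem_fib (h : IsHom ρ σ g) {k : ℕ} {m : M} (hm : m ∈ ρ.fib q k) : g m ∈ σ.fib q k := by
  rw [TotalRep.mem_fib] at hm ⊢
  rw [← h.P, hm]

theorem mem_map_up_pow (h : IsHom ρ σ g) {j k : ℕ} {m : M}
    (hm : m ∈ (ρ.fib q j).map (ρ.up pe n ^ k)) : g m ∈ (σ.fib q j).map (σ.up pe n ^ k) := by
  obtain ⟨z, hz, rfl⟩ := hm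
  exact ⟨g z, h.mem_fib hz, (h.up_pow k z).symm⟩

theorem mem_map_down_pow (h : IsHom ρ σ g) {j k : ℕ} {m : M}
    (hm : m ∈ (ρ.fib q j).map (ρ.down pe n ^ k)) : g m ∈ (σ.fib q j).map (σ.down pe n ^ k) := by
  obtain ⟨z, hz, rfl⟩ := hm
  exact ⟨g z, h.mem_fib hz, (h.down_pow k z).symm⟩

end IsHom

end TotalRep

namespace Link

open TotalRep Expansion

variable {V V' E M N M' N' : Type} [Fintype V] [Fintype V'] [AddCommGroup M] [Module ℂ M]
  [AddCommGroup N] [Module ℂ N] [AddCommGroup M'] [Module ℂ M'] [AddCommGroup N'] [Module ℂ N']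
  {X : Expansion V V' E} {J : V' → N →ₗ[ℂ] N'} {J' : V' → N' →ₗ[ℂ] N}
  {ρ σ : TotalRep X.src X.tgt M N} {ρ' σ' : TotalRep X.src' X.tgt' M' N'}
  (L : Link X J J' ρ ρ') (K : Link X J J' σ σ')

theorem eq_of_apply_I {H : Type} [AddCommGroup H] [Module ℂ H] {f g : M' →ₗ[ℂ] H}
    (h : ∀ u m, ρ.P (X.π u) m = m → f (L.I u m) = g (L.I u m)) (m : M') : f m = g m := by
  rw [← ρ'.P_sum m, map_sum, map_sum]
  exact Finset.sum_congr rfl fun u _ => by rw [← L.I_Q, h u _ (L.P_Q u m)]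

/-- A map between representations, transferred to the doubled quiver. -/
def push (g : M →ₗ[ℂ] M) : M' →ₗ[ℂ] M' := ∑ u, K.I u ∘ₗ g ∘ₗ L.Q u

/-- A map between representations of the doubled quiver, transferred to the original one. -/
def pull (g : M' →ₗ[ℂ] M') : M →ₗ[ℂ] M := ∑ j, K.Q (X.κL j) ∘ₗ g ∘ₗ L.I (X.κL j)

theorem push_I {g : M →ₗ[ℂ] M} (hg : ∀ a m, g (ρ.P a m) = σ.P a (g m)) (u : V') (m : M) :
    push L K g (L.I u m) = K.I u (g m) := by
  rw [push, LinearMap.sum_apply, Finset.sum_eq_single u]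
  · rw [LinearMap.comp_apply, LinearMap.comp_apply, L.Q_I, hg, K.I_P]
  · intro w _ hw
    rw [LinearMap.comp_apply, LinearMap.comp_apply, L.Q_eq_zero hw (L.P_I u m), map_zero, map_zero]
  · exact fun h => absurd (Finset.mem_univ u) h

theorem isHom_push {g : M →ₗ[ℂ] M} (hg : IsHom ρ σ g) (hL : L.Mid) (hK : K.Mid)
    (hsup : ρ.fib X.q X.r ≤ (ρ.fib X.q 0).map (ρ.up X.pe (2 * X.r) ^ X.r) ⊔
      (ρ.fib X.q (2 * X.r)).map (ρ.down X.pe (2 * X.r) ^ X.r)) :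
    IsHom ρ' σ' (push L K g) where
  P a m := by
    refine L.eq_of_apply_I (f := push L K g ∘ₗ ρ'.P a) (g := σ'.P a ∘ₗ push L K g)
      (fun u m _ => ?_) m
    rw [LinearMap.comp_apply, LinearMap.comp_apply, push_I L K hg.P]
    by_cases h : a = u
    · rw [h, L.P_I, K.P_I, push_I L K hg.P]
    · rw [← L.P_I, ← K.P_I, ρ'.P_ne _ _ _ h, σ'.P_ne _ _ _ h, map_zero]
  x e m := by
    refine L.eq_of_apply_I (f := push L K g ∘ₗ ρ'.x e) (g := σ'.x e ∘ₗ push L K g)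
      (fun u m hm => ?_) m
    rw [LinearMap.comp_apply, LinearMap.comp_apply, push_I L K hg.P]
    cases e with
    | none =>
      by_cases h : u = X.iL
      · subst h
        rw [X.π_iL, ← mem_fib_r] at hm
        obtain ⟨z₁, hz₁, z₂, hz₂, rfl⟩ := Submodule.mem_sup.1 (hsup hm)
        have hz := hg.mem_fib (right_le hz₂)
        simp only [map_add]
        congr 1
        · rw [L.starL _ hz₁, push_I L K hg.P, K.starL _ (hg.mem_map_up_pow hz₁)]
        · rw [← L.starR _ hz₂, ← K.starR _ (hg.mem_map_down_pow hz₂), hL.2 _ (right_le hz₂),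
            hK.2 _ hz, push_I L K hg.P, hg.down, hg.up]
      · rw [L.x_none_I h, K.x_none_I h, map_zero]
    | some e =>
      by_cases h : X.src' (some e) = u
      · rw [← h, L.x_I, K.x_I, push_I L K hg.P, hg.x]
      · rw [x_eq_zero (L.P_I u m) h, x_eq_zero (K.P_I u _) h, map_zero]
  y e m := by
    refine L.eq_of_apply_I (f := push L K g ∘ₗ ρ'.y e) (g := σ'.y e ∘ₗ push L K g)
      (fun u m hm => ?_) m
    rw [LinearMap.comp_apply, LinearMap.comp_apply, push_I L K hg.P]
    cases e with
    | none =>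
      by_cases h : u = X.iR
      · subst h
        rw [X.π_iR, ← mem_fib_r] at hm
        obtain ⟨z₁, hz₁, z₂, hz₂, rfl⟩ := Submodule.mem_sup.1 (hsup hm)
        have hz := hg.mem_fib (left_le hz₁)
        simp only [map_add]
        congr 1
        · rw [← L.starL _ hz₁, ← K.starL _ (hg.mem_map_up_pow hz₁), hL.1 _ (left_le hz₁),
            hK.1 _ hz, push_I L K hg.P, hg.up, hg.down]
        · rw [L.starR _ hz₂, push_I L K hg.P, K.starR _ (hg.mem_map_down_pow hz₂)]
      · rw [L.y_none_I h, K.y_none_I h, map_zero]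
    | some e =>
      by_cases h : X.tgt' (some e) = u
      · rw [← h, L.y_I, K.y_I, push_I L K hg.P, hg.y]
      · rw [y_eq_zero (L.P_I u m) h, y_eq_zero (K.P_I u _) h, map_zero]
  T m := L.eq_of_apply_I (f := σ'.T ∘ₗ push L K g) (g := ρ'.T) (fun u m _ => by
    rw [LinearMap.comp_apply, push_I L K hg.P, K.T_I, L.T_I, hg.T]) m

theorem pull_P {g : M' →ₗ[ℂ] M'} (j : V) (m : M) :
    pull L K g (ρ.P j m) = K.Q (X.κL j) (g (L.I (X.κL j) m)) := by
  rw [pull, LinearMap.sum_apply, Finset.sum_eq_single j]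
  · conv_rhs => rw [← L.I_P, X.π_κL]
    rfl
  · intro k _ hk
    rw [LinearMap.comp_apply, LinearMap.comp_apply, L.I_eq_zero (j := j) _ (ρ.P_self _ _),
      map_zero, map_zero]
    rwa [X.π_κL]
  · exact fun h => absurd (Finset.mem_univ j) h

theorem P_pull {g : M' →ₗ[ℂ] M'} (j : V) (m : M) :
    σ.P j (pull L K g m) = K.Q (X.κL j) (g (L.I (X.κL j) m)) := by
  rw [pull, LinearMap.sum_apply, map_sum, Finset.sum_eq_single j]
  · have := K.P_Q (X.κL j) (g (L.I (X.κL j) m))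
    rwa [X.π_κL] at this
  · intro k _ hk
    have := K.P_Q (X.κL k) (g (L.I (X.κL k) m))
    rw [X.π_κL] at this
    rw [LinearMap.comp_apply, LinearMap.comp_apply, ← this, σ.P_ne _ _ _ hk.symm]
  · exact fun h => absurd (Finset.mem_univ j) h

theorem I_pull {g : M' →ₗ[ℂ] M'} (hg : IsHom ρ' σ' g)
    (hsup : ρ.fib X.q X.r ≤ (ρ.fib X.q 0).map (ρ.up X.pe (2 * X.r) ^ X.r) ⊔
      (ρ.fib X.q (2 * X.r)).map (ρ.down X.pe (2 * X.r) ^ X.r)) (u : V') (m : M) :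
    K.I u (pull L K g m) = g (L.I u m) := by
  have hκ : ∀ j m, K.I (X.κL j) (pull L K g m) = g (L.I (X.κL j) m) := fun j m => by
    rw [← K.I_P, X.π_κL, P_pull, K.I_Q, ← hg.P, L.P_I]
  have hiL : ∀ m, K.I X.iL (pull L K g m) = g (L.I X.iL m) := fun m => by rw [← X.κL_i, hκ]
  by_cases hu : X.π u = X.i
  · rcases X.eq_iL_or hu with rfl | rfl
    · exact hiL m
    · rw [← L.I_P, ← K.I_P, P_pull, ← pull_P, X.π_iR]
      have hm : ρ.P X.i m ∈ ρ.fib X.q X.r := mem_fib_r.2 (ρ.P_self _ _)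
      have hP : ∀ z ∈ ρ.fib X.q X.r, σ.P (X.π X.iL) (pull L K g z) = pull L K g z := by
        intro z hz
        rw [P_pull, ← pull_P, X.π_iL, mem_fib_r.1 hz]
      obtain ⟨z₁, hz₁, z₂, hz₂, h⟩ := Submodule.mem_sup.1 (hsup hm)
      rw [← h]
      simp only [map_add]
      congr 1
      · have h1 : L.I X.iL z₁ ∈ (ρ'.fib X.q' 0).map (ρ'.up X.pe' (2 * X.r + 1) ^ X.r) := by
          rw [L.map_up'_pow]; exact ⟨_, hz₁, rfl⟩
        have h2 := hg.mem_map_up_pow h1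
        rw [K.map_up'_pow] at h2
        obtain ⟨w, hw, h3⟩ := h2
        have h4 : pull L K g z₁ = w := K.I_injOn (u := X.iL) (hP _ (left_le hz₁))
          (by rw [X.π_iL, ← mem_fib_r]; exact left_le hw) (by rw [hiL, h3])
        rw [h4, ← K.starL _ hw, h3, ← hg.x, L.starL _ hz₁]
      · have h1 : L.I X.iR z₂ ∈
            (ρ'.fib X.q' (2 * X.r + 1)).map (ρ'.down X.pe' (2 * X.r + 1) ^ X.r) := by
          rw [L.map_down'_pow]; exact ⟨_, hz₂, rfl⟩
        have h2 := hg.mem_map_down_pow h1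
        rw [K.map_down'_pow] at h2
        obtain ⟨w, hw, h3⟩ := h2
        have h4 : pull L K g z₂ = w := K.I_injOn (u := X.iL) (hP _ (right_le hz₂))
          (by rw [X.π_iL, ← mem_fib_r]; exact right_le hw)
          (by rw [hiL, ← L.starR _ hz₂, hg.y, ← h3, K.starR _ hw])
        rw [h4, h3]
  · rw [← X.κL_eq hu, hκ]

theorem isHom_pull {g : M' →ₗ[ℂ] M'} (hg : IsHom ρ' σ' g)
    (hsup : ρ.fib X.q X.r ≤ (ρ.fib X.q 0).map (ρ.up X.pe (2 * X.r) ^ X.r) ⊔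
      (ρ.fib X.q (2 * X.r)).map (ρ.down X.pe (2 * X.r) ^ X.r)) :
    IsHom ρ σ (pull L K g) := by
  have hP : ∀ a m, pull L K g (ρ.P a m) = σ.P a (pull L K g m) := fun a m => by
    rw [pull_P, P_pull]
  refine ⟨hP, fun e m => ?_, fun e m => ?_, fun m => ?_⟩
  · refine K.I_injOn (u := X.tgt' (some e)) ?_ ?_ ?_
    · rw [← hP, X.π_tgt', ρ.P_x]
    · rw [X.π_tgt', σ.P_x]
    · rw [I_pull L K hg hsup, ← L.x_I, ← K.x_I, hg.x, I_pull L K hg hsup]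
  · refine K.I_injOn (u := X.src' (some e)) ?_ ?_ ?_
    · rw [← hP, X.π_src', ρ.P_y]
    · rw [X.π_src', σ.P_y]
    · rw [I_pull L K hg hsup, ← L.y_I, ← K.y_I, hg.y, I_pull L K hg hsup]
  · rw [← σ.P_sum (pull L K g m), map_sum]
    conv_rhs => rw [← ρ.P_sum m, map_sum]
    refine Finset.sum_congr rfl fun j _ => ?_
    rw [P_pull, K.T_Q, hg.T, ← L.T_Q, L.Q_I, X.π_κL]

theorem iso_iff (hL : L.Mid) (hK : K.Mid)
    (hρ : ρ.fib X.q X.r ≤ (ρ.fib X.q 0).map (ρ.up X.pe (2 * X.r) ^ X.r) ⊔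
      (ρ.fib X.q (2 * X.r)).map (ρ.down X.pe (2 * X.r) ^ X.r))
    (hσ : σ.fib X.q X.r ≤ (σ.fib X.q 0).map (σ.up X.pe (2 * X.r) ^ X.r) ⊔
      (σ.fib X.q (2 * X.r)).map (σ.down X.pe (2 * X.r) ^ X.r)) : ρ.Iso σ ↔ ρ'.Iso σ' := by
  constructor
  · rintro ⟨g, hg⟩
    have h1 := isHom_push L K hg hL hK hρ
    refine ⟨LinearEquiv.ofLinearMap (push L K g.toLinearMap) (push K L g.symm.toLinearMap) ?_ ?_, h1⟩
    · refine LinearMap.ext (K.eq_of_apply_I fun u m _ => ?_)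
      rw [LinearMap.comp_apply, push_I K L hg.symm.P, push_I L K hg.P]
      simp
    · refine LinearMap.ext (L.eq_of_apply_I fun u m _ => ?_)
      rw [LinearMap.comp_apply, push_I L K hg.P, push_I K L hg.symm.P]
      simp
  · rintro ⟨g, hg⟩
    refine ⟨LinearEquiv.ofLinearMap (pull L K g.toLinearMap) (pull K L g.symm.toLinearMap) ?_ ?_,
      isHom_pull L K hg hρ⟩
    · ext m
      rw [← σ.P_sum (LinearMap.comp _ _ m), ← σ.P_sum (LinearMap.id (R := ℂ) m)]
      refine Finset.sum_congr rfl fun j _ => ?_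
      rw [← X.π_κL j, ← K.Q_I, ← K.Q_I, LinearMap.comp_apply, I_pull L K hg hρ,
        I_pull K L hg.symm hσ]
      simp
    · ext m
      rw [← ρ.P_sum (LinearMap.comp _ _ m), ← ρ.P_sum (LinearMap.id (R := ℂ) m)]
      refine Finset.sum_congr rfl fun j _ => ?_
      rw [← X.π_κL j, ← L.Q_I, ← L.Q_I, LinearMap.comp_apply, I_pull K L hg.symm hσ,
        I_pull L K hg hρ]
      simp

end Link

/-! ### Constructing linked representations -/

structure IsGrading {V M : Type} [Fintype V] [AddCommGroup M] [Module ℂ M]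
    (P : V → Module.End ℂ M) : Prop where
  self : ∀ a m, P a (P a m) = P a m
  ne : ∀ a b m, a ≠ b → P a (P b m) = 0
  sum : ∀ m, ∑ a, P a m = m

/-- Identifications of the `u`-th component of `M'` with the `π u`-th component of `M`. -/
structure Frame {V V' M M' : Type} [AddCommGroup M] [Module ℂ M] [AddCommGroup M'] [Module ℂ M']
    (π : V' → V) (P : V → Module.End ℂ M) (P' : V' → Module.End ℂ M') where
  I : V' → M →ₗ[ℂ] M'
  Q : V' → M' →ₗ[ℂ] M
  P_I : ∀ u m, P' u (I u m) = I u m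
  I_P : ∀ u m, I u (P (π u) m) = I u m
  P_Q : ∀ u m, P (π u) (Q u m) = Q u m
  Q_P : ∀ u m, Q u (P' u m) = Q u m
  Q_I : ∀ u m, Q u (I u m) = P (π u) m
  I_Q : ∀ u m, I u (Q u m) = P' u m

namespace Frame

section Basic

variable {V V' M M' : Type} [AddCommGroup M] [Module ℂ M] [AddCommGroup M'] [Module ℂ M']
  {π : V' → V} {P : V → Module.End ℂ M} {P' : V' → Module.End ℂ M'} (F : Frame π P P')

include F

theorem P_I_ne [Fintype V'] (hP' : IsGrading P') {u w : V'} (h : u ≠ w) (m : M) :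
    P' u (F.I w m) = 0 := by
  rw [← F.P_I, hP'.ne _ _ _ h]

theorem Q_P_ne [Fintype V'] (hP' : IsGrading P') {u w : V'} (h : u ≠ w) (m : M') :
    F.Q u (P' w m) = 0 := by
  rw [← F.Q_P, hP'.ne _ _ _ h, map_zero]

theorem I_P_ne [Fintype V] (hP : IsGrading P) {u : V'} {j : V} (h : π u ≠ j) (m : M) :
    F.I u (P j m) = 0 := by
  rw [← F.I_P, hP.ne _ _ _ h, map_zero]

end Basic

open TotalRep Expansion

variable {V V' E M N M' N' : Type} [Fintype V] [Fintype V'] [AddCommGroup M] [Module ℂ M]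
  [AddCommGroup N] [Module ℂ N] [AddCommGroup M'] [Module ℂ M'] [AddCommGroup N'] [Module ℂ N']
  {X : Expansion V V' E}

section Double

variable {ρ : TotalRep X.src X.tgt M N} {P' : V' → Module.End ℂ M'} {PN' : V' → Module.End ℂ N'}
  {PN : V → Module.End ℂ N}

/-- The representation of the doubled quiver with prescribed maps on the new edge. -/
def double (F : Frame X.π ρ.P P') (FN : Frame X.π PN PN') (hP' : IsGrading P')
    (α β : Module.End ℂ M) : TotalRep X.src' X.tgt' M' N' where
  P := P'
  x e := e.elim (F.I X.iR ∘ₗ α ∘ₗ F.Q X.iL)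
    fun e => F.I (X.tgt' (some e)) ∘ₗ ρ.x e ∘ₗ F.Q (X.src' (some e))
  y e := e.elim (F.I X.iL ∘ₗ β ∘ₗ F.Q X.iR)
    fun e => F.I (X.src' (some e)) ∘ₗ ρ.y e ∘ₗ F.Q (X.tgt' (some e))
  T := ∑ u, FN.I u ∘ₗ ρ.T ∘ₗ F.Q u
  P_self := hP'.self
  P_ne := hP'.ne
  P_sum := hP'.sum
  P_x e m := by
    cases e with
    | none => rw [X.tgt'_none]; exact F.P_I _ _
    | some e => exact F.P_I _ _
  x_P e m := by
    cases e with
    | none =>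
      simp only [X.src'_none, Option.elim_none, LinearMap.comp_apply, F.Q_P]
    | some e => simp only [Option.elim_some, LinearMap.comp_apply, F.Q_P]
  P_y e m := by
    cases e with
    | none => rw [X.src'_none]; exact F.P_I _ _
    | some e => exact F.P_I _ _
  y_P e m := by
    cases e with
    | none =>
      simp only [X.tgt'_none, Option.elim_none, LinearMap.comp_apply, F.Q_P]
    | some e => simp only [Option.elim_some, LinearMap.comp_apply, F.Q_P]

theorem exists_double [Fintype E] (F : Frame X.π ρ.P P') (FN : Frame X.π PN PN')
    (hP' : IsGrading P') (hPN' : IsGrading PN') (hTP : ∀ j m, PN j (ρ.T m) = ρ.T (ρ.P j m)) {s : ℕ}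
    (hs : s ≤ X.r) (hT : TightLadder (ρ.up X.pe (2 * X.r)) (ρ.down X.pe (2 * X.r)) (ρ.fib X.q)
      (2 * X.r) s) :
    ∃ ρ' : TotalRep X.src' X.tgt' M' N', ρ'.P = P' ∧
      (∀ u m, PN' u (ρ'.T m) = ρ'.T (ρ'.P u m)) ∧ ∃ L : Link X FN.I FN.Q ρ ρ', L.Mid := by
  have hr := X.r_pos
  have hr2 : 2 * X.r - X.r = X.r := by omega
  set A := ρ.up X.pe (2 * X.r)
  set B := ρ.down X.pe (2 * X.r)
  set R := (ρ.fib X.q 0).map (A ^ X.r)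
  set L := (ρ.fib X.q (2 * X.r)).map (B ^ X.r)
  have hdisj := hT.disjoint (k := X.r) hs (by omega) hr (by omega)
  have hsup := hT.le_sup (k := X.r) hr (by omega)
  rw [hr2] at hdisj hsup
  have hRp : ∀ z ∈ R, B (A z) ∈ R := fun z hz => hT.toLadder.mul_mem_map_pow (by omega) hz
  have hLp : ∀ z ∈ L, B (A z) ∈ L := fun z hz => by
    rw [← hT.comm X.r hr (by omega) _ (right_le hz)]
    exact hT.toLadder.reverse.mul_mem_map_pow (by omega) hz
  obtain ⟨α, hαR, hαL⟩ := exists_linearMap_eq_on_disjoint hdisj R.subtype ((B * A).domRestrict L)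
  obtain ⟨β, hβR, hβL⟩ := exists_linearMap_eq_on_disjoint hdisj ((B * A).domRestrict R) L.subtype
  replace hαR : ∀ z ∈ R, α z = z := fun z hz => hαR ⟨z, hz⟩
  replace hαL : ∀ z ∈ L, α z = B (A z) := fun z hz => hαL ⟨z, hz⟩
  replace hβR : ∀ z ∈ R, β z = B (A z) := fun z hz => hβR ⟨z, hz⟩
  replace hβL : ∀ z ∈ L, β z = z := fun z hz => hβL ⟨z, hz⟩
  set ρ' := F.double FN hP' α β
  have hQI : ∀ {z}, z ∈ ρ.fib X.q X.r → ∀ u, X.π u = X.i → F.Q u (F.I u z) = z := by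
    intro z hz u hu
    rw [F.Q_I, hu, mem_fib_r.1 hz]
  have hx : ∀ {z}, z ∈ ρ.fib X.q X.r → ρ'.x none (F.I X.iL z) = F.I X.iR (α z) := by
    intro z hz
    change F.I X.iR (α (F.Q X.iL (F.I X.iL z))) = _
    rw [hQI hz _ X.π_iL]
  have hy : ∀ {z}, z ∈ ρ.fib X.q X.r → ρ'.y none (F.I X.iR z) = F.I X.iL (β z) := by
    intro z hz
    change F.I X.iL (β (F.Q X.iR (F.I X.iR z))) = _
    rw [hQI hz _ X.π_iR]
  have hT' : ∀ u m, PN' u (ρ'.T m) = FN.I u (ρ.T (F.Q u m)) := by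
    intro u m
    change PN' u ((∑ u, FN.I u ∘ₗ ρ.T ∘ₗ F.Q u) m) = _
    rw [LinearMap.sum_apply, map_sum, Finset.sum_eq_single u]
    · exact FN.P_I _ _
    · exact fun w _ hw => FN.P_I_ne hPN' hw.symm _
    · exact fun h => absurd (Finset.mem_univ u) h
  have hTP' : ∀ u m, ρ'.T (P' u m) = FN.I u (ρ.T (F.Q u m)) := by
    intro u m
    change (∑ u, FN.I u ∘ₗ ρ.T ∘ₗ F.Q u) (P' u m) = _
    rw [LinearMap.sum_apply, Finset.sum_eq_single u]
    · simp only [LinearMap.comp_apply, F.Q_P]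
    · intro w _ hw
      simp only [LinearMap.comp_apply, F.Q_P_ne hP' hw, map_zero]
    · exact fun h => absurd (Finset.mem_univ u) h
  refine ⟨ρ', rfl, fun u m => by rw [hT']; exact (hTP' u m).symm, ⟨{
    I := F.I
    Q := F.Q
    P_I := F.P_I
    I_P := F.I_P
    P_Q := F.P_Q
    Q_P := F.Q_P
    Q_I := F.Q_I
    I_Q := F.I_Q
    x_I := fun e m => ?_
    y_I := fun e m => ?_
    T_I := fun u m => ?_
    T_Q := fun u m => ?_
    starL := fun z hz => by rw [hx (left_le hz), hαR z hz]
    starR := fun z hz => by rw [hy (right_le hz), hβL z hz] }, ?_, ?_⟩⟩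
  · change F.I _ (ρ.x e (F.Q _ (F.I _ m))) = _
    rw [F.Q_I, X.π_src', ρ.x_P]
  · change F.I _ (ρ.y e (F.Q _ (F.I _ m))) = _
    rw [F.Q_I, X.π_tgt', ρ.y_P]
  · rw [← F.P_I, hTP', F.Q_I, ← hTP, FN.I_P]
  · rw [← FN.Q_P, hT', FN.Q_I, hTP, F.P_Q]
  · intro z hz
    change ρ'.y none (ρ'.x none (F.I X.iL z)) = F.I X.iL (A (B z))
    rw [hT.comm X.r hr (by omega) _ hz]
    obtain ⟨z₁, hz₁, z₂, hz₂, rfl⟩ := Submodule.mem_sup.1 (hsup hz)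
    simp only [map_add]
    congr 1
    · rw [hx (left_le hz₁), hαR _ hz₁, hy (left_le hz₁), hβR _ hz₁]
    · rw [hx (right_le hz₂), hαL _ hz₂, hy (right_le (hLp _ hz₂)), hβL _ (hLp _ hz₂)]
  · intro z hz
    change ρ'.x none (ρ'.y none (F.I X.iR z)) = F.I X.iR (B (A z))
    obtain ⟨z₁, hz₁, z₂, hz₂, rfl⟩ := Submodule.mem_sup.1 (hsup hz)
    simp only [map_add]
    congr 1
    · rw [hy (left_le hz₁), hβR _ hz₁, hx (left_le (hRp _ hz₁)), hαR _ (hRp _ hz₁)]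
    · rw [hy (right_le hz₂), hβL _ hz₂, hx (right_le hz₂), hαL _ hz₂]

end Double

section Contract

variable {P : V → Module.End ℂ M} {ρ' : TotalRep X.src' X.tgt' M' N'}
  {PN' : V' → Module.End ℂ N'} {PN : V → Module.End ℂ N}

/-- Change the identification at `iR` to the one at `iL` followed by `Φ`. -/
def twist (F : Frame X.π P ρ'.P) (Φ Ψ : Module.End ℂ M')
    (hΦ : ∀ m, ρ'.P X.iR (Φ (ρ'.P X.iL m)) = Φ (ρ'.P X.iL m))
    (hΨ : ∀ m, ρ'.P X.iL (Ψ (ρ'.P X.iR m)) = Ψ (ρ'.P X.iR m))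
    (hΨΦ : ∀ m, Ψ (Φ (ρ'.P X.iL m)) = ρ'.P X.iL m)
    (hΦΨ : ∀ m, Φ (Ψ (ρ'.P X.iR m)) = ρ'.P X.iR m) : Frame X.π P ρ'.P := by
  classical
  have hI : ∀ m, ρ'.P X.iR (Φ (F.I X.iL m)) = Φ (F.I X.iL m) := fun m => by
    rw [← F.P_I, hΦ]
  exact {
    I := fun u => if u = X.iR then Φ ∘ₗ F.I X.iL else F.I u
    Q := fun u => if u = X.iR then F.Q X.iL ∘ₗ Ψ ∘ₗ ρ'.P X.iR else F.Q u
    P_I := fun u m => by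
      split_ifs with h
      · rw [h, LinearMap.comp_apply, hI]
      · exact F.P_I u m
    I_P := fun u m => by
      split_ifs with h
      · rw [h, LinearMap.comp_apply, LinearMap.comp_apply, X.π_iR, ← X.π_iL, F.I_P]
      · exact F.I_P u m
    P_Q := fun u m => by
      split_ifs with h
      · rw [h, LinearMap.comp_apply, X.π_iR, ← X.π_iL, F.P_Q]
      · exact F.P_Q u m
    Q_P := fun u m => by
      split_ifs with h
      · rw [h]; simp only [LinearMap.comp_apply, ρ'.P_self]
      · exact F.Q_P u m
    Q_I := fun u m => by
      split_ifs with h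
      · rw [h]
        simp only [LinearMap.comp_apply]
        rw [hI, ← F.P_I, hΨΦ, F.P_I, F.Q_I, X.π_iL, X.π_iR]
      · exact F.Q_I u m
    I_Q := fun u m => by
      split_ifs with h
      · rw [h]
        simp only [LinearMap.comp_apply]
        rw [F.I_Q, hΨ, hΦΨ]
      · exact F.I_Q u m }

/-- The representation of the original quiver induced by identifications of the fibres. -/
def contract (F : Frame X.π P ρ'.P) (FN : Frame X.π PN PN') (hP : IsGrading P) :
    TotalRep X.src X.tgt M N where
  P := P
  x e := F.Q (X.tgt' (some e)) ∘ₗ ρ'.x (some e) ∘ₗ F.I (X.src' (some e))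
  y e := F.Q (X.src' (some e)) ∘ₗ ρ'.y (some e) ∘ₗ F.I (X.tgt' (some e))
  T := ∑ j, FN.Q (X.κL j) ∘ₗ ρ'.T ∘ₗ F.I (X.κL j)
  P_self := hP.self
  P_ne := hP.ne
  P_sum := hP.sum
  P_x e m := by rw [← X.π_tgt']; exact F.P_Q _ _
  x_P e m := by simp only [LinearMap.comp_apply, ← X.π_src', F.I_P]
  P_y e m := by rw [← X.π_src']; exact F.P_Q _ _
  y_P e m := by simp only [LinearMap.comp_apply, ← X.π_tgt', F.I_P]

theorem exists_contract (F : Frame X.π P ρ'.P) (FN : Frame X.π PN PN')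
    (hP : IsGrading P) (hPN : IsGrading PN) (hi : PN X.i = 0)
    (hTP : ∀ u m, PN' u (ρ'.T m) = ρ'.T (ρ'.P u m)) {s : ℕ}
    (hs : s ≤ X.r) (hT : TightLadder (ρ'.up X.pe' (2 * X.r + 1)) (ρ'.down X.pe' (2 * X.r + 1))
      (ρ'.fib X.q') (2 * X.r + 1) s) :
    ∃ ρ : TotalRep X.src X.tgt M N, ρ.P = P ∧
      (∀ u m, PN u (ρ.T m) = ρ.T (ρ.P u m)) ∧ Nonempty (Link X FN.I FN.Q ρ ρ') := by
  have hr := X.r_pos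
  set A := ρ'.up X.pe' (2 * X.r + 1)
  set B := ρ'.down X.pe' (2 * X.r + 1)
  set R := (ρ'.fib X.q' 0).map (A ^ X.r)
  set R₁ := (ρ'.fib X.q' 0).map (A ^ (X.r + 1))
  set L := (ρ'.fib X.q' (2 * X.r + 1)).map (B ^ (X.r + 1))
  set L₁ := (ρ'.fib X.q' (2 * X.r + 1)).map (B ^ X.r)
  have hR₁ : ∀ z ∈ R₁, ∃ w ∈ R, A w = z := by
    rintro _ ⟨z, hz, rfl⟩
    exact ⟨_, ⟨z, hz, rfl⟩, by rw [pow_succ', Module.End.mul_apply]⟩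
  have hL : ∀ z ∈ L, ∃ w ∈ L₁, B w = z := by
    rintro _ ⟨z, hz, rfl⟩
    exact ⟨_, ⟨z, hz, rfl⟩, by rw [pow_succ', Module.End.mul_apply]⟩
  have hR₁' : ∀ z ∈ R, A z ∈ R₁ := by
    rintro _ ⟨z, hz, rfl⟩
    exact ⟨z, hz, by rw [pow_succ', Module.End.mul_apply]⟩
  have hL' : ∀ z ∈ L₁, B z ∈ L := by
    rintro _ ⟨z, hz, rfl⟩
    exact ⟨z, hz, by rw [pow_succ', Module.End.mul_apply]⟩
  have hfib : ∀ m, m ∈ ρ'.fib X.q' X.r ↔ ρ'.P X.iL m = m := fun m => by rw [mem_fib, X.q'_r]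
  have hfib₁ : ∀ m, m ∈ ρ'.fib X.q' (X.r + 1) ↔ ρ'.P X.iR m = m := fun m => by
    rw [mem_fib, X.q'_r_succ]
  have hd := hT.disjoint (k := X.r) hs (by omega) hr (by omega)
  have hd₁ := hT.disjoint (k := X.r + 1) (by omega) (by omega) (by omega) (by omega)
  have hsup := hT.le_sup (k := X.r) hr (by omega)
  have hsup₁ := hT.le_sup (k := X.r + 1) (by omega) (by omega)
  rw [show 2 * X.r + 1 - X.r = X.r + 1 by omega] at hd hsup
  rw [show 2 * X.r + 1 - (X.r + 1) = X.r by omega] at hd₁ hsup₁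
  have hRle : R ≤ ρ'.fib X.q' X.r := by
    rintro _ ⟨z, hz, rfl⟩
    exact up_pow_mem X.path' (by omega) hz
  have hR₁le : R₁ ≤ ρ'.fib X.q' (X.r + 1) := by
    rintro _ ⟨z, hz, rfl⟩
    exact up_pow_mem X.path' (by omega) hz
  have hLle : L ≤ ρ'.fib X.q' X.r := by
    rintro _ ⟨z, hz, rfl⟩
    have := down_pow_mem X.path' (k := X.r + 1) (by omega) hz
    rwa [show 2 * X.r + 1 - (X.r + 1) = X.r by omega] at this
  have hL₁le : L₁ ≤ ρ'.fib X.q' (X.r + 1) := by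
    rintro _ ⟨z, hz, rfl⟩
    have := down_pow_mem X.path' (k := X.r) (by omega) hz
    rwa [show 2 * X.r + 1 - X.r = X.r + 1 by omega] at this
  obtain ⟨g, hg⟩ := LinearMap.exists_leftInverse_of_injective (B.domRestrict L₁)
    (LinearMap.ker_eq_bot'.2 fun z hz => Subtype.ext (hT.reverse.eq_zero_of_apply (k := X.r) hs hr
      (by omega) z.2 hz))
  obtain ⟨g₁, hg₁⟩ := LinearMap.exists_leftInverse_of_injective (A.domRestrict R)
    (LinearMap.ker_eq_bot'.2 fun z hz => Subtype.ext (hT.eq_zero_of_apply (k := X.r) hs hr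
      (by omega) z.2 hz))
  obtain ⟨Φ, hΦR, hΦL⟩ := exists_linearMap_eq_on_disjoint hd (A.domRestrict R)
    ((L₁.subtype ∘ₗ g).domRestrict L)
  obtain ⟨Ψ, hΨR, hΨL⟩ := exists_linearMap_eq_on_disjoint hd₁ ((R.subtype ∘ₗ g₁).domRestrict R₁)
    (B.domRestrict L₁)
  replace hΦR : ∀ z ∈ R, Φ z = A z := fun z hz => hΦR ⟨z, hz⟩
  replace hΦL : ∀ z ∈ L₁, Φ (B z) = z := fun z hz => (hΦL ⟨B z, hL' z hz⟩).trans
    (congrArg Subtype.val (LinearMap.congr_fun hg ⟨z, hz⟩))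
  replace hΨR : ∀ z ∈ R, Ψ (A z) = z := fun z hz => (hΨR ⟨A z, hR₁' z hz⟩).trans
    (congrArg Subtype.val (LinearMap.congr_fun hg₁ ⟨z, hz⟩))
  replace hΨL : ∀ z ∈ L₁, Ψ z = B z := fun z hz => hΨL ⟨z, hz⟩
  have hdec : ∀ m, ∃ z ∈ R, ∃ w ∈ L₁, z + B w = ρ'.P X.iL m := fun m => by
    obtain ⟨z, hz, w, hw, h⟩ := Submodule.mem_sup.1 (hsup ((hfib _).2 (ρ'.P_self X.iL m)))
    obtain ⟨w₁, hw₁, rfl⟩ := hL w hw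
    exact ⟨z, hz, w₁, hw₁, h⟩
  have hdec₁ : ∀ m, ∃ z ∈ R, ∃ w ∈ L₁, A z + w = ρ'.P X.iR m := fun m => by
    obtain ⟨z, hz, w, hw, h⟩ := Submodule.mem_sup.1 (hsup₁ ((hfib₁ _).2 (ρ'.P_self X.iR m)))
    obtain ⟨z₁, hz₁, rfl⟩ := hR₁ z hz
    exact ⟨z₁, hz₁, w, hw, h⟩
  set G := F.twist Φ Ψ
    (fun m => by
      obtain ⟨z, hz, w, hw, h⟩ := hdec m
      rw [← h, map_add, hΦR z hz, hΦL w hw, ← hfib₁]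
      exact add_mem (hR₁le (hR₁' z hz)) (hL₁le hw))
    (fun m => by
      obtain ⟨z, hz, w, hw, h⟩ := hdec₁ m
      rw [← h, map_add, hΨR z hz, hΨL w hw, ← hfib]
      exact add_mem (hRle hz) (hLle (hL' w hw)))
    (fun m => by
      obtain ⟨z, hz, w, hw, h⟩ := hdec m
      rw [← h, map_add, hΦR z hz, hΦL w hw, map_add, hΨR z hz, hΨL w hw])
    (fun m => by
      obtain ⟨z, hz, w, hw, h⟩ := hdec₁ m
      rw [← h, map_add, hΨR z hz, hΨL w hw, map_add, hΦR z hz, hΦL w hw])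
  have hGR : ∀ m, G.I X.iR m = Φ (G.I X.iL m) := by
    intro m
    simp only [G, twist, if_neg X.iL_ne_iR, if_true, LinearMap.comp_apply]
  clear_value G
  set ρ := G.contract FN hP
  have hFI : ∀ {u}, X.π u = X.i → ∀ n, FN.I u n = 0 := fun {u} hu n => by
    rw [← FN.I_P, hu, hi, LinearMap.zero_apply, map_zero]
  have hFQ : ∀ {u}, X.π u = X.i → ∀ n, FN.Q u n = 0 := fun {u} hu n => by
    rw [← FN.P_Q, hu, hi, LinearMap.zero_apply]
  have hPT : ∀ j m, PN j (ρ.T m) = FN.Q (X.κL j) (ρ'.T (G.I (X.κL j) m)) := by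
    intro j m
    change PN j ((∑ j, FN.Q (X.κL j) ∘ₗ ρ'.T ∘ₗ G.I (X.κL j)) m) = _
    rw [LinearMap.sum_apply, map_sum, Finset.sum_eq_single j]
    · have := FN.P_Q (X.κL j) (ρ'.T (G.I (X.κL j) m))
      rwa [X.π_κL] at this
    · intro k _ hk
      rw [LinearMap.comp_apply, ← FN.P_Q, X.π_κL, hPN.ne _ _ _ hk.symm]
    · exact fun h => absurd (Finset.mem_univ j) h
  have hTP₁ : ∀ j m, ρ.T (P j m) = FN.Q (X.κL j) (ρ'.T (G.I (X.κL j) m)) := by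
    intro j m
    change (∑ j, FN.Q (X.κL j) ∘ₗ ρ'.T ∘ₗ G.I (X.κL j)) (P j m) = _
    rw [LinearMap.sum_apply, Finset.sum_eq_single j]
    · have := G.I_P (X.κL j) m
      rw [X.π_κL] at this
      simp only [LinearMap.comp_apply, this]
    · intro k _ hk
      simp only [LinearMap.comp_apply]
      rw [G.I_P_ne hP (by rwa [X.π_κL]), map_zero, map_zero]
    · exact fun h => absurd (Finset.mem_univ j) h
  let C : Cover X FN.I FN.Q ρ ρ' := {
    I := G.I
    Q := G.Q
    P_I := G.P_I
    I_P := G.I_P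
    P_Q := G.P_Q
    Q_P := G.Q_P
    Q_I := G.Q_I
    I_Q := G.I_Q
    x_I := fun e m => by
      change _ = G.I _ (G.Q _ (ρ'.x _ (G.I _ m)))
      rw [G.I_Q, ρ'.P_x]
    y_I := fun e m => by
      change _ = G.I _ (G.Q _ (ρ'.y _ (G.I _ m)))
      rw [G.I_Q, ρ'.P_y]
    T_I := fun u m => by
      rw [← FN.I_P, hPT, ← G.P_I, ← hTP]
      by_cases hu : X.π u = X.i
      · rw [← FN.I_Q, hFI hu, hFI hu]
      · rw [X.κL_eq hu, FN.I_Q, hTP]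
    T_Q := fun u m => by
      rw [← G.P_Q]
      refine (hTP₁ _ _).trans ?_
      by_cases hu : X.π u = X.i
      · rw [hu, X.κL_i, hFQ X.π_iL, hFQ hu]
      · rw [X.κL_eq hu, G.I_Q, ← hTP, FN.Q_P] }
  refine ⟨ρ, rfl, fun j m => by rw [hPT]; exact (hTP₁ j m).symm, ⟨{ C with
    starL := fun z hz => ?_
    starR := fun z hz => ?_ }⟩⟩
  · have h1 : C.I X.iL z ∈ R := by
      change _ ∈ (ρ'.fib X.q' 0).map (A ^ X.r)
      rw [C.map_up'_pow]; exact ⟨_, hz, rfl⟩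
    change ρ'.x none (C.I X.iL z) = G.I X.iR z
    rw [hGR, ← C.up'_iL]
    exact (hΦR _ h1).symm
  · have h1 : C.I X.iR z ∈ L₁ := by
      change _ ∈ (ρ'.fib X.q' (2 * X.r + 1)).map (B ^ X.r)
      rw [C.map_down'_pow]; exact ⟨_, hz, rfl⟩
    obtain ⟨z₁, hz₁, w, hw, h⟩ := hdec (C.I X.iL z)
    rw [C.P_I] at h
    have h2 : C.I X.iR z = A z₁ + w := by
      change G.I X.iR z = _
      rw [hGR]
      change Φ (C.I X.iL z) = _
      rw [← h, map_add, hΦR z₁ hz₁, hΦL w hw]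
    change ρ'.y none (C.I X.iR z) = C.I X.iL z
    rw [← C.down'_iR]
    change B _ = _
    rw [← hΨL _ h1, h2, map_add, hΨR z₁ hz₁, hΨL w hw, h]

end Contract

end Frame

/-! ### The correspondence -/

/-- The representations to be classified: stable, nilpotent, satisfying the moment map condition
and generated by the edge maps at the vertices in `S`. -/
structure TotalRep.Good {V E M N : Type} [Fintype V] [Fintype E] [AddCommGroup M] [Module ℂ M]
    [AddCommGroup N] [Module ℂ N] {src tgt : E → V} (ρ : TotalRep src tgt M N)
    (PN : V → Module.End ℂ N) (S : Set V) : Prop where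
  socle : ρ.Socle
  nil : ρ.Nil
  moment : ρ.Moment
  top : ∀ j ∈ S, ρ.Top j
  graded : ∀ j m, PN j (ρ.T m) = ρ.T (ρ.P j m)

theorem TotalRep.out_iSup {V E M N ι : Type} [Fintype V] [AddCommGroup M] [Module ℂ M]
    [AddCommGroup N] [Module ℂ N] {src tgt : E → V} (ρ : TotalRep src tgt M N)
    (U : ι → Submodule ℂ M) : ρ.out (⨆ i, U i) = ⨆ i, ρ.out (U i) := by
  simp only [TotalRep.out, Submodule.map_iSup, ← iSup_sup_eq]
  exact iSup_comm

theorem TotalRep.nil_of_fixed {V E M N : Type} [Fintype V] [AddCommGroup M] [Module ℂ M]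
    [AddCommGroup N] [Module ℂ N] {src tgt : E → V} (ρ : TotalRep src tgt M N)
    (h : ∀ U, ρ.out U = U → U = ⊥) : ρ.Nil := by
  intro U hU
  have hW : (⨆ n, ρ.out^[n] U) = ⊥ := by
    apply h
    rw [ρ.out_iSup]
    refine le_antisymm (iSup_le fun n => ?_) (iSup_le fun n => ?_)
    · rw [← Function.iterate_succ_apply' ρ.out]
      exact le_iSup (fun n => ρ.out^[n] U) (n + 1)
    · refine le_iSup_of_le n ?_
      rw [← Function.iterate_succ_apply' ρ.out, Function.iterate_succ_apply]
      exact Monotone.iterate (fun _ _ => TotalRep.out_mono) n hU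
  exact le_bot_iff.1 (hW ▸ le_iSup (fun n => ρ.out^[n] U) 0)

theorem TotalRep.eq_bot_of_out_le {V E M N : Type} [Fintype V] [AddCommGroup M] [Module ℂ M]
    [AddCommGroup N] [Module ℂ N] {src tgt : E → V} [FiniteDimensional ℂ M]
    {ρ : TotalRep src tgt M N} (hS : ρ.Socle) (hN : ρ.Nil) (W : Submodule ℂ M)
    (hW : ρ.out W ≤ W) (hT : ∀ j, ∀ m ∈ W, ρ.T (ρ.P j m) = 0) : W = ⊥ := by
  induction W using WellFoundedLT.induction with
  | ind W ih =>
    by_cases h : ρ.out W = W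
    · exact hN W h.ge
    · have h1 := ih _ (lt_of_le_of_ne hW h) (TotalRep.out_mono hW) fun j m hm => hT j m (hW hm)
      rw [eq_bot_iff]
      intro m hm
      rw [Submodule.mem_bot, ← ρ.P_sum m]
      refine Finset.sum_eq_zero fun j _ => hS j _ (ρ.P_self j m) (fun e => ⟨?_, ?_⟩) (hT j m hm)
      · by_cases he : src e = j
        · rw [← he, ρ.x_P]
          exact (Submodule.mem_bot ℂ).1 (h1 ▸ TotalRep.x_mem_out e hm)
        · exact TotalRep.x_eq_zero (ρ.P_self j m) he
      · by_cases he : tgt e = j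
        · rw [← he, ρ.y_P]
          exact (Submodule.mem_bot ℂ).1 (h1 ▸ TotalRep.y_mem_out e hm)
        · exact TotalRep.y_eq_zero (ρ.P_self j m) he

theorem TotalRep.nil_iff {V E M N : Type} [Fintype V] [AddCommGroup M] [Module ℂ M]
    [AddCommGroup N] [Module ℂ N] {src tgt : E → V} [FiniteDimensional ℂ M]
    {ρ : TotalRep src tgt M N} : ρ.Nil ↔ ∃ n, ρ.out^[n] ⊤ = ⊥ := by
  constructor
  · intro hN
    have key : ∀ W, ρ.out W ≤ W → ∃ n, ρ.out^[n] W = ⊥ := by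
      intro W
      induction W using WellFoundedLT.induction with
      | ind W ih =>
        intro hW
        by_cases h : ρ.out W = W
        · exact ⟨0, hN W h.ge⟩
        · obtain ⟨n, hn⟩ := ih _ (lt_of_le_of_ne hW h) (TotalRep.out_mono hW)
          exact ⟨n + 1, hn⟩
    exact key ⊤ le_top
  · rintro ⟨n, hn⟩
    refine ρ.nil_of_fixed fun U hU => ?_
    rw [← le_bot_iff, ← hn, ← Function.iterate_fixed hU n]
    exact Monotone.iterate (fun _ _ => TotalRep.out_mono) n le_top

namespace Expansion

variable {V V' E : Type} (X : Expansion V V' E)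

def onPath : Set V := {j | ∃ k ≤ 2 * X.r, X.q k = j}

theorem q_mem_onPath {k : ℕ} (hk : k ≤ 2 * X.r) : X.q k ∈ X.onPath := ⟨k, hk, rfl⟩

theorem i_mem_onPath : X.i ∈ X.onPath := ⟨X.r, by omega, X.q_r⟩

theorem π_q'_mem_onPath {k : ℕ} (hk : k ≤ 2 * X.r + 1) : X.π (X.q' k) ∈ X.onPath := by
  rw [q']
  split_ifs with h
  · rw [X.π_κL]; exact X.q_mem_onPath (by omega)
  · rw [X.π_κR]; exact X.q_mem_onPath (by omega)

end Expansion

namespace Frame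

open TotalRep Expansion

variable {V V' E M N M' N' : Type} [Fintype V] [Fintype V'] [Fintype E] [AddCommGroup M]
  [Module ℂ M] [AddCommGroup N] [Module ℂ N] [AddCommGroup M'] [Module ℂ M'] [AddCommGroup N']
  [Module ℂ N'] [FiniteDimensional ℂ M] [FiniteDimensional ℂ M'] {X : Expansion V V' E}
  {P : V → Module.End ℂ M} {P' : V' → Module.End ℂ M'} {PN : V → Module.End ℂ N}
  {PN' : V' → Module.End ℂ N'} {s : ℕ}

omit [Fintype V] [Fintype V'] [Fintype E] [FiniteDimensional ℂ M'] in
theorem finrank_range_le (F : Frame X.π P P') (u : V') :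
    Module.finrank ℂ (LinearMap.range (P' u)) ≤ Module.finrank ℂ (LinearMap.range (P (X.π u))) := by
  refine le_trans (Submodule.finrank_mono ?_)
    (Submodule.finrank_map_le (F.I u) (LinearMap.range (P (X.π u))))
  rintro _ ⟨m, rfl⟩
  exact ⟨F.Q u m, ⟨F.Q u m, F.P_Q u m⟩, F.I_Q u m⟩

omit [Fintype V'] in
theorem tightLadder {ρ : TotalRep X.src X.tgt M N} (hρ : ρ.Good PN X.onPath)
    (hPN : ∀ j ∈ X.onPath, PN j = 0)
    (hdim : ∀ j ∈ X.onPath, Module.finrank ℂ (LinearMap.range (ρ.P j)) ≤ s) :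
    TightLadder (ρ.up X.pe (2 * X.r)) (ρ.down X.pe (2 * X.r)) (ρ.fib X.q) (2 * X.r) s := by
  refine TotalRep.tightLadder X.path hρ.moment hρ.socle hρ.nil (fun k _ hk m hm => ?_)
    (fun k _ hk => hρ.top _ (X.q_mem_onPath hk.le)) fun k hk => hdim _ (X.q_mem_onPath hk)
  rw [← mem_fib.1 hm, ← hρ.graded, hPN _ (X.q_mem_onPath hk.le), LinearMap.zero_apply]

omit [Fintype V] in
theorem tightLadder' (F : Frame X.π P P') (FN : Frame X.π PN PN')
    {ρ' : TotalRep X.src' X.tgt' M' N'} (hP' : ρ'.P = P') (hρ' : ρ'.Good PN' (X.π ⁻¹' X.onPath))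
    (hPN : ∀ j ∈ X.onPath, PN j = 0)
    (hdim : ∀ j ∈ X.onPath, Module.finrank ℂ (LinearMap.range (P j)) ≤ s) :
    TightLadder (ρ'.up X.pe' (2 * X.r + 1)) (ρ'.down X.pe' (2 * X.r + 1))
      (ρ'.fib X.q') (2 * X.r + 1) s := by
  refine TotalRep.tightLadder X.path' hρ'.moment hρ'.socle hρ'.nil (fun k _ hk m hm => ?_)
    (fun k _ hk => hρ'.top _ (X.π_q'_mem_onPath hk.le)) fun k hk => ?_
  · rw [← mem_fib.1 hm, ← hρ'.graded, ← FN.I_Q, ← FN.P_Q, hPN _ (X.π_q'_mem_onPath hk.le),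
      LinearMap.zero_apply, map_zero]
  · rw [fib, hP']
    exact (F.finrank_range_le _).trans (hdim _ (X.π_q'_mem_onPath hk))

omit [FiniteDimensional ℂ M'] in
theorem exists_good_double (F : Frame X.π P P') (FN : Frame X.π PN PN') (hP' : IsGrading P')
    (hPN' : IsGrading PN') (hPN : ∀ j ∈ X.onPath, PN j = 0)
    (hdim : ∀ j ∈ X.onPath, Module.finrank ℂ (LinearMap.range (P j)) ≤ s) (hs : s ≤ X.r)
    {ρ : TotalRep X.src X.tgt M N} (hP : ρ.P = P) (hρ : ρ.Good PN X.onPath) :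
    ∃ ρ' : TotalRep X.src' X.tgt' M' N', ρ'.P = P' ∧ ρ'.Good PN' (X.π ⁻¹' X.onPath) ∧
      Nonempty (Link X FN.I FN.Q ρ ρ') := by
  subst hP
  have hr := X.r_pos
  have hT := Frame.tightLadder hρ hPN hdim
  obtain ⟨ρ', hρP, hg, L, hmid⟩ := F.exists_double FN hP' hPN' hρ.graded hs hT
  have hM' := L.moment_fwd hρ.moment hmid
  have hsup := hT.le_sup (k := X.r) hr (by omega)
  rw [show 2 * X.r - X.r = X.r by omega] at hsup
  refine ⟨ρ', hρP, ⟨L.socle_fwd hs hρ.socle hmid hT, nil_of_fixed _ fun U => L.nil_fwd hρ.moment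
    hM' hρ.nil (fun z hz => hT.nil X.r (by omega) z hz), hM', fun u hu => ?_, hg⟩, ⟨L⟩⟩
  by_cases h : X.π u = X.i
  · rcases X.eq_iL_or h with rfl | rfl
    · exact L.top_iL hsup
    · exact L.top_iR hsup
  · exact (L.top_iff h).2 (hρ.top _ hu)

theorem exists_good_contract (F : Frame X.π P P') (FN : Frame X.π PN PN') (hP : IsGrading P)
    (hPN : IsGrading PN) (hPN0 : ∀ j ∈ X.onPath, PN j = 0)
    (hdim : ∀ j ∈ X.onPath, Module.finrank ℂ (LinearMap.range (P j)) ≤ s) (hs : s ≤ X.r)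
    {ρ' : TotalRep X.src' X.tgt' M' N'} (hP' : ρ'.P = P')
    (hρ' : ρ'.Good PN' (X.π ⁻¹' X.onPath)) :
    ∃ ρ : TotalRep X.src X.tgt M N, ρ.P = P ∧ ρ.Good PN X.onPath ∧
      Nonempty (Link X FN.I FN.Q ρ ρ') := by
  have hT := F.tightLadder' FN hP' hρ' hPN0 hdim
  subst hP'
  have hr := X.r_pos
  obtain ⟨ρ, hρP, hg, ⟨L⟩⟩ := F.exists_contract FN hP hPN (hPN0 _ X.i_mem_onPath) hρ'.graded hs hT
  have hsup := L.fib_le_sup hT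
  have hM := L.moment_bwd hρ'.moment hsup
  refine ⟨ρ, hρP, ⟨L.socle_bwd hs hρ'.socle hT, nil_of_fixed _ fun U => L.nil_bwd hM
    hρ'.nil (fun z hz => hT.nil (X.r + 1) (by omega) z hz), hM, fun j hj => ?_, hg⟩, ⟨L⟩⟩
  by_cases h : j = X.i
  · rw [h]; exact Link.top_i hsup
  · have h1 := L.top_iff (u := X.κL j) (by rwa [X.π_κL])
    rw [X.π_κL] at h1
    exact h1.1 (hρ'.top _ (by rwa [Set.mem_preimage, X.π_κL]))

omit [FiniteDimensional ℂ M'] in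
theorem iso_iff_of_good (FN : Frame X.π PN PN') (hPN : ∀ j ∈ X.onPath, PN j = 0)
    (hdim : ∀ j ∈ X.onPath, Module.finrank ℂ (LinearMap.range (P j)) ≤ s)
    {ρ σ : TotalRep X.src X.tgt M N} {ρ' σ' : TotalRep X.src' X.tgt' M' N'}
    (hρP : ρ.P = P) (hσP : σ.P = P) (hρ : ρ.Good PN X.onPath) (hσ : σ.Good PN X.onPath)
    (hρ' : ρ'.Moment) (hσ' : σ'.Moment)
    (L : Link X FN.I FN.Q ρ ρ') (K : Link X FN.I FN.Q σ σ') : ρ.Iso σ ↔ ρ'.Iso σ' := by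
  have hr := X.r_pos
  have h1 := (Frame.tightLadder hρ hPN (by rwa [hρP])).le_sup (k := X.r) hr (by omega)
  have h2 := (Frame.tightLadder hσ hPN (by rwa [hσP])).le_sup (k := X.r) hr (by omega)
  rw [show 2 * X.r - X.r = X.r by omega] at h1 h2
  exact L.iso_iff K (L.mid hρ') (K.mid hσ') h1 h2

end Frame

/-! ### Framed representations as representations on a total space -/

section Graded

variable {V : Type} [DecidableEq V] (v : V → ℕ)

/-- The projection of the total space onto the component at `j`. -/
def compP (j : V) : Module.End ℂ (∀ j, Fin (v j) → ℂ) :=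
  LinearMap.single ℂ (fun j => Fin (v j) → ℂ) j ∘ₗ LinearMap.proj j

theorem compP_apply (j : V) (m : ∀ j, Fin (v j) → ℂ) : compP v j m = Pi.single j (m j) := rfl

theorem single_injective (j : V) :
    Function.Injective (LinearMap.single ℂ (fun j => Fin (v j) → ℂ) j) :=
  fun _ _ h => Pi.single_injective (M := fun j => Fin (v j) → ℂ) j h

theorem isGrading_compP [Fintype V] : IsGrading (compP v) where
  self a m := by simp [compP_apply]
  ne a b m h := by simp [compP_apply, Pi.single_eq_of_ne h]
  sum m := by simp only [compP_apply]; exact LinearMap.sum_single_apply _ m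

theorem finrank_range_compP [Fintype V] (j : V) :
    Module.finrank ℂ (LinearMap.range (compP v j)) = v j := by
  rw [compP, LinearMap.range_comp, LinearMap.range_eq_top.2 (LinearMap.proj_surjective j),
    Submodule.map_top, LinearMap.finrank_range_of_inj (single_injective v j)]
  simp

theorem compP_eq_zero {j : V} (h : v j = 0) : compP v j = 0 := by
  refine LinearMap.ext fun m => ?_
  have : m j = 0 := funext fun a => absurd (h ▸ a.2 : a.1 < 0) (Nat.not_lt_zero _)
  rw [compP_apply, this, Pi.single_zero, LinearMap.zero_apply]

/-- The frame given by pulling back along a map of vertex sets. -/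
def compFrame {V' : Type} [DecidableEq V'] (π : V' → V) :
    Frame π (compP v) (compP fun u => v (π u)) where
  I u := LinearMap.single ℂ (fun u => Fin (v (π u)) → ℂ) u ∘ₗ LinearMap.proj (π u)
  Q u := LinearMap.single ℂ (fun j => Fin (v j) → ℂ) (π u) ∘ₗ LinearMap.proj u
  P_I u m := by simp [compP_apply]
  I_P u m := by simp [compP_apply]
  P_Q u m := by simp [compP_apply]
  Q_P u m := by simp [compP_apply]
  Q_I u m := by simp [compP_apply]
  I_Q u m := by simp [compP_apply]

end Graded

/-- A choice of direction of each edge of `G`, with the edges indexed by `E`. -/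
structure Orient (G : Multigraph) (E : Type) where
  f : E ≃ G.E
  b : E → Bool

namespace Orient

variable {G : Multigraph} {E : Type} (O : Orient G E)

def dir (e : E) : G.E ⊕ G.E := cond (O.b e) (Sum.inl (O.f e)) (Sum.inr (O.f e))

def src (e : E) : G.V := G.dsrc (O.dir e)

def tgt (e : E) : G.V := G.dtgt (O.dir e)

end Orient

namespace FramedRep

variable {G : Multigraph} {v w : G.V → ℕ} {E : Type}

theorem edgeEnd_apply (ρ : FramedRep G v w) (d : G.E ⊕ G.E) (m : ∀ j, Fin (v j) → ℂ) :
    ρ.edgeEnd d m = Pi.single (G.dtgt d) (ρ.dmap d (m (G.dsrc d))) := by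
  funext j
  rw [edgeEnd, LinearMap.pi_apply]
  split_ifs with h
  · subst h
    rw [Pi.single_eq_same]; rfl
  · rw [Pi.single_eq_of_ne (Ne.symm h)]; rfl

theorem edgeEnd_inl (ρ : FramedRep G v w) (e : G.E) (m : ∀ j, Fin (v j) → ℂ) :
    ρ.edgeEnd (Sum.inl e) m = Pi.single (G.tgt e) (ρ.x e (m (G.src e))) := ρ.edgeEnd_apply _ m

theorem edgeEnd_inr (ρ : FramedRep G v w) (e : G.E) (m : ∀ j, Fin (v j) → ℂ) :
    ρ.edgeEnd (Sum.inr e) m = Pi.single (G.src e) (ρ.xbar e (m (G.tgt e))) := ρ.edgeEnd_apply _ m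

theorem P_edgeEnd (ρ : FramedRep G v w) (d : G.E ⊕ G.E) (m : ∀ j, Fin (v j) → ℂ) :
    compP v (G.dtgt d) (ρ.edgeEnd d m) = ρ.edgeEnd d m := by
  rw [compP_apply, edgeEnd_apply, Pi.single_eq_same]

theorem edgeEnd_P (ρ : FramedRep G v w) (d : G.E ⊕ G.E) (m : ∀ j, Fin (v j) → ℂ) :
    ρ.edgeEnd d (compP v (G.dsrc d) m) = ρ.edgeEnd d m := by
  rw [compP_apply, edgeEnd_apply, edgeEnd_apply, Pi.single_eq_same]

theorem dmap_apply (ρ : FramedRep G v w) (d : G.E ⊕ G.E) (z : Fin (v (G.dsrc d)) → ℂ) :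
    ρ.dmap d z = ρ.edgeEnd d (Pi.single (G.dsrc d) z) (G.dtgt d) := by
  rw [edgeEnd_apply, Pi.single_eq_same, Pi.single_eq_same]

theorem dtgt_swap (d : G.E ⊕ G.E) : G.dtgt d.swap = G.dsrc d := by cases d <;> rfl

theorem dsrc_swap (d : G.E ⊕ G.E) : G.dsrc d.swap = G.dtgt d := by cases d <;> rfl

/-- The representation on the total space, with the signs of the edge maps adapted to `O`. -/
def total (O : Orient G E) (ρ : FramedRep G v w) :
    TotalRep O.src O.tgt (∀ j, Fin (v j) → ℂ) (∀ j, Fin (w j) → ℂ) where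
  P := compP v
  x e := ρ.edgeEnd (O.dir e)
  y e := cond (O.b e) (ρ.edgeEnd (O.dir e).swap) (-ρ.edgeEnd (O.dir e).swap)
  T := LinearMap.pi fun j => ρ.t j ∘ₗ LinearMap.proj j
  P_self := (isGrading_compP v).self
  P_ne := (isGrading_compP v).ne
  P_sum := (isGrading_compP v).sum
  P_x e m := ρ.P_edgeEnd _ m
  x_P e m := ρ.edgeEnd_P _ m
  P_y e m := by
    have := ρ.P_edgeEnd (O.dir e).swap m
    rw [dtgt_swap] at this
    change compP v (G.dsrc (O.dir e)) _ = _
    cases O.b e <;> simp [this]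
  y_P e m := by
    have := ρ.edgeEnd_P (O.dir e).swap m
    rw [dsrc_swap] at this
    change (cond (O.b e) _ _ : Module.End ℂ _) (compP v (G.dtgt (O.dir e)) _) = _
    cases O.b e <;> simp [this]

variable (O : Orient G E) (ρ σ : FramedRep G v w)

theorem _root_.Submodule.single_mem_pi {V : Type} [DecidableEq V] {M : V → Type}
    [∀ j, AddCommGroup (M j)] [∀ j, Module ℂ (M j)] (U : ∀ j, Submodule ℂ (M j)) {j : V} {z : M j}
    (hz : z ∈ U j) : Pi.single j z ∈ Submodule.pi Set.univ U := by
  intro k _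
  by_cases h : k = j
  · subst h; rwa [Pi.single_eq_same]
  · rw [Pi.single_eq_of_ne h]; exact zero_mem _

theorem total_x (e : E) : (ρ.total O).x e = ρ.edgeEnd (O.dir e) := rfl

theorem total_y (e : E) : (ρ.total O).y e =
    cond (O.b e) (ρ.edgeEnd (O.dir e).swap) (-ρ.edgeEnd (O.dir e).swap) := rfl

theorem total_T_apply (m : ∀ j, Fin (v j) → ℂ) (j : G.V) : (ρ.total O).T m j = ρ.t j (m j) := rfl

theorem total_graded (j : G.V) (m : ∀ j, Fin (v j) → ℂ) :
    compP w j ((ρ.total O).T m) = (ρ.total O).T ((ρ.total O).P j m) := by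
  funext k
  change (Pi.single j (ρ.t j (m j)) : ∀ j, Fin (w j) → ℂ) k =
    ρ.t k ((Pi.single j (m j) : ∀ j, Fin (v j) → ℂ) k)
  by_cases h : k = j
  · subst h; rw [Pi.single_eq_same, Pi.single_eq_same]
  · rw [Pi.single_eq_of_ne h, Pi.single_eq_of_ne h, map_zero]

theorem forall_edge {p : G.E ⊕ G.E → Prop} :
    (∀ d, p d) ↔ ∀ e, p (O.dir e) ∧ p (O.dir e).swap := by
  refine ⟨fun h e => ⟨h _, h _⟩, fun h d => ?_⟩
  have key : ∀ e : G.E, p (Sum.inl e) ∧ p (Sum.inr e) := by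
    intro e
    have := h (O.f.symm e)
    rw [Orient.dir, Equiv.apply_symm_apply] at this
    cases hb : O.b (O.f.symm e) <;> rw [hb] at this
    · exact this.symm
    · exact this
  exact d.casesOn (fun e => (key e).1) fun e => (key e).2

theorem total_y_mem_iff {e : E} {m : ∀ j, Fin (v j) → ℂ} {W : Submodule ℂ (∀ j, Fin (v j) → ℂ)} :
    (ρ.total O).y e m ∈ W ↔ ρ.edgeEnd (O.dir e).swap m ∈ W := by
  change (cond (O.b e) _ _ : Module.End ℂ _) m ∈ W ↔ _
  cases O.b e <;> simp

theorem total_out_le_iff {U W : Submodule ℂ (∀ j, Fin (v j) → ℂ)} :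
    (ρ.total O).out U ≤ W ↔ ∀ d, ∀ m ∈ U, ρ.edgeEnd d m ∈ W := by
  rw [forall_edge O]
  refine ⟨fun h e => ⟨fun m hm => h (TotalRep.x_mem_out e hm), fun m hm => ?_⟩,
    fun h => TotalRep.out_le fun e m hm => ⟨(h e).1 m hm, ?_⟩⟩
  · rw [← total_y_mem_iff]; exact h (TotalRep.y_mem_out e hm)
  · rw [total_y_mem_iff]; exact (h e).2 m hm

theorem total_out (U : Submodule ℂ (∀ j, Fin (v j) → ℂ)) :
    (ρ.total O).out U = ⨆ d, U.map (ρ.edgeEnd d) := by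
  refine eq_of_forall_ge_iff fun W => ?_
  simp only [total_out_le_iff, iSup_le_iff, Submodule.map_le_iff_le_comap]
  rfl

theorem iterate_out_eq_bot_iff (n : ℕ) (U : Submodule ℂ (∀ j, Fin (v j) → ℂ)) :
    (ρ.total O).out^[n] U = ⊥ ↔
      ∀ L : List (G.E ⊕ G.E), L.length = n → ∀ m ∈ U, (L.map ρ.edgeEnd).prod m = 0 := by
  induction n generalizing U with
  | zero => simp [Submodule.eq_bot_iff]
  | succ n ih =>
    rw [Function.iterate_succ_apply, ih]
    constructor
    · intro h L hL m hm
      obtain rfl | ⟨L, d, rfl⟩ := List.eq_nil_or_concat L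
      · simp at hL
      · have := h L (by simpa using hL) _ ((total_out_le_iff O ρ).1 le_rfl d m hm)
        simpa using this
    · intro h L hL m hm
      have h1 : (ρ.total O).out U ≤ LinearMap.ker (L.map ρ.edgeEnd).prod := by
        rw [total_out_le_iff]
        intro d m hm
        have := h (L ++ [d]) (by simp [hL]) m hm
        simpa using this
      exact h1 hm

theorem isNilpotentRep_iff : ρ.IsNilpotentRep ↔ (ρ.total O).Nil := by
  rw [TotalRep.nil_iff]
  refine exists_congr fun n => ?_
  rw [iterate_out_eq_bot_iff]
  refine forall₂_congr fun L _ => ?_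
  simp [LinearMap.ext_iff]

theorem stable_iff (hN : (ρ.total O).Nil) : ρ.Stable ↔ (ρ.total O).Socle := by
  constructor
  · intro h j m _ hxy hT
    have hd : ∀ d, ρ.edgeEnd d m = 0 := by
      rw [forall_edge O]
      refine fun e => ⟨(hxy e).1, ?_⟩
      rw [← Submodule.mem_bot ℂ, ← total_y_mem_iff, Submodule.mem_bot]
      exact (hxy e).2
    have := h (fun j => ℂ ∙ m j) (fun d => ?_) fun j => ?_
    · funext j
      exact Submodule.span_singleton_eq_bot.1 (this j)
    · rw [Submodule.map_span_le]
      rintro _ rfl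
      have := congrFun (hd d) (G.dtgt d)
      rw [edgeEnd_apply, Pi.single_eq_same] at this
      rw [this]; exact zero_mem _
    · rw [Submodule.span_singleton_le_iff_mem, LinearMap.mem_ker]
      exact congrFun hT j
  · intro hS U hU ht
    have := TotalRep.eq_bot_of_out_le hS hN (Submodule.pi Set.univ U) ?_ ?_
    · intro j
      rw [Submodule.eq_bot_iff]
      intro z hz
      have h1 : Pi.single j z ∈ Submodule.pi Set.univ U := Submodule.single_mem_pi U hz
      rw [this, Submodule.mem_bot] at h1
      simpa using congrFun h1 j
    · rw [total_out_le_iff]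
      intro d m hm
      rw [edgeEnd_apply]
      exact Submodule.single_mem_pi U (hU d ⟨_, hm _ trivial, rfl⟩)
    · intro j m hm
      rw [← total_graded]
      change (Pi.single j (ρ.t j (m j)) : ∀ j, Fin (w j) → ℂ) = _
      rw [LinearMap.mem_ker.1 (ht j (hm j trivial)), Pi.single_zero]

theorem momentMap_iff : ρ.MomentMap ↔
    ∀ m, ∑ e, ρ.edgeEnd (Sum.inl e) (ρ.edgeEnd (Sum.inr e) m) =
      ∑ e, ρ.edgeEnd (Sum.inr e) (ρ.edgeEnd (Sum.inl e) m) := by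
  have h1 : ∀ m j, (∑ e, ρ.edgeEnd (Sum.inl e) (ρ.edgeEnd (Sum.inr e) m)) j =
      (∑ e : G.E, if h : G.tgt e = j then
        (castL h).comp ((ρ.x e).comp ((ρ.xbar e).comp (castL h.symm))) else 0) (m j) := by
    intro m j
    rw [Finset.sum_apply, LinearMap.sum_apply]
    refine Finset.sum_congr rfl fun e _ => ?_
    rw [edgeEnd_inl, edgeEnd_inr, Pi.single_eq_same]
    split_ifs with h
    · subst h
      exact Pi.single_eq_same _ _
    · exact Pi.single_eq_of_ne (Ne.symm h) _
  have h2 : ∀ m j, (∑ e, ρ.edgeEnd (Sum.inr e) (ρ.edgeEnd (Sum.inl e) m)) j =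
      (∑ e : G.E, if h : G.src e = j then
        (castL h).comp ((ρ.xbar e).comp ((ρ.x e).comp (castL h.symm))) else 0) (m j) := by
    intro m j
    rw [Finset.sum_apply, LinearMap.sum_apply]
    refine Finset.sum_congr rfl fun e _ => ?_
    rw [edgeEnd_inl, edgeEnd_inr, Pi.single_eq_same]
    split_ifs with h
    · subst h
      exact Pi.single_eq_same _ _
    · exact Pi.single_eq_of_ne (Ne.symm h) _
  constructor
  · intro h m
    funext j
    rw [h1, h2, h j]
  · intro h j
    refine LinearMap.ext fun z => ?_
    have := congrFun (h (Pi.single j z)) j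
    rwa [h1, h2, Pi.single_eq_same] at this

theorem momentMap_iff_total [Fintype E] : ρ.MomentMap ↔ (ρ.total O).Moment := by
  have key : ∀ e, (ρ.total O).x e * (ρ.total O).y e - (ρ.total O).y e * (ρ.total O).x e =
      ρ.edgeEnd (Sum.inl (O.f e)) * ρ.edgeEnd (Sum.inr (O.f e)) -
        ρ.edgeEnd (Sum.inr (O.f e)) * ρ.edgeEnd (Sum.inl (O.f e)) := by
    intro e
    rw [total_x, total_y, Orient.dir]
    cases O.b e
    · refine LinearMap.ext fun m => ?_
      simp only [cond_false, Sum.swap_inr, LinearMap.sub_apply, Module.End.mul_apply,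
        LinearMap.neg_apply, map_neg]
      abel
    · simp only [cond_true, Sum.swap_inl]
  rw [momentMap_iff, TotalRep.Moment, Finset.sum_congr rfl fun e _ => key e,
    O.f.sum_comp fun e => ρ.edgeEnd (Sum.inl e) * ρ.edgeEnd (Sum.inr e) -
        ρ.edgeEnd (Sum.inr e) * ρ.edgeEnd (Sum.inl e), LinearMap.ext_iff]
  refine forall_congr' fun m => ?_
  rw [LinearMap.sum_apply, LinearMap.zero_apply, ← sub_eq_zero, ← Finset.sum_sub_distrib]
  simp only [LinearMap.sub_apply, Module.End.mul_apply]

theorem rangeSup_eq (j : G.V) :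
    ρ.rangeSup j = ((ρ.total O).out ⊤).map (LinearMap.proj j) := by
  rw [total_out, Submodule.map_iSup, rangeSup]
  refine iSup_congr fun d => ?_
  rw [Submodule.map_top, ← LinearMap.range_comp]
  apply le_antisymm
  · refine iSup_le ?_
    rintro rfl _ ⟨z, rfl⟩
    exact ⟨Pi.single _ z, (ρ.dmap_apply d z).symm⟩
  · rintro _ ⟨m, rfl⟩
    rw [LinearMap.comp_apply, edgeEnd_apply, LinearMap.proj_apply]
    by_cases h : G.dtgt d = j
    · subst h
      rw [Pi.single_eq_same, iSup_pos rfl]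
      exact ⟨_, rfl⟩
    · rw [Pi.single_eq_of_ne (Ne.symm h)]; exact zero_mem _

theorem epsVal_eq (j : G.V) :
    ρ.epsVal j = v j - Module.finrank ℂ (((ρ.total O).out ⊤).map ((ρ.total O).P j)) := by
  change _ = v j - Module.finrank ℂ (((ρ.total O).out ⊤).map
    (LinearMap.single ℂ (fun j => Fin (v j) → ℂ) j ∘ₗ LinearMap.proj j))
  rw [epsVal, rangeSup_eq O, Submodule.map_comp]
  rw [LinearEquiv.finrank_eq (Submodule.equivMapOfInjective _
    (single_injective v j)
    (Submodule.map (LinearMap.proj j) ((ρ.total O).out ⊤)))]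

theorem epsVal_eq_zero_iff (j : G.V) : ρ.epsVal j = 0 ↔ (ρ.total O).Top j := by
  have h1 : ((ρ.total O).out ⊤).map ((ρ.total O).P j) ≤ LinearMap.range ((ρ.total O).P j) :=
    LinearMap.map_le_range
  rw [epsVal_eq O, Nat.sub_eq_zero_iff_le, TotalRep.Top]
  nth_rewrite 1 [← finrank_range_compP v j]
  exact ⟨fun h => (Submodule.eq_of_le_of_finrank_le h1 h).ge, Submodule.finrank_mono⟩

theorem iso_iff_total : ρ.Iso σ ↔ (ρ.total O).Iso (σ.total O) := by
  have key : ∀ g : Module.End ℂ (∀ j, Fin (v j) → ℂ),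
      ((∀ d m, g (ρ.edgeEnd d m) = σ.edgeEnd d (g m)) ↔
      ∀ e m, g ((ρ.total O).x e m) = (σ.total O).x e (g m) ∧
        g ((ρ.total O).y e m) = (σ.total O).y e (g m)) := by
    intro g
    rw [forall_edge O]
    refine forall_congr' fun e => ?_
    rw [← forall_and]
    refine forall_congr' fun m => and_congr Iff.rfl ?_
    change _ ↔ g ((cond (O.b e) _ _ : Module.End ℂ _) m) = (cond (O.b e) _ _ : Module.End ℂ _) _
    cases O.b e <;> simp
  constructor
  · rintro ⟨g, hx, hy, ht⟩
    have hs : ∀ j z, LinearEquiv.piCongrRight g (Pi.single j z) = Pi.single j (g j z) :=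
      fun j z => funext fun k => (Pi.apply_single (fun j => g j) (fun j => map_zero _) j z k)
    have hd := (key (LinearEquiv.piCongrRight g).toLinearMap).1 fun d m => by
      rw [edgeEnd_apply, edgeEnd_apply]
      refine (hs _ _).trans ?_
      congr 1
      cases d with
      | inl e => exact LinearMap.congr_fun (hx e) _
      | inr e => exact LinearMap.congr_fun (hy e) _
    exact ⟨LinearEquiv.piCongrRight g, fun j m => hs j _, fun e m => (hd e m).1,
      fun e m => (hd e m).2, fun m => funext fun j => LinearMap.congr_fun (ht j) (m j)⟩
  · rintro ⟨g, hg⟩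
    have hd := (key g.toLinearMap).2 fun e m => ⟨hg.x e m, hg.y e m⟩
    have hs : ∀ (g : Module.End ℂ (∀ j, Fin (v j) → ℂ)),
        (∀ j m, g (compP v j m) = compP v j (g m)) → ∀ j z,
        Pi.single j (g (Pi.single j z) j) = g (Pi.single j z) := by
      intro g hg j z
      have := hg j (Pi.single j z)
      rw [compP_apply, compP_apply, Pi.single_eq_same] at this
      exact this.symm
    have hs₁ := hs _ hg.P
    have hs₂ := hs _ hg.symm.P
    let h : ∀ j, (Fin (v j) → ℂ) ≃ₗ[ℂ] (Fin (v j) → ℂ) := fun j => LinearEquiv.ofLinearMap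
      (LinearMap.proj j ∘ₗ g.toLinearMap ∘ₗ LinearMap.single ℂ (fun j => Fin (v j) → ℂ) j)
      (LinearMap.proj j ∘ₗ g.symm.toLinearMap ∘ₗ LinearMap.single ℂ (fun j => Fin (v j) → ℂ) j)
      (LinearMap.ext fun z => by
        change g (Pi.single j (g.symm (Pi.single j z) j)) j = z
        rw [show Pi.single j (g.symm (Pi.single j z) j) = g.symm (Pi.single j z) from hs₂ j z,
          g.apply_symm_apply, Pi.single_eq_same])
      (LinearMap.ext fun z => by
        change g.symm (Pi.single j (g (Pi.single j z) j)) j = z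
        rw [show Pi.single j (g (Pi.single j z) j) = g (Pi.single j z) from hs₁ j z,
          g.symm_apply_apply, Pi.single_eq_same])
    have hh : ∀ d z, h (G.dtgt d) (ρ.dmap d z) = σ.dmap d (h (G.dsrc d) z) := by
      intro d z
      have h1 := congrFun (hd d (Pi.single (G.dsrc d) z)) (G.dtgt d)
      rw [edgeEnd_apply, edgeEnd_apply, Pi.single_eq_same, Pi.single_eq_same] at h1
      exact h1
    refine ⟨h, fun e => LinearMap.ext fun z => hh (Sum.inl e) z,
      fun e => LinearMap.ext fun z => hh (Sum.inr e) z, fun j => LinearMap.ext fun z => ?_⟩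
    have h1 := congrFun (hg.T (Pi.single j z)) j
    rw [total_T_apply, total_T_apply, Pi.single_eq_same] at h1
    exact h1

theorem exists_total_eq {τ : TotalRep O.src O.tgt (∀ j, Fin (v j) → ℂ) (∀ j, Fin (w j) → ℂ)}
    (hP : τ.P = compP v) (hg : ∀ j m, compP w j (τ.T m) = τ.T (τ.P j m)) :
    ∃ ρ : FramedRep G v w, ρ.total O = τ := by
  obtain ⟨φ, hφ₁, hφ₂, hx, hy⟩ : ∃ φ : G.E ⊕ G.E → Module.End ℂ (∀ j, Fin (v j) → ℂ),
      (∀ d m, compP v (G.dtgt d) (φ d m) = φ d m) ∧ (∀ d m, φ d (compP v (G.dsrc d) m) = φ d m) ∧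
      (∀ e, φ (O.dir e) = τ.x e) ∧
      ∀ e, cond (O.b e) (φ (O.dir e).swap) (-φ (O.dir e).swap) = τ.y e := by
    obtain ⟨φ, hφ⟩ : ∃ φ : G.E ⊕ G.E → Module.End ℂ (∀ j, Fin (v j) → ℂ),
        ∀ e, φ (O.dir e) = τ.x e ∧ φ (O.dir e).swap = cond (O.b e) (τ.y e) (-τ.y e) := by
      refine ⟨Sum.elim (fun e => cond (O.b (O.f.symm e)) (τ.x (O.f.symm e)) (-τ.y (O.f.symm e)))
        fun e => cond (O.b (O.f.symm e)) (τ.y (O.f.symm e)) (τ.x (O.f.symm e)), fun e => ?_⟩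
      rw [Orient.dir]
      cases hb : O.b e <;> simp [hb]
    refine ⟨φ, (forall_edge O).2 fun e => ⟨fun m => ?_, fun m => ?_⟩,
      (forall_edge O).2 fun e => ⟨fun m => ?_, fun m => ?_⟩, fun e => (hφ e).1, fun e => ?_⟩
    · rw [(hφ e).1, ← hP]; exact τ.P_x e m
    · rw [dtgt_swap, (hφ e).2, ← hP]
      have := τ.P_y e m
      rw [Orient.src] at this
      cases O.b e <;> simp [this]
    · rw [(hφ e).1, ← hP]; exact τ.x_P e m
    · rw [dsrc_swap, (hφ e).2, ← hP]
      have := τ.y_P e m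
      rw [Orient.tgt] at this
      cases O.b e <;> simp [this]
    · rw [(hφ e).2]
      cases O.b e <;> simp
  let ρ : FramedRep G v w := {
    x := fun e => LinearMap.proj (G.tgt e) ∘ₗ φ (Sum.inl e) ∘ₗ
      LinearMap.single ℂ (fun j => Fin (v j) → ℂ) (G.src e)
    xbar := fun e => LinearMap.proj (G.src e) ∘ₗ φ (Sum.inr e) ∘ₗ
      LinearMap.single ℂ (fun j => Fin (v j) → ℂ) (G.tgt e)
    t := fun j => LinearMap.proj j ∘ₗ τ.T ∘ₗ LinearMap.single ℂ (fun j => Fin (v j) → ℂ) j }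
  have hρ : ∀ d, ρ.edgeEnd d = φ d := by
    intro d
    refine LinearMap.ext fun m => ?_
    rw [edgeEnd_apply, ← hφ₁, ← hφ₂, compP_apply]
    cases d <;> rfl
  have hT : (ρ.total O).T = τ.T := by
    refine LinearMap.ext fun m => funext fun j => ?_
    change τ.T (compP v j m) j = _
    rw [← hP, ← hg, compP_apply, Pi.single_eq_same]
  exact ⟨ρ, TotalRep.ext hP.symm (funext fun e => (hρ _).trans (hx e)) (funext fun e => by
    rw [← hy]
    change (cond (O.b e) _ _ : Module.End ℂ _) = _
    rw [hρ]) hT⟩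

end FramedRep

/-! ### Orientations adapted to a path -/

namespace Multigraph

variable {X : Multigraph}

theorem Joins.symm {e : X.E} {a b : X.V} (h : X.Joins e a b) : X.Joins e b a := Or.symm h

theorem Joins.src_or_tgt {e : X.E} {a b : X.V} (h : X.Joins e a b) : X.src e = a ∨ X.tgt e = a :=
  h.imp And.left And.right

theorem Joins.eq_or {e : X.E} {a b a' b' : X.V} (h : X.Joins e a b) (h' : X.Joins e a' b') :
    a = a' ∧ b = b' ∨ a = b' ∧ b = a' := by
  rcases h with ⟨rfl, rfl⟩ | ⟨rfl, rfl⟩ <;> rcases h' with ⟨rfl, rfl⟩ | ⟨rfl, rfl⟩ <;> simp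

end Multigraph

namespace Orient

variable {X : Multigraph}

theorem joins {E : Type} (O : Orient X E) (e : E) : X.Joins (O.f e) (O.src e) (O.tgt e) := by
  rw [src, tgt, dir]
  cases O.b e
  · exact Or.inr ⟨rfl, rfl⟩
  · exact Or.inl ⟨rfl, rfl⟩

theorem exists_of_joins {E : Type} (f : E ≃ X.E) {a b : E → X.V}
    (h : ∀ e, X.Joins (f e) (a e) (b e)) :
    ∃ O : Orient X E, O.f = f ∧ O.src = a ∧ O.tgt = b := by
  have key : ∀ e, ∃ β : Bool,
      X.dsrc (cond β (Sum.inl (f e)) (Sum.inr (f e))) = a e ∧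
        X.dtgt (cond β (Sum.inl (f e)) (Sum.inr (f e))) = b e := by
    intro e
    rcases h e with h | h
    · exact ⟨true, h⟩
    · exact ⟨false, h.symm⟩
  choose β hβ using key
  exact ⟨⟨f, β⟩, rfl, funext fun e => (hβ e).1, funext fun e => (hβ e).2⟩

theorem exists_isPath {n : ℕ} {q : ℕ → X.V} (hn : 1 < n)
    (hinj : ∀ j k, j ≤ n → k ≤ n → q j = q k → j = k)
    (hdeg : ∀ k, k + 1 < n → ∃ e₁ e₂ : X.E, X.Joins e₁ (q k) (q (k + 1)) ∧
      X.Joins e₂ (q (k + 1)) (q (k + 2)) ∧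
      ∀ e, X.src e = q (k + 1) ∨ X.tgt e = q (k + 1) → e = e₁ ∨ e = e₂) :
    ∃ (O : Orient X X.E) (pe : ℕ → X.E), O.f = Equiv.refl _ ∧
      TotalRep.IsPath O.src O.tgt q pe n ∧
      ∀ k, k + 1 < n → ∀ e, X.src e = q (k + 1) ∨ X.tgt e = q (k + 1) →
        e = pe k ∨ e = pe (k + 1) := by
  have hex : ∀ k, ∃ e, k < n → X.Joins e (q k) (q (k + 1)) := by
    intro k
    obtain ⟨e₀, -, h₀, -⟩ := hdeg 0 hn
    rcases k with _ | k
    · exact ⟨e₀, fun _ => h₀⟩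
    · by_cases hk : k + 1 < n
      · obtain ⟨-, e, -, h, -⟩ := hdeg k hk
        exact ⟨e, fun _ => h⟩
      · exact ⟨e₀, fun h => absurd h hk⟩
  choose pe hpe using hex
  have hdisj : ∀ j k e, j < n → k < n → X.Joins e (q j) (q (j + 1)) →
      X.Joins e (q k) (q (k + 1)) → j = k := by
    intro j k e hj hk h h'
    rcases h.eq_or h' with ⟨h1, -⟩ | ⟨h1, h2⟩
    · exact hinj _ _ hj.le hk.le h1
    · have := hinj _ _ hj.le hk h1
      have := hinj _ _ hj hk.le h2
      omega
  have hinc : ∀ k, k + 1 < n → ∀ e, X.src e = q (k + 1) ∨ X.tgt e = q (k + 1) →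
      e = pe k ∨ e = pe (k + 1) := by
    intro k hk e he
    obtain ⟨e₁, e₂, h₁, h₂, h⟩ := hdeg k hk
    have hk' : k < n := by omega
    have h3 : pe k = e₁ := (h _ (hpe k hk').symm.src_or_tgt).resolve_right fun h4 => by
      have := hdisj k (k + 1) _ hk' hk (hpe k hk') (h4 ▸ h₂)
      omega
    have h4 : pe (k + 1) = e₂ := (h _ (hpe _ hk).src_or_tgt).resolve_left fun h4 => by
      have := hdisj (k + 1) k _ hk hk' (hpe _ hk) (h4 ▸ h₁)
      omega
    rw [h3, h4]
    exact h e he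
  have hab : ∀ e, ∃ a b, X.Joins e a b ∧ ∀ k < n, e = pe k → a = q k ∧ b = q (k + 1) := by
    intro e
    by_cases he : ∃ k < n, e = pe k
    · obtain ⟨k, hk, rfl⟩ := he
      refine ⟨_, _, hpe k hk, fun j hj h => ?_⟩
      obtain rfl := hdisj k j _ hk hj (hpe k hk) (h ▸ hpe j hj)
      exact ⟨rfl, rfl⟩
    · exact ⟨_, _, Or.inl ⟨rfl, rfl⟩, fun k hk h => absurd ⟨k, hk, h⟩ he⟩
  choose a b hJ hp using hab
  obtain ⟨O, hf, rfl, rfl⟩ := exists_of_joins (Equiv.refl X.E) hJ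
  refine ⟨O, pe, hf, ⟨fun k hk => (hp _ k hk rfl).1, fun k hk => (hp _ k hk rfl).2, hinj,
    fun k h0 hk e he => ?_, fun k hk e he => ?_⟩, hinc⟩
  · obtain ⟨k, rfl⟩ : ∃ m, k = m + 1 := ⟨k - 1, by omega⟩
    refine (hinc k hk e (he ▸ (hJ e).src_or_tgt)).resolve_left fun h => ?_
    have := hinj _ _ (by omega) hk.le ((hp _ k (by omega) h).1.symm.trans he)
    omega
  · refine (hinc k hk e (he ▸ (hJ e).symm.src_or_tgt)).resolve_right fun h => ?_
    have := hinj _ _ (by omega) (by omega) ((hp _ (k + 1) hk h).2.symm.trans he)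
    omega

end Orient

theorem Expansion.exists_of_graph (X X' : Multigraph) (i : X.V) {r : ℕ} (hr : 1 < r) {q : ℕ → X.V}
    (hqi : q r = i) (hinj : ∀ j k, j ≤ 2 * r → k ≤ 2 * r → q j = q k → j = k)
    (hdeg : ∀ k, k + 1 < 2 * r → ∃ e₁ e₂ : X.E, X.Joins e₁ (q k) (q (k + 1)) ∧
      X.Joins e₂ (q (k + 1)) (q (k + 2)) ∧
      ∀ e, X.src e = q (k + 1) ∨ X.tgt e = q (k + 1) → e = e₁ ∨ e = e₂)
    (eV : ({u : X.V // u ≠ i} ⊕ Bool) ≃ X'.V)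
    (eE : ({e : X.E // X.src e ≠ i ∧ X.tgt e ≠ i} ⊕ Fin 3) ≃ X'.E)
    (hold : ∀ e : {e : X.E // X.src e ≠ i ∧ X.tgt e ≠ i},
      X'.src (eE (Sum.inl e)) = eV (Sum.inl ⟨X.src e.1, e.2.1⟩) ∧
      X'.tgt (eE (Sum.inl e)) = eV (Sum.inl ⟨X.tgt e.1, e.2.2⟩))
    (hnew0 : ∀ h : q (r - 1) ≠ i,
      X'.Joins (eE (Sum.inr 0)) (eV (Sum.inl ⟨q (r - 1), h⟩)) (eV (Sum.inr false)))
    (hnew1 : X'.Joins (eE (Sum.inr 1)) (eV (Sum.inr false)) (eV (Sum.inr true)))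
    (hnew2 : ∀ h : q (r + 1) ≠ i,
      X'.Joins (eE (Sum.inr 2)) (eV (Sum.inr true)) (eV (Sum.inl ⟨q (r + 1), h⟩))) :
    ∃ (Y : Expansion X.V X'.V X.E) (O : Orient X X.E) (O' : Orient X' (Option X.E)),
      O.src = Y.src ∧ O.tgt = Y.tgt ∧ O'.src = Y.src' ∧ O'.tgt = Y.tgt' ∧
      Y.i = i ∧ Y.r = r ∧ Y.q = q ∧
      Y.π = fun u => Sum.elim (fun j => j.1) (fun _ => i) (eV.symm u) := by
  classical
  obtain ⟨O, pe, hf, hp, hinc⟩ := Orient.exists_isPath (by omega) hinj hdeg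
  obtain ⟨m, rfl⟩ : ∃ m, r = m + 1 := ⟨r - 1, by omega⟩
  have hOJ : ∀ e, X.Joins e (O.src e) (O.tgt e) := fun e => by
    simpa [hf] using O.joins e
  let κ : Bool → X.V → X'.V := fun β j => if h : j = i then eV (Sum.inr β) else eV (Sum.inl ⟨j, h⟩)
  have κ_i : ∀ β, κ β i = eV (Sum.inr β) := fun β => dif_pos rfl
  have κ_ne : ∀ β j (h : j ≠ i), κ β j = eV (Sum.inl ⟨j, h⟩) := fun β j h => dif_neg h
  have hl : q m ≠ i := fun h => by
    have := hinj _ _ (by omega) (by omega) (h.trans hqi.symm)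
    omega
  have hrt : q (m + 2) ≠ i := fun h => by
    have := hinj _ _ (by omega) (by omega) (h.trans hqi.symm)
    omega
  have hpl := hp.src m (by omega)
  have hpl' := hp.tgt m (by omega)
  have hpr := hp.src (m + 1) (by omega)
  have hpr' := hp.tgt (m + 1) (by omega)
  have hne : pe m ≠ pe (m + 1) := fun h => by
    rw [h, hpr] at hpl
    exact hl (hpl.symm.trans hqi)
  have hnl : ¬ (X.src (pe m) ≠ i ∧ X.tgt (pe m) ≠ i) := fun h => by
    rcases (hOJ (pe m)).symm.src_or_tgt with h1 | h1
    · exact h.1 (by rw [h1, hpl', hqi])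
    · exact h.2 (by rw [h1, hpl', hqi])
  have hnr : ¬ (X.src (pe (m + 1)) ≠ i ∧ X.tgt (pe (m + 1)) ≠ i) := fun h => by
    rcases (hOJ (pe (m + 1))).src_or_tgt with h1 | h1
    · exact h.1 (by rw [h1, hpr, hqi])
    · exact h.2 (by rw [h1, hpr, hqi])
  let g : {e : X.E // X.src e ≠ i ∧ X.tgt e ≠ i} ⊕ Fin 3 → Option X.E :=
    Sum.elim (fun e => some e.1) ![some (pe m), none, some (pe (m + 1))]
  have hg : Function.Bijective g := by
    constructor
    · rintro (a | a) (b | b) h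
      · exact congrArg _ (Subtype.ext (Option.some_injective _ h))
      · fin_cases b
        · exact absurd (Option.some_injective _ h ▸ a.2) hnl
        · cases h
        · exact absurd (Option.some_injective _ h ▸ a.2) hnr
      · fin_cases a
        · exact absurd ((Option.some_injective _ h).symm ▸ b.2) hnl
        · cases h
        · exact absurd ((Option.some_injective _ h).symm ▸ b.2) hnr
      · congr 1
        fin_cases a <;> fin_cases b <;>
          first
          | rfl
          | exact absurd (Option.some_injective _ h) hne
          | exact absurd (Option.some_injective _ h).symm hne
          | cases h
    · rintro (_ | e)
      · exact ⟨Sum.inr 1, rfl⟩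
      · by_cases h : X.src e ≠ i ∧ X.tgt e ≠ i
        · exact ⟨Sum.inl ⟨e, h⟩, rfl⟩
        · rw [not_and_or, not_not, not_not, ← hqi] at h
          rcases hinc m (by omega) e h with rfl | rfl
          · exact ⟨Sum.inr 0, rfl⟩
          · exact ⟨Sum.inr 2, rfl⟩
  let τ : Option X.E ≃ X'.E := (Equiv.ofBijective g hg).symm.trans eE
  have hτ : ∀ y, τ (g y) = eE y := fun y =>
    congrArg eE ((Equiv.ofBijective g hg).symm_apply_apply y)
  have hJ : ∀ z : Option X.E, X'.Joins (τ z)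
      (z.elim (eV (Sum.inr false)) fun e => κ true (O.src e))
      (z.elim (eV (Sum.inr true)) fun e => κ false (O.tgt e)) := by
    intro z
    obtain ⟨y, rfl⟩ := hg.2 z
    rw [hτ]
    rcases y with e | a
    · obtain ⟨h1, h2⟩ := hold e
      change X'.Joins _ (κ true (O.src e.1)) (κ false (O.tgt e.1))
      rcases hOJ e.1 with ⟨h3, h4⟩ | ⟨h3, h4⟩
      · rw [← h3, ← h4, κ_ne _ _ e.2.1, κ_ne _ _ e.2.2]
        exact Or.inl ⟨h1, h2⟩
      · rw [← h3, ← h4, κ_ne _ _ e.2.1, κ_ne _ _ e.2.2]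
        exact Or.inr ⟨h1, h2⟩
    · fin_cases a
      · change X'.Joins _ (κ true (O.src (pe m))) (κ false (O.tgt (pe m)))
        rw [hpl, hpl', hqi, κ_i, κ_ne _ _ hl]
        exact hnew0 hl
      · exact hnew1
      · change X'.Joins _ (κ true (O.src (pe (m + 1)))) (κ false (O.tgt (pe (m + 1))))
        rw [hpr, hpr', hqi, κ_i, κ_ne _ _ hrt]
        exact hnew2 hrt
  obtain ⟨O', -, hO₁, hO₂⟩ := Orient.exists_of_joins τ hJ
  have hπκ : ∀ β j, Sum.elim (fun j : {u : X.V // u ≠ i} => j.1) (fun _ => i)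
      (eV.symm (κ β j)) = j := by
    intro β j
    by_cases h : j = i
    · subst h; rw [κ_i, Equiv.symm_apply_apply]; rfl
    · rw [κ_ne _ _ h, Equiv.symm_apply_apply]; rfl
  refine ⟨{
    src := O.src
    tgt := O.tgt
    src' := O'.src
    tgt' := O'.tgt
    i := i
    iL := eV (Sum.inr false)
    iR := eV (Sum.inr true)
    π := fun u => Sum.elim (fun j => j.1) (fun _ => i) (eV.symm u)
    κL := κ false
    κR := κ true
    q := q
    pe := pe
    r := m + 1
    r_pos := Nat.succ_pos m
    iL_ne_iR := by simp
    κL_i := κ_i _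
    κR_i := κ_i _
    κL_eq_κR := fun j h => by rw [κ_ne _ _ h, κ_ne _ _ h]
    π_κL := hπκ _
    π_κR := hπκ _
    eq_κL_or := fun u => by
      obtain ⟨j | β, rfl⟩ := eV.surjective u
      · rw [Equiv.symm_apply_apply]
        exact Or.inl (κ_ne _ _ j.2).symm
      · rw [Equiv.symm_apply_apply]
        cases β
        · exact Or.inl (κ_i _).symm
        · exact Or.inr (κ_i _).symm
    src'_some := fun e => congrFun hO₁ (some e)
    tgt'_some := fun e => congrFun hO₂ (some e)
    src'_none := congrFun hO₁ none
    tgt'_none := congrFun hO₂ none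
    path := hp
    q_r := hqi }, O, O', rfl, rfl, rfl, rfl, rfl, rfl, rfl, rfl⟩

/-! ### The bijection on isomorphism classes -/

theorem exists_bijective_quot {α β : Type*} {r : α → α → Prop} {r' : β → β → Prop}
    (hr : Equivalence r) (hr' : Equivalence r') (R : α → β → Prop) (hα : ∀ a, ∃ b, R a b)
    (hβ : ∀ b, ∃ a, R a b) (h : ∀ a a' b b', R a b → R a' b' → (r a a' ↔ r' b b')) :
    ∃ F : Quot r → Quot r', Function.Bijective F ∧
      ∀ a b, F (Quot.mk _ a) = Quot.mk _ b → ∃ b', R a b' ∧ r' b' b := by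
  choose f hf using hα
  refine ⟨Quot.lift (fun a => Quot.mk _ (f a)) fun a a' haa =>
    Quot.sound ((h _ _ _ _ (hf a) (hf a')).1 haa), ⟨?_, ?_⟩, fun a b hab => ⟨f a, hf a, ?_⟩⟩
  · rintro ⟨a⟩ ⟨a'⟩ haa
    exact Quot.sound ((h _ _ _ _ (hf a) (hf a')).2 (hr'.quot_mk_eq_iff _ _ |>.1 haa))
  · rintro ⟨b⟩
    obtain ⟨a, hab⟩ := hβ b
    exact ⟨Quot.mk _ a, Quot.sound ((h _ _ _ _ (hf a) hab).1 (hr.refl a))⟩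
  · exact (hr'.quot_mk_eq_iff _ _).1 hab

theorem TotalRep.Iso.finrank_map_P_out {V E M N : Type} [Fintype V] [AddCommGroup M] [Module ℂ M]
    [AddCommGroup N] [Module ℂ N] [FiniteDimensional ℂ M] {src tgt : E → V}
    {ρ σ : TotalRep src tgt M N} (h : ρ.Iso σ) (j : V) :
    Module.finrank ℂ ((ρ.out ⊤).map (ρ.P j)) = Module.finrank ℂ ((σ.out ⊤).map (σ.P j)) := by
  have key : ∀ {ρ σ : TotalRep src tgt M N} (g : M ≃ₗ[ℂ] M), IsHom ρ σ g.toLinearMap →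
      Module.finrank ℂ ((ρ.out ⊤).map (ρ.P j)) ≤ Module.finrank ℂ ((σ.out ⊤).map (σ.P j)) := by
    intro ρ σ g hg
    rw [← LinearEquiv.finrank_map_eq g]
    refine Submodule.finrank_mono ?_
    rintro _ ⟨_, ⟨m, hm, rfl⟩, rfl⟩
    have h1 : ρ.out ⊤ ≤ (σ.out ⊤).comap g.toLinearMap := TotalRep.out_le fun e m _ =>
      ⟨Submodule.mem_comap.2 (hg.x e m ▸ TotalRep.x_mem_out e trivial),
        Submodule.mem_comap.2 (hg.y e m ▸ TotalRep.y_mem_out e trivial)⟩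
    exact ⟨_, h1 hm, (hg.P j m).symm⟩
  obtain ⟨g, hg⟩ := h
  exact le_antisymm (key g hg) (key g.symm hg.symm)

namespace FramedRep

variable {G : Multigraph} {v w : G.V → ℕ}

theorem good_total_iff {E : Type} [Fintype E] (O : Orient G E) (ρ : FramedRep G v w)
    (S : Set G.V) : (ρ.total O).Good (compP w) S ↔
      ρ.Stable ∧ ρ.IsNilpotentRep ∧ ρ.MomentMap ∧ ∀ j ∈ S, ρ.epsVal j = 0 := by
  constructor
  · intro h
    exact ⟨(stable_iff O ρ h.nil).2 h.socle, (isNilpotentRep_iff O ρ).2 h.nil,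
      (momentMap_iff_total O ρ).2 h.moment, fun j hj => (epsVal_eq_zero_iff O ρ j).2 (h.top j hj)⟩
  · rintro ⟨h1, h2, h3, h4⟩
    have hN := (isNilpotentRep_iff O ρ).1 h2
    exact ⟨(stable_iff O ρ hN).1 h1, hN, (momentMap_iff_total O ρ).1 h3,
      fun j hj => (epsVal_eq_zero_iff O ρ j).1 (h4 j hj), ρ.total_graded O⟩

theorem equivalence_iso : Equivalence (Iso (G := G) (v := v) (w := w)) where
  refl _ := ⟨fun _ => LinearEquiv.refl ℂ _, fun _ => rfl, fun _ => rfl, fun _ => rfl⟩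
  symm := by
    rintro ρ σ ⟨g, hx, hy, ht⟩
    refine ⟨fun j => (g j).symm, fun e => LinearMap.ext fun z => ?_,
      fun e => LinearMap.ext fun z => ?_, fun j => LinearMap.ext fun z => ?_⟩
    · have := LinearMap.congr_fun (hx e) ((g _).symm z)
      simp only [LinearMap.comp_apply, LinearEquiv.coe_coe, LinearEquiv.apply_symm_apply] at this
      simp [← this]
    · have := LinearMap.congr_fun (hy e) ((g _).symm z)
      simp only [LinearMap.comp_apply, LinearEquiv.coe_coe, LinearEquiv.apply_symm_apply] at this
      simp [← this]
    · simp [← ht]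
  trans := by
    rintro ρ σ τ ⟨g, hx, hy, ht⟩ ⟨g', hx', hy', ht'⟩
    refine ⟨fun j => (g j).trans (g' j), fun e => LinearMap.ext fun z => ?_,
      fun e => LinearMap.ext fun z => ?_, fun j => LinearMap.ext fun z => ?_⟩
    · exact (congrArg _ (LinearMap.congr_fun (hx e) z)).trans (LinearMap.congr_fun (hx' e) _)
    · exact (congrArg _ (LinearMap.congr_fun (hy e) z)).trans (LinearMap.congr_fun (hy' e) _)
    · exact (LinearMap.congr_fun (ht' j) _).trans (LinearMap.congr_fun (ht j) z)

theorem Iso.epsVal_eq {ρ σ : FramedRep G v w} (h : ρ.Iso σ) (j : G.V) :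
    ρ.epsVal j = σ.epsVal j := by
  let O : Orient G G.E := ⟨Equiv.refl _, fun _ => true⟩
  rw [FramedRep.epsVal_eq O, FramedRep.epsVal_eq O,
    ((iso_iff_total O ρ σ).1 h).finrank_map_P_out]

end FramedRep

/-- For representations of the two graphs of an expansion there is a correspondence which is
compatible with isomorphisms and preserves the invariants `ε` away from the split vertex. -/
theorem Expansion.exists_correspondence {X X' : Multigraph} (Y : Expansion X.V X'.V X.E)
    (O : Orient X X.E) (O' : Orient X' (Option X.E)) (hs : O.src = Y.src) (ht : O.tgt = Y.tgt)
    (hs' : O'.src = Y.src') (ht' : O'.tgt = Y.tgt') {s : ℕ} (hr : s ≤ Y.r) (v w : X.V → ℕ)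
    (hw : ∀ j ∈ Y.onPath, w j = 0) (hv : ∀ j ∈ Y.onPath, v j ≤ s) :
    ∃ R : FramedRep X v w → FramedRep X' (fun u => v (Y.π u)) (fun u => w (Y.π u)) → Prop,
      (∀ ρ, (ρ.Stable ∧ ρ.IsNilpotentRep ∧ ρ.MomentMap ∧ ∀ j ∈ Y.onPath, ρ.epsVal j = 0) →
        ∃ ρ', (ρ'.Stable ∧ ρ'.IsNilpotentRep ∧ ρ'.MomentMap ∧
          ∀ u ∈ Y.π ⁻¹' Y.onPath, ρ'.epsVal u = 0) ∧ R ρ ρ') ∧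
      (∀ ρ', (ρ'.Stable ∧ ρ'.IsNilpotentRep ∧ ρ'.MomentMap ∧
          ∀ u ∈ Y.π ⁻¹' Y.onPath, ρ'.epsVal u = 0) →
        ∃ ρ, (ρ.Stable ∧ ρ.IsNilpotentRep ∧ ρ.MomentMap ∧ ∀ j ∈ Y.onPath, ρ.epsVal j = 0) ∧
          R ρ ρ') ∧
      (∀ ρ σ ρ' σ',
        (ρ.Stable ∧ ρ.IsNilpotentRep ∧ ρ.MomentMap ∧ ∀ j ∈ Y.onPath, ρ.epsVal j = 0) →
        (σ.Stable ∧ σ.IsNilpotentRep ∧ σ.MomentMap ∧ ∀ j ∈ Y.onPath, σ.epsVal j = 0) →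
        ρ'.MomentMap → σ'.MomentMap → R ρ ρ' → R σ σ' → (ρ.Iso σ ↔ ρ'.Iso σ')) ∧
      ∀ ρ ρ' u, R ρ ρ' → Y.π u ≠ Y.i → ρ.epsVal (Y.π u) = ρ'.epsVal u := by
  obtain ⟨src, tgt, src', tgt', i, iL, iR, π, κL, κR, q, pe, r, h₁, h₂, h₃, h₄, h₅, h₆, h₇, h₈, h₉,
    h₁₀, h₁₁, h₁₂, h₁₃, h₁₄⟩ := Y
  dsimp only at hs ht hs' ht' hr
  subst hs ht hs' ht'
  set Y : Expansion X.V X'.V X.E := ⟨O.src, O.tgt, O'.src, O'.tgt, i, iL, iR, π, κL, κR, q, pe, r,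
    h₁, h₂, h₃, h₄, h₅, h₆, h₇, h₈, h₉, h₁₀, h₁₁, h₁₂, h₁₃, h₁₄⟩
  have hPN : ∀ j ∈ Y.onPath, compP w j = 0 := fun j hj => compP_eq_zero w (hw j hj)
  have hdim : ∀ j ∈ Y.onPath, Module.finrank ℂ (LinearMap.range (compP v j)) ≤ s :=
    fun j hj => (finrank_range_compP v j).trans_le (hv j hj)
  refine ⟨fun ρ ρ' => Nonempty (Link Y (compFrame w π).I (compFrame w π).Q (ρ.total O)
    (ρ'.total O')), fun ρ hρ => ?_, fun ρ' hρ' => ?_,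
    fun ρ σ ρ' σ' hρ hσ hρ' hσ' ⟨L⟩ ⟨K⟩ => ?_, fun ρ ρ' u ⟨L⟩ hu => ?_⟩
  · obtain ⟨τ, hτ, hg, hL⟩ := (compFrame v π).exists_good_double (X := Y) (compFrame w π)
      (isGrading_compP _) (isGrading_compP _) hPN hdim hr rfl
      ((FramedRep.good_total_iff O ρ Y.onPath).2 hρ)
    obtain ⟨ρ', rfl⟩ := FramedRep.exists_total_eq O' hτ hg.graded
    exact ⟨ρ', (FramedRep.good_total_iff O' ρ' _).1 hg, hL⟩
  · obtain ⟨τ, hτ, hg, hL⟩ := (compFrame v π).exists_good_contract (X := Y) (compFrame w π)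
      (isGrading_compP _) (isGrading_compP _) hPN hdim hr rfl
      ((FramedRep.good_total_iff O' ρ' (Y.π ⁻¹' Y.onPath)).2 hρ')
    obtain ⟨ρ, rfl⟩ := FramedRep.exists_total_eq O hτ hg.graded
    exact ⟨ρ, (FramedRep.good_total_iff O ρ _).1 hg, hL⟩
  · rw [FramedRep.iso_iff_total O, FramedRep.iso_iff_total O']
    exact (compFrame w π).iso_iff_of_good (X := Y) hPN hdim rfl rfl
      ((FramedRep.good_total_iff O ρ Y.onPath).2 hρ) ((FramedRep.good_total_iff O σ Y.onPath).2 hσ)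
      ((FramedRep.momentMap_iff_total O' ρ').1 hρ') ((FramedRep.momentMap_iff_total O' σ').1 hσ')
      L K
  · rw [FramedRep.epsVal_eq O, FramedRep.epsVal_eq O', L.finrank_map_P_out hu]

/-- Let `X` be a finite undirected loopless graph, `s ≥ 1`,
`r = 2s+1`, and `c : {−r,…,r} ↪ V(X)` with `c 0 = i`, such that for `|k| < r`
the edges incident to `c k` are exactly one edge joining `c k` to `c (k−1)` and
one edge joining `c k` to `c (k+1)`.  Let `X′` be obtained from `X` by deleting
the vertex `i` (and the edges incident to it) and inserting two vertices
`i′, i″` (encoded `Sum.inr false`, `Sum.inr true`) and three edges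
`c(−1)—i′`, `i′—i″`, `i″—c(1)` (encoded `Sum.inr 0, 1, 2`); the identification
of vertices and edges is given by the equivalences `eV, eE`.  Let `v, w` be
dimension vectors on `X` with `w (c k) = 0` and `v (c k) ≤ s` for `|k| ≤ r`,
and let `v′, w′` be the induced dimension vectors on `X′` (with
`v′ i′ = v′ i″ = v i`, `w′ i′ = w′ i″ = 0`).  Then there is a bijection between
the isomorphism classes of stable nilpotent framed representations of `X`
satisfying the moment map condition with dimension vectors `v, w` and
`ε_{c k} = 0` for `|k| ≤ r`, and the isomorphism classes of stable nilpotent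
framed representations of `X′` satisfying the moment map condition with
dimension vectors `v′, w′` and `ε = 0` along the path
`c(−r),…,c(−1), i′, i″, c(1),…,c(r)`; moreover the bijection preserves `ε_j`
for every vertex `j` not on the path. -/
theorem statement0
    (X X' : Multigraph) (s : ℕ) (hs : 1 ≤ s)
    (c : ℤ → X.V) (i : X.V)
    (hinj : ∀ k k' : ℤ, |k| ≤ 2 * s + 1 → |k'| ≤ 2 * s + 1 → c k = c k' → k = k')
    (hc0 : c 0 = i)
    (hdeg : ∀ k : ℤ, |k| < 2 * s + 1 →
      ∃ e₁ e₂ : X.E, e₁ ≠ e₂ ∧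
        X.Joins e₁ (c (k - 1)) (c k) ∧ X.Joins e₂ (c k) (c (k + 1)) ∧
        ∀ e : X.E, (X.src e = c k ∨ X.tgt e = c k) → e = e₁ ∨ e = e₂)
    -- the identification of `X′` with `(V(X) ∖ {i}) ⊔ {i′, i″}` etc.
    (eV : ({u : X.V // u ≠ i} ⊕ Bool) ≃ X'.V)
    (eE : ({e : X.E // X.src e ≠ i ∧ X.tgt e ≠ i} ⊕ Fin 3) ≃ X'.E)
    (hold : ∀ e : {e : X.E // X.src e ≠ i ∧ X.tgt e ≠ i},
      X'.src (eE (Sum.inl e)) = eV (Sum.inl ⟨X.src e.1, e.2.1⟩) ∧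
      X'.tgt (eE (Sum.inl e)) = eV (Sum.inl ⟨X.tgt e.1, e.2.2⟩))
    (hnew0 : ∀ h : c (-1) ≠ i,
      X'.Joins (eE (Sum.inr 0)) (eV (Sum.inl ⟨c (-1), h⟩)) (eV (Sum.inr false)))
    (hnew1 : X'.Joins (eE (Sum.inr 1)) (eV (Sum.inr false)) (eV (Sum.inr true)))
    (hnew2 : ∀ h : c 1 ≠ i,
      X'.Joins (eE (Sum.inr 2)) (eV (Sum.inr true)) (eV (Sum.inl ⟨c 1, h⟩)))
    -- the dimension vectors
    (v w : X.V → ℕ)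
    (hw : ∀ k : ℤ, |k| ≤ 2 * s + 1 → w (c k) = 0)
    (hv : ∀ k : ℤ, |k| ≤ 2 * s + 1 → v (c k) ≤ s)
    (v' w' : X'.V → ℕ)
    (hv' : v' = fun u => Sum.elim (fun j => v j.1) (fun _ => v i) (eV.symm u))
    (hw' : w' = fun u => Sum.elim (fun j => w j.1) (fun _ => 0) (eV.symm u)) :
    ∃ F : Quot (fun ρ σ : {ρ : FramedRep X v w //
              ρ.Stable ∧ ρ.IsNilpotentRep ∧ ρ.MomentMap ∧
                ∀ k : ℤ, |k| ≤ 2 * s + 1 → ρ.epsVal (c k) = 0} =>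
            FramedRep.Iso ρ.1 σ.1) →
          Quot (fun ρ σ : {ρ : FramedRep X' v' w' //
              ρ.Stable ∧ ρ.IsNilpotentRep ∧ ρ.MomentMap ∧
                ((∀ (k : ℤ) (h : c k ≠ i), |k| ≤ 2 * s + 1 →
                    ρ.epsVal (eV (Sum.inl ⟨c k, h⟩)) = 0) ∧
                  ρ.epsVal (eV (Sum.inr false)) = 0 ∧
                  ρ.epsVal (eV (Sum.inr true)) = 0)} =>
            FramedRep.Iso ρ.1 σ.1),
      Function.Bijective F ∧
      -- the bijection preserves `ε_j` for every vertex `j` off the path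
      ∀ ρ ρ', F (Quot.mk _ ρ) = Quot.mk _ ρ' →
        ∀ (u : X.V) (hu : u ≠ i), (∀ k : ℤ, |k| ≤ 2 * s + 1 → u ≠ c k) →
          (ρ.1).epsVal u = (ρ'.1).epsVal (eV (Sum.inl ⟨u, hu⟩)) := by
  have hq0 : c (((2 * s + 1 : ℕ) : ℤ) - (2 * s + 1)) = i := by
    rw [← hc0]; congr 1; push_cast; ring
  obtain ⟨Y, O, O', h1, h2, h3, h4, hYi, hYr, hYq, hYπ⟩ := Expansion.exists_of_graph X X' i
    (r := 2 * s + 1) (q := fun k => c ((k : ℤ) - (2 * s + 1))) (by omega) hq0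
    (fun j k hj hk h => by
      have := hinj _ _ (by rw [abs_le]; constructor <;> omega)
        (by rw [abs_le]; constructor <;> omega) h
      omega)
    (fun k hk => by
      obtain ⟨e₁, e₂, -, h1, h2, h3⟩ := hdeg (((k + 1 : ℕ) : ℤ) - (2 * s + 1))
        (by rw [abs_lt]; constructor <;> omega)
      refine ⟨e₁, e₂, ?_, ?_, h3⟩
      · convert h1 using 2; push_cast; ring
      · convert h2 using 2; push_cast; ring)
    eV eE hold
    (fun h => by
      have hc : c (((2 * s + 1 - 1 : ℕ) : ℤ) - (2 * s + 1)) = c (-1) := by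
        congr 1; push_cast; ring
      convert hnew0 (hc ▸ h))
    hnew1
    (fun h => by
      have hc : c (((2 * s + 1 + 1 : ℕ) : ℤ) - (2 * s + 1)) = c 1 := by
        congr 1; push_cast; ring
      convert hnew2 (hc ▸ h))
  have hmem : ∀ j, j ∈ Y.onPath ↔ ∃ k : ℤ, |k| ≤ 2 * s + 1 ∧ c k = j := by
    intro j
    rw [Expansion.onPath, Set.mem_ofPred_eq, hYr, hYq]
    constructor
    · rintro ⟨k, hk, h⟩
      exact ⟨_, by rw [abs_le]; constructor <;> omega, h⟩
    · rintro ⟨k, hk, h⟩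
      rw [abs_le] at hk
      refine ⟨(k + (2 * s + 1)).toNat, by omega, ?_⟩
      rw [← h]
      change c _ = c _
      congr 1
      omega
  have hpath : ∀ p : X.V → Prop, (∀ j ∈ Y.onPath, p j) ↔ ∀ k : ℤ, |k| ≤ 2 * s + 1 → p (c k) :=
    fun p => ⟨fun h k hk => h _ ((hmem _).2 ⟨k, hk, rfl⟩), fun h j hj => by
      obtain ⟨k, hk, rfl⟩ := (hmem j).1 hj
      exact h k hk⟩
  have hπl : ∀ j, Y.π (eV (Sum.inl j)) = j.1 := fun j => by
    rw [hYπ]; exact congrArg _ (eV.symm_apply_apply _)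
  have hπr : ∀ β, Y.π (eV (Sum.inr β)) = i := fun β => by
    rw [hYπ]; exact congrArg _ (eV.symm_apply_apply _)
  have hpath' : ∀ p : X'.V → Prop, (∀ u ∈ Y.π ⁻¹' Y.onPath, p u) ↔
      (∀ (k : ℤ) (h : c k ≠ i), |k| ≤ 2 * s + 1 → p (eV (Sum.inl ⟨c k, h⟩))) ∧
        p (eV (Sum.inr false)) ∧ p (eV (Sum.inr true)) := by
    intro p
    have hi : ∀ β, eV (Sum.inr β) ∈ Y.π ⁻¹' Y.onPath := fun β => by
      rw [Set.mem_preimage, hπr, ← hYi]; exact Y.i_mem_onPath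
    refine ⟨fun h => ⟨fun k hki hk => h _ ?_, h _ (hi _), h _ (hi _)⟩, fun h u hu => ?_⟩
    · rw [Set.mem_preimage, hπl]
      exact (hmem _).2 ⟨k, hk, rfl⟩
    · obtain ⟨⟨j, hj⟩ | β, rfl⟩ := eV.surjective u
      · rw [Set.mem_preimage, hπl] at hu
        obtain ⟨k, hk, rfl⟩ := (hmem _).1 hu
        exact h.1 k hj hk
      · cases β
        · exact h.2.1
        · exact h.2.2
  have hv'' : v' = fun u => v (Y.π u) := by
    rw [hv']
    funext u
    obtain ⟨j | β, rfl⟩ := eV.surjective u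
    · rw [hπl, Equiv.symm_apply_apply, Sum.elim_inl]
    · rw [hπr, Equiv.symm_apply_apply, Sum.elim_inr]
  have hw'' : w' = fun u => w (Y.π u) := by
    rw [hw']
    funext u
    obtain ⟨j | β, rfl⟩ := eV.surjective u
    · rw [hπl, Equiv.symm_apply_apply, Sum.elim_inl]
    · rw [hπr, Equiv.symm_apply_apply, Sum.elim_inr, ← hc0, hw 0 (by rw [abs_zero]; positivity)]
  clear hv' hw'
  subst hv'' hw''
  obtain ⟨R, hR₁, hR₂, hR₃, hR₄⟩ := Y.exists_correspondence O O' h1 h2 h3 h4 (s := s)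
    (by omega) v w ((hpath _).2 hw) ((hpath _).2 hv)
  simp only [hpath, hpath'] at hR₁ hR₂ hR₃
  refine Exists.imp (fun F hF => ⟨hF.1, fun ρ ρ' h u hu _ => ?_⟩) (exists_bijective_quot
    (FramedRep.equivalence_iso.comap Subtype.val) (FramedRep.equivalence_iso.comap Subtype.val)
    (fun ρ ρ' => R ρ.1 ρ'.1) (fun ρ => ?_) (fun ρ' => ?_)
    fun ρ σ ρ' σ' => hR₃ ρ.1 σ.1 ρ'.1 σ'.1 ρ.2 σ.2 ρ'.2.2.2.1 σ'.2.2.2.1)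
  · obtain ⟨σ, hR, hσ⟩ := hF.2 ρ ρ' h
    have hu' := hπl ⟨u, hu⟩
    have h5 := hR₄ _ _ (eV (Sum.inl ⟨u, hu⟩)) hR (by rwa [hu', hYi])
    rw [hu'] at h5
    exact h5.trans (FramedRep.Iso.epsVal_eq hσ _)
  · obtain ⟨ρ', h, hR⟩ := hR₁ ρ.1 ρ.2
    exact ⟨⟨ρ', h⟩, hR⟩
  · obtain ⟨ρ, h, hR⟩ := hR₂ ρ'.1 ρ'.2
    exact ⟨⟨ρ, h⟩, hR⟩
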